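/- arXiv:1203.4274 — 4 statements merged into one kernel-verified Lean document; each statement's English description precedes it below -/
import Mathlib

section
/- The Griffiths space 𝒢 is not homotopy equivalent to the Formal Harmonic archipelago HA; that is, there is no homotopy equivalence of topological spaces between 𝒢 and HA. -/
/-- The cone over a subset `A` of `ℝ³` with vertex `v`. -/
def cone (A : Set (ℝ × ℝ × ℝ)) (v : ℝ × ℝ × ℝ) : Set (ℝ × ℝ × ℝ) :=
  {p | ∃ a ∈ A, ∃ t ∈ Set.Icc (0 : ℝ) 1, p = (1 - t) • a + t • v}

/-- The circle `C_n ⊆ ℝ³` of radius `1/(3n(n+1))` centered at `(0, 1/n, 0)`. -/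
def circleC (n : ℕ) : Set (ℝ × ℝ × ℝ) :=
  {p | p.1 ^ 2 + (p.2.1 - 1 / n) ^ 2 = (1 / (3 * n * (n + 1))) ^ 2 ∧ p.2.2 = 0}

/-- The Formal Harmonic archipelago `HA ⊆ ℝ³`. -/
def formalHarmonicArchipelago : Set (ℝ × ℝ × ℝ) :=
  (⋃ (n : ℕ) (_ : 1 ≤ n), cone (circleC n) (0, 1 / n, 1)) ∪
    (⋃ (n : ℕ) (_ : 1 ≤ n), {p : ℝ × ℝ × ℝ | p.1 = 0 ∧
      p.2.1 ∈ Set.Icc ((3 * n + 7) / (3 * (n + 1) * (n + 2)) : ℝ)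
        ((3 * n + 2) / (3 * n * (n + 1))) ∧ p.2.2 = 0}) ∪
    {(0, 0, 0)}

/-- The Hawaiian earring `ℍ₊` in the plane `z = 0` of `ℝ³`, with circles tangent from above. -/
def hawaiianPlus : Set (ℝ × ℝ × ℝ) :=
  ⋃ (n : ℕ) (_ : 1 ≤ n),
    {p : ℝ × ℝ × ℝ | p.1 ^ 2 + (p.2.1 - 1 / n) ^ 2 = (1 / n) ^ 2 ∧ p.2.2 = 0}

/-- The Hawaiian earring `ℍ₋` in the plane `z = 0` of `ℝ³`, with circles tangent from below. -/
def hawaiianMinus : Set (ℝ × ℝ × ℝ) :=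
  ⋃ (n : ℕ) (_ : 1 ≤ n),
    {p : ℝ × ℝ × ℝ | p.1 ^ 2 + (p.2.1 + 1 / n) ^ 2 = (1 / n) ^ 2 ∧ p.2.2 = 0}

/-- The Griffiths space `𝒢 ⊆ ℝ³`: the union of the cones over `ℍ₊` and `ℍ₋` with vertices
`(0,0,1)` and `(0,0,-1)`. -/
def griffithsSpace : Set (ℝ × ℝ × ℝ) :=
  cone hawaiianPlus (0, 0, 1) ∪ cone hawaiianMinus (0, 0, -1)

open Set Filter Topology unitInterval

/-- Homotopy lifting through the exponential. -/
lemma exp_lift_homotopy {A : Type*} [TopologicalSpace A] (F : I × A → ℂ) (hF : Continuous F)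
    (hF0 : ∀ p, F p ≠ 0) (f0 : A → ℂ) (hf0 : Continuous f0)
    (h0 : ∀ a, F (0, a) = Complex.exp (f0 a)) :
    ∃ L : A → ℂ, Continuous L ∧ ∀ a, Complex.exp (L a) = F (1, a) := by
  let H : C(I × A, {z : ℂ // z ≠ 0}) := ⟨fun p => ⟨F p, hF0 p⟩, by fun_prop⟩
  have hl := Complex.isCoveringMap_exp.liftHomotopy_lifts H ⟨f0, hf0⟩
    (fun a => Subtype.ext (h0 a))
  refine ⟨fun a => Complex.isCoveringMap_exp.liftHomotopy H ⟨f0, hf0⟩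
    (fun a => Subtype.ext (h0 a)) (1, a), ?_, ?_⟩
  · exact (ContinuousMap.continuous _).comp (by fun_prop)
  · intro a
    exact congrArg Subtype.val (congrFun hl (1, a))

/-- Nonvanishing functions on star-shaped sets have logarithms. -/
lemma exp_lift_star {S : Set (ℝ × ℝ × ℝ)} {v : ℝ × ℝ × ℝ} (hv : v ∈ S)
    (hS : ∀ p ∈ S, ∀ t : I, (t : ℝ) • p + (1 - (t : ℝ)) • v ∈ S)
    (φ : ℝ × ℝ × ℝ → ℂ) (hφ : ContinuousOn φ S) (hne : ∀ p ∈ S, φ p ≠ 0) :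
    ∃ L : ℝ × ℝ × ℝ → ℂ, ContinuousOn L S ∧ ∀ p ∈ S, Complex.exp (L p) = φ p := by
  classical
  have hφ' : Continuous (fun p : S => φ p) := continuousOn_iff_continuous_domRestrict.1 hφ
  obtain ⟨L, hL, hL'⟩ := exp_lift_homotopy (A := S)
    (fun q => φ ((⟨_, hS q.2 q.2.2 q.1⟩ : S) : ℝ × ℝ × ℝ))
    (hφ'.comp (by fun_prop)) (fun q => hne _ (hS q.2 q.2.2 q.1))
    (fun _ => Complex.log (φ v)) continuous_const
    (fun a => by simp [Complex.exp_log (hne v hv)])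
  refine ⟨fun p => if h : p ∈ S then L ⟨p, h⟩ else 0, ?_, ?_⟩
  · rw [continuousOn_iff_continuous_domRestrict]
    convert hL using 1
    ext p; simp
  · intro p hp
    simpa [hp] using hL' ⟨p, hp⟩

lemma no_circle_log (R : ℝ) (L : Circle → ℂ) (hL : Continuous L)
    (h : ∀ w : Circle, Complex.exp (L w) = R * w) : False := by
  have key : (fun θ : ℝ => L (Circle.exp θ)) = fun θ : ℝ => θ * Complex.I + L 1 := by
    refine Complex.isCoveringMap_exp.eq_of_comp_eq (by fun_prop) (by fun_prop) ?_ 0 (by simp)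
    ext θ
    simp only [Function.comp]
    rw [h, Complex.exp_add, h]
    simp [mul_comm]
  have := congrFun key (2 * Real.pi)
  simp [Real.pi_ne_zero] at this

lemma cone_star (A : Set (ℝ × ℝ × ℝ)) (v : ℝ × ℝ × ℝ) :
    ∀ p ∈ cone A v, ∀ t : I, (t : ℝ) • p + (1 - (t : ℝ)) • v ∈ cone A v := by
  rintro p ⟨a, ha, s, ⟨hs0, hs1⟩, rfl⟩ ⟨t, ht0, ht1⟩
  refine ⟨a, ha, 1 - t * (1 - s), ⟨by nlinarith, by nlinarith⟩, ?_⟩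
  simp only
  module

lemma cone_compact {A : Set (ℝ × ℝ × ℝ)} (hA : IsCompact A) (v : ℝ × ℝ × ℝ) :
    IsCompact (cone A v) := by
  have : cone A v = (fun q : (ℝ × ℝ × ℝ) × ℝ => (1 - q.2) • q.1 + q.2 • v) ''
      (A ×ˢ Set.Icc (0 : ℝ) 1) := by
    ext p
    constructor
    · rintro ⟨a, ha, t, ht, rfl⟩
      exact ⟨(a, t), ⟨ha, ht⟩, rfl⟩
    · rintro ⟨⟨a, t⟩, ⟨ha, ht⟩, rfl⟩
      exact ⟨a, ha, t, ht, rfl⟩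
  rw [this]
  exact (hA.prod isCompact_Icc).image (by fun_prop)

lemma earring_compact (c : ℝ) (hc : c ^ 2 = 1) :
    IsCompact (⋃ (n : ℕ) (_ : 1 ≤ n),
      {p : ℝ × ℝ × ℝ | p.1 ^ 2 + (p.2.1 - c * (1 / n)) ^ 2 = (1 / n) ^ 2 ∧ p.2.2 = 0}) := by
  have ht : Tendsto (fun n : ℕ => 1 / ((n : ℝ) + 1)) atTop (𝓝 0) :=
    tendsto_one_div_add_atTop_nhds_zero_nat
  have hK : IsCompact (insert (0 : ℝ) (range fun n : ℕ => 1 / ((n : ℝ) + 1))) :=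
    ht.isCompact_insert_range
  have hC := (hK.prod (isCompact_univ : IsCompact (univ : Set Circle))).image
    (f := fun q : ℝ × Circle =>
      ((q.1 * (q.2 : ℂ).re, q.1 * (q.2 : ℂ).im + c * q.1, 0) : ℝ × ℝ × ℝ)) (by
      have h1 : Continuous fun q : ℝ × Circle => (q.2 : ℂ).re :=
        Complex.continuous_re.comp (continuous_subtype_val.comp continuous_snd)
      have h2 : Continuous fun q : ℝ × Circle => (q.2 : ℂ).im :=
        Complex.continuous_im.comp (continuous_subtype_val.comp continuous_snd)
      fun_prop)
  convert hC using 1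
  ext ⟨x, y, z⟩
  simp only [mem_iUnion, mem_ofPred_eq, exists_prop, mem_image, Prod.exists, mem_prod, mem_univ,
    and_true, Prod.mk.injEq]
  constructor
  · rintro ⟨n, hn, h, rfl⟩
    have hn0 : (0 : ℝ) < n := by exact_mod_cast hn
    have hw : (⟨n * x, n * (y - c * (1 / n))⟩ : ℂ) ∈ Submonoid.unitSphere ℂ := by
      rw [Submonoid.unitSphere, ← SetLike.mem_coe]
      change _ ∈ Metric.sphere (0 : ℂ) 1
      rw [mem_sphere_zero_iff_norm, ← sq_eq_sq₀ (norm_nonneg _) zero_le_one,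
        ← Complex.normSq_eq_norm_sq, Complex.normSq_apply]
      have : (n : ℝ) ^ 2 * (1 / n) ^ 2 = 1 := by field_simp
      linear_combination (n : ℝ) ^ 2 * h + this
    refine ⟨1 / n, ⟨_, hw⟩, Or.inr ⟨n - 1, ?_⟩, ?_, ?_, rfl⟩
    · simp [Nat.cast_sub hn]
    · simp only; field_simp
    · simp only; field_simp; ring
  · rintro ⟨s, w, hs, rfl, rfl, rfl⟩
    have hw := Circle.normSq_coe w
    rw [Complex.normSq_apply] at hw
    rcases hs with rfl | ⟨n, rfl⟩
    · exact ⟨1, le_rfl, by simp [hc], rfl⟩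
    · refine ⟨n + 1, by omega, ?_, rfl⟩
      push_cast
      linear_combination (1 / ((n : ℝ) + 1)) ^ 2 * hw

lemma hawaiianPlus_compact : IsCompact hawaiianPlus := by
  have := earring_compact 1 (by norm_num)
  simpa [hawaiianPlus] using this

lemma hawaiianMinus_compact : IsCompact hawaiianMinus := by
  have := earring_compact (-1) (by norm_num)
  simpa [hawaiianMinus] using this

lemma griffiths_compact : IsCompact griffithsSpace :=
  (cone_compact hawaiianPlus_compact _).union (cone_compact hawaiianMinus_compact _)

lemma zero_mem_plus : (0 : ℝ × ℝ × ℝ) ∈ hawaiianPlus := by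
  simp only [hawaiianPlus, mem_iUnion]
  exact ⟨1, le_rfl, by simp⟩

lemma zero_mem_minus : (0 : ℝ × ℝ × ℝ) ∈ hawaiianMinus := by
  simp only [hawaiianMinus, mem_iUnion]
  exact ⟨1, le_rfl, by simp⟩

lemma cones_inter {p : ℝ × ℝ × ℝ} (h1 : p ∈ cone hawaiianPlus (0, 0, 1))
    (h2 : p ∈ cone hawaiianMinus (0, 0, -1)) : p = 0 := by
  obtain ⟨⟨a1, a2, a3⟩, ha, t, ⟨ht0, ht1⟩, rfl⟩ := h1
  obtain ⟨⟨b1, b2, b3⟩, hb, s, ⟨hs0, hs1⟩, hp⟩ := h2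
  simp only [hawaiianPlus, hawaiianMinus, mem_iUnion, mem_ofPred_eq, exists_prop] at ha hb
  obtain ⟨n, hn, ha, rfl⟩ := ha
  obtain ⟨m, hm, hb, rfl⟩ := hb
  simp only [Prod.smul_mk, smul_eq_mul, Prod.mk_add_mk, Prod.mk.injEq] at hp
  obtain ⟨e1, e2, e3⟩ := hp
  have ht : t = 0 := by linarith
  have hs : s = 0 := by linarith
  subst ht hs
  have hn' : (0 : ℝ) < 1 / n := by positivity
  have hm' : (0 : ℝ) < 1 / m := by positivity
  have e1' : a1 = b1 := by linarith
  have e2' : a2 = b2 := by linarith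
  subst e1' e2'
  have h1 : 0 ≤ a2 := by
    by_contra! h
    nlinarith [sq_nonneg a1, mul_pos hn' (neg_pos.2 h)]
  have h2 : a2 ≤ 0 := by
    by_contra! h
    nlinarith [sq_nonneg a1, mul_pos hm' h]
  have h3 : a2 = 0 := le_antisymm h2 h1
  subst h3
  have : a1 = 0 := by
    have : a1 ^ 2 = 0 := by linarith
    simpa using this
  subst this
  simp

lemma vertex_mem_cone {A : Set (ℝ × ℝ × ℝ)} (h0 : 0 ∈ A) (v : ℝ × ℝ × ℝ) : v ∈ cone A v :=
  ⟨0, h0, 1, by simp, by simp⟩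

lemma base_mem_cone {A : Set (ℝ × ℝ × ℝ)} {a : ℝ × ℝ × ℝ} (h : a ∈ A) (v : ℝ × ℝ × ℝ) :
    a ∈ cone A v :=
  ⟨a, h, 0, by simp, by simp⟩

/-- Nonvanishing functions on the Griffiths space have logarithms. -/
lemma griffiths_log (φ : griffithsSpace → ℂ) (hφ : Continuous φ) (hne : ∀ p, φ p ≠ 0) :
    ∃ L : griffithsSpace → ℂ, Continuous L ∧ ∀ p, Complex.exp (L p) = φ p := by
  classical
  set S1 := cone hawaiianPlus (0, 0, 1) with hS1
  set S2 := cone hawaiianMinus (0, 0, -1) with hS2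
  have hG : griffithsSpace = S1 ∪ S2 := rfl
  let ψ : ℝ × ℝ × ℝ → ℂ := fun p => if h : p ∈ griffithsSpace then φ ⟨p, h⟩ else 0
  have hψφ : ∀ p : griffithsSpace, ψ p = φ p := fun p => by simp [ψ]
  have hψ : ContinuousOn ψ griffithsSpace := by
    rw [continuousOn_iff_continuous_domRestrict]
    convert hφ using 1
    ext p; exact hψφ p
  have hψ0 : ∀ p ∈ griffithsSpace, ψ p ≠ 0 := fun p hp => by
    rw [hψφ ⟨p, hp⟩]; exact hne _
  obtain ⟨L1, hL1, hL1'⟩ := exp_lift_star (vertex_mem_cone zero_mem_plus (0, 0, 1))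
    (cone_star _ _) ψ (hψ.mono subset_union_left) (fun p hp => hψ0 p (Or.inl hp))
  obtain ⟨L2, hL2, hL2'⟩ := exp_lift_star (vertex_mem_cone zero_mem_minus (0, 0, -1))
    (cone_star _ _) ψ (hψ.mono subset_union_right) (fun p hp => hψ0 p (Or.inr hp))
  have hz1 := hL1' 0 (base_mem_cone zero_mem_plus _)
  have hz2 := hL2' 0 (base_mem_cone zero_mem_minus _)
  let L : ℝ × ℝ × ℝ → ℂ := fun p => if p ∈ S1 then L1 p else L2 p + (L1 0 - L2 0)
  have hA : ∀ p ∈ S1, L p = L1 p := fun p hp => by simp [L, hp]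
  have hB : ∀ p ∈ S2, L p = L2 p + (L1 0 - L2 0) := fun p hp => by
    by_cases h : p ∈ S1
    · rw [hA p h, cones_inter h hp]; ring
    · simp [L, h]
  have hL : ContinuousOn L griffithsSpace := by
    rw [hG]
    refine ContinuousOn.union_of_isClosed (hL1.congr hA)
      ((hL2.add continuousOn_const).congr hB)
      (cone_compact hawaiianPlus_compact _).isClosed
      (cone_compact hawaiianMinus_compact _).isClosed
  refine ⟨fun p => L p, continuousOn_iff_continuous_domRestrict.1 hL, ?_⟩
  rintro ⟨p, hp⟩
  rw [← hψφ]
  rcases hp with hp | hp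
  · simp only [hA p hp, hL1' p hp]
  · simp only [hB p hp]
    rw [Complex.exp_add, Complex.exp_sub, hz1, hz2, hL2' p hp, div_self, mul_one]
    exact hψ0 0 (Or.inl (base_mem_cone zero_mem_plus _))

/-- The only point of `HA` over `(0, 1/M)` is the apex. -/
lemma HA_apex {p : ℝ × ℝ × ℝ} (hp : p ∈ formalHarmonicArchipelago) {M : ℕ} (hM : 1 ≤ M)
    (h1 : p.1 = 0) (h2 : p.2.1 = 1 / M) : p = (0, 1 / (M : ℝ), 1) := by
  have hM0 : (0 : ℝ) < M := by exact_mod_cast hM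
  rcases hp with (hp | hp) | hp
  · simp only [mem_iUnion] at hp
    obtain ⟨n, hn, ⟨a1, a2, a3⟩, ⟨ha, ha3⟩, t, ⟨ht0, ht1⟩, rfl⟩ := hp
    have hn0 : (0 : ℝ) < n := by exact_mod_cast hn
    simp only [Prod.smul_mk, smul_eq_mul, Prod.mk_add_mk] at h1 h2 ha ha3 ⊢
    set r : ℝ := 1 / (3 * n * (n + 1)) with hr
    have hr0 : 0 < r := by positivity
    have e : (1 / (M : ℝ) - 1 / n) ^ 2 = (1 - t) ^ 2 * r ^ 2 := by
      rw [← ha, ← h2]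
      have : ((1 - t) * a1) ^ 2 = 0 := by
        have : (1 - t) * a1 = 0 := by linarith
        rw [this]; ring
      linear_combination -this
    by_cases hnM : n = M
    · subst hnM
      have : (1 - t) ^ 2 = 0 := by
        have : (1 - t) ^ 2 * r ^ 2 = 0 := by rw [← e]; ring
        exact (mul_eq_zero.1 this).resolve_right (by positivity)
      have ht : t = 1 := by
        have : 1 - t = 0 := by simpa using this
        linarith
      subst ht
      simp
    · exfalso
      have hle : (1 / (M : ℝ) - 1 / n) ^ 2 ≤ r ^ 2 := by
        rw [e]
        have : (1 - t) ^ 2 ≤ 1 := by nlinarith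
        nlinarith [sq_nonneg r]
      have hab := abs_le.1 (abs_le_of_sq_le_sq hle hr0.le)
      have e1 : r * (3 * n * (n + 1)) = 1 := by rw [hr]; field_simp
      have e2 : (1 / (M : ℝ) - 1 / n) * (n * M) = n - M := by field_simp
      have hnr : n * r * (3 * (n + 1)) = 1 := by linarith
      have hk : 0 < (n : ℝ) * r := by positivity
      rcases lt_or_gt_of_ne hnM with h | h
      · have h' : (n : ℝ) + 1 ≤ M := by exact_mod_cast h
        have := mul_le_mul_of_nonneg_right hab.1 (by positivity : (0 : ℝ) ≤ n * M)
        rw [e2] at this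
        have h3 : (M : ℝ) - n ≤ n * r * M := by linarith
        have h4 : ((M : ℝ) - n) * (3 * (n + 1)) ≤ M := by
          calc _ ≤ n * r * M * (3 * (n + 1)) := by gcongr
            _ = M := by linear_combination (M : ℝ) * hnr
        nlinarith
      · have h' : (M : ℝ) + 1 ≤ n := by exact_mod_cast h
        have := mul_le_mul_of_nonneg_right hab.2 (by positivity : (0 : ℝ) ≤ n * M)
        rw [e2] at this
        have h3 : (n : ℝ) - M ≤ n * r * M := by linarith
        have h4 : ((n : ℝ) - M) * (3 * (n + 1)) ≤ M := by
          calc _ ≤ n * r * M * (3 * (n + 1)) := by gcongr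
            _ = M := by linear_combination (M : ℝ) * hnr
        nlinarith
  · simp only [mem_iUnion] at hp
    obtain ⟨n, hn, -, ⟨hl, hu⟩, -⟩ := hp
    exfalso
    have hn0 : (0 : ℝ) < n := by exact_mod_cast hn
    rw [h2] at hl hu
    rw [div_le_div_iff₀ (by positivity) hM0] at hl
    rw [div_le_div_iff₀ hM0 (by positivity)] at hu
    rcases le_or_gt M n with h | h
    · have h' : (M : ℝ) ≤ n := by exact_mod_cast h
      nlinarith
    · have h' : (n : ℝ) + 1 ≤ M := by exact_mod_cast h
      nlinarith
  · rw [mem_singleton_iff] at hp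
    subst hp
    simp only at h2
    exact absurd h2.symm (by positivity)

lemma limit_not_mem_HA : ((0, 0, 1) : ℝ × ℝ × ℝ) ∉ formalHarmonicArchipelago := by
  rintro ((hp | hp) | hp)
  · simp only [mem_iUnion] at hp
    obtain ⟨n, hn, ⟨a1, a2, a3⟩, ⟨ha, ha3⟩, t, ⟨ht0, ht1⟩, h⟩ := hp
    have hn0 : (0 : ℝ) < n := by exact_mod_cast hn
    simp only [Prod.smul_mk, smul_eq_mul, Prod.mk_add_mk, Prod.mk.injEq] at h ha3
    obtain ⟨-, h2, h3⟩ := h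
    have : t = 1 := by rw [ha3] at h3; linarith
    subst this
    have : (0 : ℝ) < 1 / n := by positivity
    linarith
  · simp only [mem_iUnion] at hp
    obtain ⟨n, hn, -, -, h⟩ := hp
    simp at h
  · simp at hp

/-- A compact subset of `HA` contains only finitely many apexes. -/
lemma compact_apex {K : Set formalHarmonicArchipelago} (hK : IsCompact K) :
    ∀ᶠ n : ℕ in atTop, ∀ p ∈ K, (p : ℝ × ℝ × ℝ) ≠ (0, 1 / (n : ℝ), 1) := by
  have hc : IsClosed ((↑) '' K : Set (ℝ × ℝ × ℝ)) :=
    (hK.image continuous_subtype_val).isClosed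
  have ht : Tendsto (fun n : ℕ => ((0, 1 / (n : ℝ), 1) : ℝ × ℝ × ℝ)) atTop (𝓝 (0, 0, 1)) :=
    tendsto_const_nhds.prodMk_nhds (tendsto_one_div_atTop_nhds_zero_nat.prodMk_nhds
      tendsto_const_nhds)
  have hm : ((↑) '' K : Set (ℝ × ℝ × ℝ))ᶜ ∈ 𝓝 ((0, 0, 1) : ℝ × ℝ × ℝ) := by
    refine hc.isOpen_compl.mem_nhds ?_
    rintro ⟨p, -, hp⟩
    exact limit_not_mem_HA (hp ▸ p.2)
  filter_upwards [ht hm] with n hn p hp he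
  exact hn ⟨p, hp, he⟩

lemma circle_mem_HA {M : ℕ} (hM : 1 ≤ M) {p : ℝ × ℝ × ℝ} (hp : p ∈ circleC M) :
    p ∈ formalHarmonicArchipelago := by
  refine Or.inl (Or.inl ?_)
  simp only [mem_iUnion]
  exact ⟨M, hM, base_mem_cone hp _⟩

lemma circleC_bound {M : ℕ} (hM : 1 ≤ M) {p : ℝ × ℝ × ℝ} (hp : p ∈ circleC M) :
    ‖p‖ ≤ 2 / M := by
  obtain ⟨x, y, z⟩ := p
  obtain ⟨h, h3⟩ := hp
  simp only at h h3
  have hM0 : (1 : ℝ) ≤ M := by exact_mod_cast hM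
  have hr : (1 : ℝ) / (3 * M * (M + 1)) ≤ 1 / M := by
    apply one_div_le_one_div_of_le <;> nlinarith
  have hr0 : (0 : ℝ) < 1 / (3 * M * (M + 1)) := by positivity
  have hx := abs_le.1 <| abs_le_of_sq_le_sq (show x ^ 2 ≤ _ from by rw [← h]; nlinarith [sq_nonneg (y - 1 / M)]) hr0.le
  have hy := abs_le.1 <| abs_le_of_sq_le_sq (show (y - 1 / M) ^ 2 ≤ _ from by rw [← h]; nlinarith [sq_nonneg x]) hr0.le
  have e : (2 : ℝ) / M = 2 * (1 / M) := by ring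
  rw [e]
  have : (0 : ℝ) < 1 / M := by positivity
  rw [Prod.norm_def, Prod.norm_def]
  simp only [h3, norm_zero, Real.norm_eq_abs]
  refine max_le (abs_le.2 ⟨by linarith, by linarith⟩)
    (max_le (abs_le.2 ⟨by linarith, by linarith⟩) (by positivity))

/-- For large `M`, the homotopy restricted to `C_M` avoids the apex over `C_M`. -/
lemma homotopy_avoids (H : I × formalHarmonicArchipelago → formalHarmonicArchipelago)
    (hH : Continuous H) :
    ∀ᶠ M : ℕ in atTop, ∀ p : formalHarmonicArchipelago, (p : ℝ × ℝ × ℝ) ∈ circleC M →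
      ∀ t : I, (H (t, p) : ℝ × ℝ × ℝ) ≠ (0, 1 / (M : ℝ), 1) := by
  classical
  let o : formalHarmonicArchipelago := ⟨(0, 0, 0), Or.inr rfl⟩
  let B : ℕ → formalHarmonicArchipelago → Prop := fun M p =>
    (p : ℝ × ℝ × ℝ) ∈ circleC M ∧ ∃ t : I, (H (t, p) : ℝ × ℝ × ℝ) = (0, 1 / (M : ℝ), 1)
  let s : ℕ → formalHarmonicArchipelago := fun M =>
    if h : ∃ p, B M p then h.choose else o
  have hs : ∀ M, (∃ p, B M p) → B M (s M) := fun M h => by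
    simp only [s, dif_pos h]; exact h.choose_spec
  have hlim : Tendsto s atTop (𝓝 o) := by
    rw [tendsto_subtype_rng]
    change Tendsto (fun M => (s M : ℝ × ℝ × ℝ)) atTop (𝓝 0)
    refine squeeze_zero_norm' (a := fun M : ℕ => 2 / (M : ℝ)) ?_
      (tendsto_const_div_atTop_nhds_zero_nat 2)
    filter_upwards [eventually_ge_atTop 1] with M hM
    by_cases h : ∃ p, B M p
    · exact circleC_bound hM (hs M h).1
    · have : (s M : ℝ × ℝ × ℝ) = 0 := by simp only [s, dif_neg h, o]; rfl
      rw [this, norm_zero]; positivity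
  have hK : IsCompact (H '' (univ ×ˢ insert o (range s))) :=
    (isCompact_univ.prod hlim.isCompact_insert_range).image hH
  filter_upwards [compact_apex hK] with M hM p hp t ht
  obtain ⟨-, u, hu⟩ := hs M ⟨p, hp, t, ht⟩
  exact hM _ ⟨(u, s M), ⟨mem_univ _, Or.inr ⟨M, rfl⟩⟩, rfl⟩ hu

/-- The Griffiths space is not homotopy equivalent to the Formal Harmonic archipelago. -/
theorem griffiths_not_homotopyEquiv_formalHarmonicArchipelago :
    ¬ Nonempty (ContinuousMap.HomotopyEquiv griffithsSpace formalHarmonicArchipelago) := by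
  rintro ⟨e⟩
  obtain ⟨H⟩ := e.right_inv
  have : CompactSpace griffithsSpace := isCompact_iff_compactSpace.1 griffiths_compact
  obtain ⟨M, hM, hM1, hM2⟩ := ((eventually_ge_atTop 1).and
    ((compact_apex (isCompact_range e.toFun.continuous)).and
      (homotopy_avoids H H.continuous))).exists
  let q : formalHarmonicArchipelago → ℂ := fun p =>
    ⟨(p : ℝ × ℝ × ℝ).1, (p : ℝ × ℝ × ℝ).2.1 - 1 / M⟩
  have hq : Continuous q := by
    have : q = fun p : formalHarmonicArchipelago => (((p : ℝ × ℝ × ℝ).1 : ℝ) : ℂ) +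
        (((p : ℝ × ℝ × ℝ).2.1 - 1 / M : ℝ) : ℂ) * Complex.I := by
      ext p; exact Complex.mk_eq_add_mul_I _ _
    rw [this]; fun_prop
  have hq0 : ∀ p, q p = 0 → (p : ℝ × ℝ × ℝ) = (0, 1 / (M : ℝ), 1) := fun p h => by
    refine HA_apex p.2 hM (congrArg Complex.re h) ?_
    have := congrArg Complex.im h
    simp only [q, Complex.zero_im] at this
    linarith
  obtain ⟨L, hL, hL'⟩ := griffiths_log (fun x => q (e.toFun x)) (hq.comp e.toFun.continuous)
    (fun x h => hM1 _ ⟨x, rfl⟩ (hq0 _ h))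
  set r : ℝ := 1 / (3 * M * (M + 1)) with hr
  have hγ : ∀ w : Circle, ((r * (w : ℂ).re, r * (w : ℂ).im + 1 / M, 0) : ℝ × ℝ × ℝ) ∈ circleC M := by
    intro w
    refine ⟨?_, rfl⟩
    have := Circle.normSq_coe w
    rw [Complex.normSq_apply] at this
    simp only [← hr]
    linear_combination r ^ 2 * this
  let γ : Circle → formalHarmonicArchipelago := fun w => ⟨_, circle_mem_HA hM (hγ w)⟩
  have hγc : Continuous γ := by
    refine Continuous.subtype_mk ?_ _
    have h1 : Continuous fun w : Circle => (w : ℂ).re := Complex.continuous_re.comp continuous_subtype_val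
    have h2 : Continuous fun w : Circle => (w : ℂ).im := Complex.continuous_im.comp continuous_subtype_val
    fun_prop
  obtain ⟨Λ, hΛ, hΛ'⟩ := exp_lift_homotopy (A := Circle) (fun x => q (H (x.1, γ x.2)))
    (hq.comp (H.continuous.comp (by fun_prop)))
    (fun x h => hM2 (γ x.2) (hγ x.2) x.1 (hq0 _ h))
    (fun w => L (e.invFun (γ w))) (hL.comp (e.invFun.continuous.comp hγc))
    (fun w => by
      rw [hL']
      simp)
  refine no_circle_log r Λ hΛ fun w => ?_
  rw [hΛ']
  simp only [H.apply_one]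
  apply Complex.ext <;> simp [q, γ]
end

section
/- The Modified Hawaiian earring ℳℋ is homotopy equivalent to the Hawaiian earring ℍ. -/
/-- The Hawaiian earring `ℍ ⊆ ℝ²`. -/
def hawaiianEarring : Set (ℝ × ℝ) :=
  ⋃ (n : ℕ) (_ : 1 ≤ n), {p : ℝ × ℝ | p.1 ^ 2 + (p.2 - 1 / n) ^ 2 = (1 / n) ^ 2}

/-- The Modified Hawaiian earring `ℳℋ ⊆ ℝ³`. -/
def modifiedHawaiianEarring : Set (ℝ × ℝ × ℝ) :=
  (⋃ (n : ℕ) (_ : 1 ≤ n), circleC n) ∪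
    (⋃ (n : ℕ) (_ : 1 ≤ n), {p : ℝ × ℝ × ℝ | p.1 = 0 ∧
      p.2.1 ∈ Set.Icc ((3 * n + 7) / (3 * (n + 1) * (n + 2)) : ℝ)
        ((3 * n + 2) / (3 * n * (n + 1))) ∧ p.2.2 = 0}) ∪
    {(0, 0, 0)}


noncomputable section

namespace MHE

open Topology Filter

/-- Centre of the `n`-th circle (indices shifted by one). -/
def cc (n : ℕ) : ℝ := 1 / ((n : ℝ) + 1)
/-- Radius of the `n`-th circle. -/
def rr (n : ℕ) : ℝ := 1 / (3 * ((n : ℝ) + 1) * ((n : ℝ) + 2))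
/-- Bottom of the `n`-th circle. -/
def bb (n : ℕ) : ℝ := cc n - rr n
/-- Top of the `n`-th circle. -/
def tt (n : ℕ) : ℝ := cc n + rr n

lemma cc_pos (n : ℕ) : 0 < cc n := by unfold cc; positivity
lemma rr_pos (n : ℕ) : 0 < rr n := by unfold rr; positivity
lemma rr_lt (n : ℕ) : rr n < cc n := by
  unfold rr cc
  apply one_div_lt_one_div_of_lt (by positivity)
  have : (0 : ℝ) ≤ n := Nat.cast_nonneg n
  nlinarith
lemma bb_pos (n : ℕ) : 0 < bb n := by unfold bb; linarith [rr_lt n]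
lemma bb_lt_tt (n : ℕ) : bb n < tt n := by unfold bb tt; linarith [rr_pos n]
lemma tt_pos (n : ℕ) : 0 < tt n := (bb_pos n).trans (bb_lt_tt n)
lemma tt_le (n : ℕ) : tt n ≤ 2 * cc n := by unfold tt; linarith [rr_lt n]

lemma tt_succ_lt (n : ℕ) : tt (n + 1) < bb n := by
  unfold tt bb cc rr
  push_cast
  have : (0 : ℝ) ≤ n := Nat.cast_nonneg n
  have h : 1 / ((n : ℝ) + 1) - 1 / (3 * ((n : ℝ) + 1) * ((n : ℝ) + 2)) -
    (1 / ((n : ℝ) + 1 + 1) + 1 / (3 * ((n : ℝ) + 1 + 1) * ((n : ℝ) + 1 + 2)))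
     = ((n : ℝ) + 5) / (3 * ((n : ℝ) + 1) * ((n : ℝ) + 2) * ((n : ℝ) + 3)) := by
    field_simp
    ring
  have h2 : 0 < ((n : ℝ) + 5) / (3 * ((n : ℝ) + 1) * ((n : ℝ) + 2) * ((n : ℝ) + 3)) := by
    positivity
  linarith

lemma bb_anti : StrictAnti bb :=
  strictAnti_nat_of_succ_lt fun n => (bb_lt_tt (n + 1)).trans (tt_succ_lt n)
lemma tt_anti : StrictAnti tt :=
  strictAnti_nat_of_succ_lt fun n => (tt_succ_lt n).trans (bb_lt_tt n)

lemma tt_lt_bb {m n : ℕ} (h : n < m) : tt m < bb n :=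
  (tt_anti.antitone (Nat.succ_le_of_lt h)).trans_lt (tt_succ_lt n)

lemma cc_tendsto : Tendsto cc atTop (𝓝 0) := tendsto_one_div_add_atTop_nhds_zero_nat

lemma disj {y : ℝ} {m n : ℕ} (hm : y ∈ Set.Icc (bb m) (tt m)) (hn : y ∈ Set.Icc (bb n) (tt n)) :
    m = n := by
  rcases lt_trichotomy m n with h | h | h
  · have := tt_lt_bb h; linarith [hm.1, hn.2]
  · exact h
  · have := tt_lt_bb h; linarith [hn.1, hm.2]

/-- `B` is a family of continuous functions of shrinking size, the `n`-th one supported over the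
`n`-th interval. -/
structure Fam {X E : Type*} [TopologicalSpace X] [NormedAddCommGroup E] (y : X → ℝ)
    (B : ℕ → X → E) : Prop where
  cont : ∀ n, Continuous (B n)
  bound : ∀ n x, ‖B n x‖ ≤ 2 * cc n
  supp : ∀ n x, y x ∉ Set.Icc (bb n) (tt n) → B n x = 0

section Fam
variable {X E : Type*} [TopologicalSpace X] [NormedAddCommGroup E] {y : X → ℝ} {B : ℕ → X → E}

lemma Fam.eval (F : Fam y B) {x : X} {n : ℕ} (h : y x ∈ Set.Icc (bb n) (tt n)) :
    ∑' m, B m x = B n x :=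
  tsum_eq_single n fun m hm => F.supp m x fun h' => hm (disj h' h)

lemma Fam.eval_out (F : Fam y B) {x : X} (h : ∀ n, y x ∉ Set.Icc (bb n) (tt n)) :
    ∑' m, B m x = 0 := by
  simp [fun m => F.supp m x (h m)]

lemma Fam.continuous (F : Fam y B) : Continuous fun x => ∑' m, B m x := by
  have key : TendstoUniformly (fun N x => ∑ m ∈ Finset.range N, B m x)
      (fun x => ∑' m, B m x) atTop := by
    rw [Metric.tendstoUniformly_iff]
    intro ε hε
    have h1 : ∀ᶠ n in atTop, 2 * cc n < ε := by
      have : Tendsto (fun n => 2 * cc n) atTop (𝓝 0) := by simpa using cc_tendsto.const_mul 2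
      exact this.eventually (gt_mem_nhds hε)
    obtain ⟨N, hN⟩ := eventually_atTop.1 h1
    filter_upwards [eventually_ge_atTop N] with K hK x
    by_cases hx : ∃ n, y x ∈ Set.Icc (bb n) (tt n)
    · obtain ⟨n, hn⟩ := hx
      have hz : ∀ m, m ≠ n → B m x = 0 := fun m hm => F.supp m x fun h' => hm (disj h' hn)
      rw [F.eval hn]
      by_cases hnK : n < K
      · rw [Finset.sum_eq_single n (fun m _ hm => hz m hm)
          (fun h => absurd (Finset.mem_range.2 hnK) h)]
        simpa using hε
      · rw [Finset.sum_eq_zero (fun m hm => hz m (by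
          have := Finset.mem_range.1 hm; omega))]
        rw [dist_zero_right]
        exact (F.bound n x).trans_lt (hN n (by omega))
    · push Not at hx
      rw [F.eval_out hx, Finset.sum_eq_zero (fun m _ => F.supp m x (hx m))]
      simpa using hε
  exact key.continuous (Frequently.of_forall fun N => continuous_finsetSum _ fun m _ => F.cont m)

end Fam

/-- Normalised coordinate on the `n`-th interval. -/
def lam (n : ℕ) (y : ℝ) : ℝ := max 0 (min 1 ((y - bb n) / (tt n - bb n)))

lemma lam_cont (n : ℕ) : Continuous (lam n) := by unfold lam; fun_prop

lemma lam_nonneg (n : ℕ) (y : ℝ) : 0 ≤ lam n y := le_max_left _ _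
lemma lam_le (n : ℕ) (y : ℝ) : lam n y ≤ 1 := max_le zero_le_one (min_le_left _ _)

lemma lam_low {n : ℕ} {y : ℝ} (h : y ≤ bb n) : lam n y = 0 := by
  unfold lam
  apply max_eq_left
  apply (min_le_right _ _).trans
  exact div_nonpos_of_nonpos_of_nonneg (by linarith) (by linarith [bb_lt_tt n])

lemma lam_high {n : ℕ} {y : ℝ} (h : tt n ≤ y) : lam n y = 1 := by
  unfold lam
  have : 1 ≤ (y - bb n) / (tt n - bb n) := by
    rw [le_div_iff₀ (by linarith [bb_lt_tt n])]; linarith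
  rw [min_eq_left this]; norm_num

lemma lam_mid {n : ℕ} {y : ℝ} (h : y ∈ Set.Icc (bb n) (tt n)) :
    bb n + lam n y * (tt n - bb n) = y := by
  have h0 : 0 < tt n - bb n := by linarith [bb_lt_tt n]
  have h1 : (y - bb n) / (tt n - bb n) ≤ 1 := by rw [div_le_one h0]; linarith [h.2]
  have h2 : 0 ≤ (y - bb n) / (tt n - bb n) := div_nonneg (by linarith [h.1]) h0.le
  unfold lam
  rw [min_eq_right h1, max_eq_right h2]
  field_simp
  ring

lemma lam_out {n : ℕ} {y : ℝ} (h : y ∉ Set.Icc (bb n) (tt n)) : lam n y = 0 ∨ lam n y = 1 := by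
  by_cases h1 : y ≤ bb n
  · exact Or.inl (lam_low h1)
  · right
    apply lam_high
    by_contra h2
    exact h ⟨by linarith, by linarith⟩

/-! ### The half width -/

def wn (n : ℕ) (y : ℝ) : ℝ := Real.sqrt (rr n ^ 2 - (y - cc n) ^ 2)

lemma wn_fam : Fam (fun y : ℝ => y) wn where
  cont n := by unfold wn; fun_prop
  bound n y := by
    unfold wn
    rw [Real.norm_of_nonneg (Real.sqrt_nonneg _)]
    apply Real.sqrt_le_iff.2
    have := rr_lt n
    have := rr_pos n
    exact ⟨by linarith, by nlinarith [sq_nonneg (y - cc n)]⟩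
  supp n y h := by
    unfold wn
    apply Real.sqrt_eq_zero_of_nonpos
    by_contra h2
    push Not at h2
    apply h
    have := abs_lt_of_sq_lt_sq' (by linarith : (y - cc n) ^ 2 < rr n ^ 2) (rr_pos n).le
    unfold bb tt
    exact ⟨by linarith, by linarith⟩

def w (y : ℝ) : ℝ := ∑' n, wn n y

lemma w_cont : Continuous w := wn_fam.continuous
lemma w_in {n : ℕ} {y : ℝ} (h : y ∈ Set.Icc (bb n) (tt n)) : w y = wn n y := wn_fam.eval h
lemma w_out {y : ℝ} (h : ∀ n, y ∉ Set.Icc (bb n) (tt n)) : w y = 0 := wn_fam.eval_out h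
lemma w_nonneg (y : ℝ) : 0 ≤ w y := tsum_nonneg fun _ => Real.sqrt_nonneg _
lemma w_bb (n : ℕ) : w (bb n) = 0 := by
  rw [w_in (n := n) ⟨le_rfl, (bb_lt_tt n).le⟩]; unfold wn bb; simp
lemma w_tt (n : ℕ) : w (tt n) = 0 := by
  rw [w_in (n := n) ⟨(bb_lt_tt n).le, le_rfl⟩]; unfold wn tt; simp
lemma w_pos {n : ℕ} {y : ℝ} (h : y ∈ Set.Ioo (bb n) (tt n)) : 0 < w y := by
  rw [w_in (n := n) ⟨h.1.le, h.2.le⟩]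
  unfold wn
  apply Real.sqrt_pos.2
  have := sq_lt_sq' (a := y - cc n) (b := rr n) (by have := h.1; unfold bb at this; linarith)
    (by have := h.2; unfold tt at this; linarith)
  linarith

lemma zero_out (n : ℕ) : (0 : ℝ) ∉ Set.Icc (bb n) (tt n) := fun h => by
  linarith [h.1, bb_pos n]
lemma w_zero : w 0 = 0 := w_out zero_out

/-- trichotomy for heights -/
lemma w_eq_zero {y : ℝ} (h : w y = 0) :
    (∀ n, y ∉ Set.Icc (bb n) (tt n)) ∨ ∃ n, y = bb n ∨ y = tt n := by
  by_cases hx : ∃ n, y ∈ Set.Icc (bb n) (tt n)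
  · obtain ⟨n, hn⟩ := hx
    right
    refine ⟨n, ?_⟩
    by_contra hc
    push Not at hc
    exact (w_pos (n := n) ⟨lt_of_le_of_ne hn.1 hc.1.symm, lt_of_le_of_ne hn.2 hc.2⟩).ne' h
  · push Not at hx; exact Or.inl hx

/-! ### The map to the Hawaiian earring -/

def qn (n : ℕ) (y : ℝ) : ℝ × ℝ :=
  (cc n * -Real.sin (2 * Real.pi * lam n y - Real.pi),
    cc n * (1 + Real.cos (2 * Real.pi * lam n y - Real.pi)))

lemma qn_zero {n : ℕ} {y : ℝ} (h : lam n y = 0 ∨ lam n y = 1) : qn n y = 0 := by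
  unfold qn
  rcases h with h | h
  · simp [h]
  · rw [h, show 2 * Real.pi * 1 - Real.pi = Real.pi by ring]; simp

lemma qn_fam : Fam (fun y : ℝ => y) qn where
  cont n := by have := lam_cont n; unfold qn; fun_prop
  bound n y := by
    have h := cc_pos n
    unfold qn
    set θ := 2 * Real.pi * lam n y - Real.pi
    rw [Prod.norm_mk, Real.norm_eq_abs, Real.norm_eq_abs, abs_mul, abs_mul, abs_of_pos h, abs_neg]
    have h1 := Real.abs_sin_le_one θ
    have h2 : |1 + Real.cos θ| ≤ 2 := by
      rw [abs_le]; constructor <;> linarith [Real.neg_one_le_cos θ, Real.cos_le_one θ]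
    exact max_le (by nlinarith) (by nlinarith)
  supp n y h := qn_zero (lam_out h)

def q (y : ℝ) : ℝ × ℝ := ∑' n, qn n y

lemma q_cont : Continuous q := qn_fam.continuous
lemma q_in {n : ℕ} {y : ℝ} (h : y ∈ Set.Icc (bb n) (tt n)) : q y = qn n y := qn_fam.eval h
lemma q_out {y : ℝ} (h : ∀ n, y ∉ Set.Icc (bb n) (tt n)) : q y = 0 := qn_fam.eval_out h
lemma q_bb (n : ℕ) : q (bb n) = 0 := by
  rw [q_in (n := n) ⟨le_rfl, (bb_lt_tt n).le⟩]; exact qn_zero (Or.inl (lam_low le_rfl))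
lemma q_tt (n : ℕ) : q (tt n) = 0 := by
  rw [q_in (n := n) ⟨(bb_lt_tt n).le, le_rfl⟩]; exact qn_zero (Or.inr (lam_high le_rfl))
lemma q_zero : q 0 = 0 := q_out zero_out
lemma q_of_w {y : ℝ} (h : w y = 0) : q y = 0 := by
  rcases w_eq_zero h with h | ⟨n, rfl | rfl⟩
  · exact q_out h
  · exact q_bb n
  · exact q_tt n

lemma mem_H {p : ℝ × ℝ} : p ∈ hawaiianEarring ↔
    ∃ n : ℕ, p.1 ^ 2 + (p.2 - cc n) ^ 2 = cc n ^ 2 := by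
  unfold hawaiianEarring cc
  simp only [Set.mem_iUnion, Set.mem_ofPred_eq]
  constructor
  · rintro ⟨n, hn, h⟩
    refine ⟨n - 1, ?_⟩
    have : ((n - 1 : ℕ) : ℝ) + 1 = n := by rw [Nat.cast_sub hn]; simp
    rw [this]; exact h
  · rintro ⟨n, h⟩
    exact ⟨n + 1, by omega, by push_cast; exact h⟩

lemma zero_mem_H : (0 : ℝ × ℝ) ∈ hawaiianEarring := mem_H.2 ⟨0, by simp⟩

lemma qn_mem (n : ℕ) (y : ℝ) :
    (qn n y).1 ^ 2 + ((qn n y).2 - cc n) ^ 2 = cc n ^ 2 := by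
  unfold qn
  set θ := 2 * Real.pi * lam n y - Real.pi
  simp only
  linear_combination cc n ^ 2 * Real.sin_sq_add_cos_sq θ

lemma q_mem (y : ℝ) : q y ∈ hawaiianEarring := by
  by_cases hx : ∃ n, y ∈ Set.Icc (bb n) (tt n)
  · obtain ⟨n, hn⟩ := hx
    rw [q_in hn]
    exact mem_H.2 ⟨n, qn_mem n y⟩
  · push Not at hx; rw [q_out hx]; exact zero_mem_H

lemma q_surj {p : ℝ × ℝ} (hp : p ∈ hawaiianEarring) : ∃ y ∈ Set.Icc 0 (tt 0), q y = p := by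
  obtain ⟨n, h⟩ := mem_H.1 hp
  have hc := cc_pos n
  have hnorm : ‖(⟨(p.2 - cc n) / cc n, -p.1 / cc n⟩ : ℂ)‖ = 1 := by
    rw [← sq_eq_sq₀ (norm_nonneg _) zero_le_one, ← Complex.normSq_eq_norm_sq, Complex.normSq_mk]
    field_simp
    linarith
  set z : ℂ := ⟨(p.2 - cc n) / cc n, -p.1 / cc n⟩ with hz
  have hz0 : z ≠ 0 := by rw [← norm_pos_iff, hnorm]; norm_num
  have hcos : Real.cos z.arg = (p.2 - cc n) / cc n := by
    rw [Complex.cos_arg hz0, hnorm, hz]; simp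
  have hsin : Real.sin z.arg = -p.1 / cc n := by rw [Complex.sin_arg, hnorm, hz]; simp
  have hpi := Real.pi_pos
  have a1 := Complex.neg_pi_lt_arg z
  have a2 := Complex.arg_le_pi z
  have hbt := bb_lt_tt n
  set l := (z.arg + Real.pi) / (2 * Real.pi) with hl
  have hl0 : 0 ≤ l := div_nonneg (by linarith) (by linarith)
  have hl1 : l ≤ 1 := by rw [hl, div_le_one (by linarith)]; linarith
  have hy : bb n + l * (tt n - bb n) ∈ Set.Icc (bb n) (tt n) := ⟨by nlinarith, by nlinarith⟩
  refine ⟨bb n + l * (tt n - bb n), ⟨by linarith [hy.1, bb_pos n],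
    hy.2.trans (tt_anti.antitone (Nat.zero_le n))⟩, ?_⟩
  rw [q_in hy]
  have hlam : lam n (bb n + l * (tt n - bb n)) = l := by
    have := lam_mid hy
    have h0 : tt n - bb n ≠ 0 := by linarith
    exact mul_right_cancel₀ h0 (by linarith)
  unfold qn
  have harg : 2 * Real.pi * l - Real.pi = z.arg := by rw [hl]; field_simp; ring
  rw [hlam, harg, hsin, hcos]
  ext
  · simp only; field_simp
  · simp only; field_simp; ring

lemma q_inj {y y' : ℝ} (h : q y = q y') : y = y' ∨ (w y = 0 ∧ w y' = 0) := by
  have key : ∀ y, w y ≠ 0 → ∃ n, y ∈ Set.Ioo (bb n) (tt n) := by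
    intro y hy
    by_cases hx : ∃ n, y ∈ Set.Icc (bb n) (tt n)
    · obtain ⟨n, hn⟩ := hx
      refine ⟨n, lt_of_le_of_ne hn.1 ?_, lt_of_le_of_ne hn.2 ?_⟩
      · rintro rfl; exact hy (w_bb n)
      · rintro rfl; exact hy (w_tt n)
    · push Not at hx; exact absurd (w_out hx) hy
  have ang : ∀ n y, y ∈ Set.Ioo (bb n) (tt n) →
      2 * Real.pi * lam n y - Real.pi ∈ Set.Ioo (-Real.pi) Real.pi := by
    intro n y hy
    have hbt := bb_lt_tt n
    have hpi := Real.pi_pos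
    have h1 := lam_mid (n := n) (y := y) ⟨hy.1.le, hy.2.le⟩
    have h2 : 0 < lam n y := by
      by_contra hc; push Not at hc; nlinarith [hy.1]
    have h3 : lam n y < 1 := by
      by_contra hc; push Not at hc; nlinarith [hy.2]
    constructor <;> nlinarith
  have hne : ∀ n y, y ∈ Set.Ioo (bb n) (tt n) → 0 < (q y).2 := by
    intro n y hy
    rw [q_in (n := n) ⟨hy.1.le, hy.2.le⟩]
    have ha := ang n y hy
    apply mul_pos (cc_pos n)
    have : -1 < Real.cos (2 * Real.pi * lam n y - Real.pi) := by
      rw [← Real.cos_abs, ← Real.cos_pi]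
      apply Real.cos_lt_cos_of_nonneg_of_le_pi (abs_nonneg _) le_rfl
      exact abs_lt.2 ha
    linarith
  by_cases hy : w y = 0
  · by_cases hy' : w y' = 0
    · exact Or.inr ⟨hy, hy'⟩
    · obtain ⟨n, hn⟩ := key y' hy'
      have := hne n y' hn
      rw [← h, q_of_w hy] at this
      simp at this
  · obtain ⟨n, hn⟩ := key y hy
    have h0 := hne n y hn
    by_cases hy' : w y' = 0
    · rw [h, q_of_w hy'] at h0
      simp at h0
    · obtain ⟨m, hm⟩ := key y' hy'
      left
      have e1 := q_in (n := n) (y := y) ⟨hn.1.le, hn.2.le⟩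
      have e2 := q_in (n := m) (y := y') ⟨hm.1.le, hm.2.le⟩
      have f1 := qn_mem n y
      have f2 := qn_mem m y'
      rw [← e1] at f1
      rw [← e2, ← h] at f2
      have hcc : cc n = cc m := by
        have : (q y).2 * cc n = (q y).2 * cc m := by linarith
        exact mul_left_cancel₀ h0.ne' this
      have hnm : n = m := by
        unfold cc at hcc
        rw [one_div, one_div] at hcc
        have := inv_injective hcc
        exact_mod_cast (by linarith : (n : ℝ) = m)
      subst hnm
      rw [e1, e2] at h
      have g := Prod.ext_iff.1 h
      unfold qn at g
      obtain ⟨g1, g2⟩ := g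
      simp only at g1 g2
      have c := (cc_pos n).ne'
      have g1 := mul_left_cancel₀ c g1
      have g2 := mul_left_cancel₀ c g2
      have a1 := ang n y hn
      have a2 := ang n y' hm
      have hθ : 2 * Real.pi * lam n y - Real.pi = 2 * Real.pi * lam n y' - Real.pi := by
        have hang : ((2 * Real.pi * lam n y - Real.pi : ℝ) : Real.Angle)
            = ((2 * Real.pi * lam n y' - Real.pi : ℝ) : Real.Angle) :=
          Real.Angle.cos_sin_inj (by linarith) (by linarith)
        have t1 := Real.Angle.toReal_coe_eq_self_iff.2 ⟨a1.1, a1.2.le⟩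
        have t2 := Real.Angle.toReal_coe_eq_self_iff.2 ⟨a2.1, a2.2.le⟩
        rw [← t1, ← t2, hang]
      have hl : lam n y = lam n y' := by
        have hpi := Real.pi_pos
        have : (2 * Real.pi) * lam n y = (2 * Real.pi) * lam n y' := by linarith
        exact mul_left_cancel₀ (by positivity) this
      rw [← lam_mid (n := n) (y := y) ⟨hn.1.le, hn.2.le⟩,
        ← lam_mid (n := n) (y := y') ⟨hm.1.le, hm.2.le⟩, hl]

/-! ### Description of the modified earring -/

lemma mem_circle {n : ℕ} {p : ℝ × ℝ × ℝ} : p ∈ circleC (n + 1) ↔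
    p.1 ^ 2 + (p.2.1 - cc n) ^ 2 = rr n ^ 2 ∧ p.2.2 = 0 := by
  unfold circleC cc rr
  simp only [Set.mem_ofPred_eq]
  push_cast
  rw [show (n : ℝ) + 1 + 1 = n + 2 by ring]

lemma mem_M {p : ℝ × ℝ × ℝ} : p ∈ modifiedHawaiianEarring ↔
    (0 ≤ p.2.1 ∧ p.2.1 ≤ tt 0) ∧ p.2.2 = 0 ∧ (p.1 = w p.2.1 ∨ p.1 = -w p.2.1) := by
  have hseg1 : ∀ n : ℕ, (3 * ((n + 1 : ℕ) : ℝ) + 7) / (3 * (((n + 1 : ℕ) : ℝ) + 1) *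
      (((n + 1 : ℕ) : ℝ) + 2)) = tt (n + 1) := by
    intro n; unfold tt cc rr; push_cast; field_simp; ring
  have hseg2 : ∀ n : ℕ, (3 * ((n + 1 : ℕ) : ℝ) + 2) / (3 * ((n + 1 : ℕ) : ℝ) *
      (((n + 1 : ℕ) : ℝ) + 1)) = bb n := by
    intro n; unfold bb cc rr; push_cast; field_simp; ring
  obtain ⟨x, y, z⟩ := p
  constructor
  · rintro ((h | h) | h)
    · simp only [Set.mem_iUnion] at h
      obtain ⟨n, hn, h⟩ := h
      obtain ⟨n, rfl⟩ : ∃ k, n = k + 1 := ⟨n - 1, by omega⟩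
      obtain ⟨h, hz⟩ := mem_circle.1 h
      simp only at h hz ⊢
      have hI : y ∈ Set.Icc (bb n) (tt n) := by
        have := abs_le_of_sq_le_sq' (by nlinarith [sq_nonneg x] : (y - cc n) ^ 2 ≤ rr n ^ 2)
          (rr_pos n).le
        unfold bb tt
        exact ⟨by linarith, by linarith⟩
      refine ⟨⟨by linarith [hI.1, bb_pos n], hI.2.trans (tt_anti.antitone (Nat.zero_le n))⟩, hz, ?_⟩
      rw [w_in hI, wn, ← sq_eq_sq_iff_eq_or_eq_neg, Real.sq_sqrt (by nlinarith [sq_nonneg x])]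
      linarith
    · simp only [Set.mem_iUnion] at h
      obtain ⟨n, hn, hx, hy, hz⟩ := h
      obtain ⟨n, rfl⟩ : ∃ k, n = k + 1 := ⟨n - 1, by omega⟩
      rw [hseg1, hseg2] at hy
      simp only at hx hy hz ⊢
      refine ⟨⟨by linarith [hy.1, tt_pos (n + 1)], ?_⟩, hz, ?_⟩
      · have := tt_anti.antitone (Nat.zero_le n)
        linarith [hy.2, bb_lt_tt n]
      · have : w y = 0 := by
          by_contra hw
          by_cases hc : ∃ m, y ∈ Set.Icc (bb m) (tt m)
          · obtain ⟨m, hm⟩ := hc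
            rcases lt_trichotomy m n with h | h | h
            · have := bb_anti h; linarith [hm.1, hy.2]
            · subst h
              exact hw (by rw [le_antisymm hy.2 hm.1]; exact w_bb m)
            · have := tt_anti.antitone (Nat.succ_le_of_lt h)
              have h2 : m = n + 1 := by
                by_contra hne
                have := tt_anti (show n + 1 < m by omega)
                linarith [hm.2, hy.1]
              subst h2
              exact hw (by rw [le_antisymm hm.2 hy.1]; exact w_tt (n + 1))
          · push Not at hc; exact hw (w_out hc)
        rw [this, hx]; simp
    · simp only [Set.mem_singleton_iff, Prod.mk.injEq] at h
      obtain ⟨rfl, rfl, rfl⟩ := h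
      simp [w_zero, (tt_pos 0).le]
  · rintro ⟨⟨h0, h1⟩, hz, hx⟩
    simp only at h0 h1 hz hx
    have hin : ∀ n, y ∈ Set.Icc (bb n) (tt n) → (x, y, z) ∈ modifiedHawaiianEarring := by
      intro n hI
      refine Or.inl (Or.inl ?_)
      simp only [Set.mem_iUnion]
      refine ⟨n + 1, by omega, mem_circle.2 ⟨?_, hz⟩⟩
      have hx2 : x ^ 2 = w y ^ 2 := sq_eq_sq_iff_eq_or_eq_neg.2 hx
      have := abs_le.2 (⟨by have := hI.1; unfold bb at this; linarith,
        by have := hI.2; unfold tt at this; linarith⟩ : -rr n ≤ y - cc n ∧ y - cc n ≤ rr n)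
      have := sq_le_sq' (abs_le.1 this).1 (abs_le.1 this).2
      simp only
      rw [hx2, w_in hI, wn, Real.sq_sqrt (by linarith)]
      ring
    rcases h0.eq_or_lt with h0 | h0
    · subst h0
      refine Or.inr ?_
      rw [w_zero] at hx
      simp at hx
      simp [hx, hz]
    · have hex : ∃ n, bb n ≤ y := by
        obtain ⟨n, hn⟩ := (cc_tendsto.eventually (gt_mem_nhds h0)).exists
        exact ⟨n, by unfold bb; linarith [rr_pos n]⟩
      classical
      let n := Nat.find hex
      have hn : bb n ≤ y := Nat.find_spec hex
      by_cases ht : y ≤ tt n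
      · exact hin n ⟨hn, ht⟩
      · push Not at ht
        have hn0 : n ≠ 0 := fun h => by rw [h] at ht; linarith
        obtain ⟨k, hk⟩ := Nat.exists_eq_succ_of_ne_zero hn0
        have hk2 : ¬ bb k ≤ y := Nat.find_min hex (show k < n by omega)
        push Not at hk2
        rw [hk] at ht
        refine Or.inl (Or.inr ?_)
        simp only [Set.mem_iUnion]
        refine ⟨k + 1, by omega, ?_⟩
        have hw : w y = 0 := by
          apply w_out
          intro m hm
          rcases le_or_gt m k with h | h
          · have := bb_anti.antitone h; linarith [hm.1]
          · have := tt_anti.antitone (Nat.succ_le_of_lt h); linarith [hm.2]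
        rw [hw] at hx
        refine ⟨by simpa using hx, ?_, hz⟩
        rw [hseg1, hseg2]
        exact ⟨ht.le, hk2.le⟩

/-! ### The auxiliary functions of the homotopies -/

def pn (n : ℕ) (y : ℝ) : ℝ := bb n + lam n y * (tt n - bb n)
def un (n : ℕ) (x : unitInterval × ℝ) : ℝ :=
  x.1 * pn n x.2 + 2 * lam n x.2 * (1 - x.1) * tt n
def hn (n : ℕ) (x : unitInterval × ℝ) : ℝ :=
  min (un n x) (2 * tt n - un n x) - x.1 * pn n x.2
def cn (n : ℕ) (x : unitInterval × ℝ) : ℝ :=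
  max (bb n) (min (tt n) (un n x)) - pn n x.2

lemma pn_mem (n : ℕ) (y : ℝ) : bb n ≤ pn n y ∧ pn n y ≤ tt n := by
  have h1 := lam_nonneg n y
  have h2 := lam_le n y
  have h3 := bb_lt_tt n
  unfold pn
  constructor <;> nlinarith

lemma un_mem (n : ℕ) (x : unitInterval × ℝ) : 0 ≤ un n x ∧ un n x ≤ 2 * tt n := by
  obtain ⟨⟨s, hs0, hs1⟩, y⟩ := x
  have h1 := lam_nonneg n y
  have h2 := lam_le n y
  have h3 := pn_mem n y
  have h4 := bb_pos n
  have h5 := tt_pos n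
  unfold un
  simp only
  have e1 : 0 ≤ s * pn n y := mul_nonneg hs0 (by linarith)
  have e2 : 0 ≤ lam n y * ((1 - s) * tt n) := mul_nonneg h1 (mul_nonneg (by linarith) h5.le)
  have e3 : lam n y * ((1 - s) * tt n) ≤ 1 * ((1 - s) * tt n) :=
    mul_le_mul_of_nonneg_right h2 (mul_nonneg (by linarith) h5.le)
  have e4 : s * pn n y ≤ s * tt n := mul_le_mul_of_nonneg_left h3.2 hs0
  have e5 : 0 ≤ s * tt n := mul_nonneg hs0 h5.le
  constructor <;> linarith

lemma un_cont (n : ℕ) : Continuous (un n) := by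
  have := lam_cont n
  unfold un pn
  fun_prop

lemma pn_cont (n : ℕ) : Continuous (pn n) := by
  have := lam_cont n
  unfold pn
  fun_prop

lemma un_low {n : ℕ} {x : unitInterval × ℝ} (h : lam n x.2 = 0) :
    pn n x.2 = bb n ∧ un n x = x.1 * bb n := by
  unfold un pn; rw [h]; constructor <;> ring

lemma un_high {n : ℕ} {x : unitInterval × ℝ} (h : lam n x.2 = 1) :
    pn n x.2 = tt n ∧ un n x = (2 - x.1) * tt n := by
  unfold un pn; rw [h]; constructor <;> ring

lemma hn_zero {n : ℕ} {x : unitInterval × ℝ} (h : lam n x.2 = 0 ∨ lam n x.2 = 1) :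
    hn n x = 0 := by
  have hb := bb_pos n
  have hbt := bb_lt_tt n
  have hs0 := x.1.2.1
  have hs1 := x.1.2.2
  unfold hn
  rcases h with h | h
  · obtain ⟨h1, h2⟩ := un_low h
    rw [h1, h2, min_eq_left (by nlinarith), sub_self]
  · obtain ⟨h1, h2⟩ := un_high h
    rw [h1, h2, min_eq_right (by nlinarith)]
    ring

lemma cn_zero {n : ℕ} {x : unitInterval × ℝ} (h : lam n x.2 = 0 ∨ lam n x.2 = 1) :
    cn n x = 0 := by
  have hb := bb_pos n
  have hbt := bb_lt_tt n
  have hs0 := x.1.2.1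
  have hs1 := x.1.2.2
  unfold cn
  rcases h with h | h
  · obtain ⟨h1, h2⟩ := un_low h
    rw [h1, h2, min_eq_right (by nlinarith), max_eq_left (by nlinarith), sub_self]
  · obtain ⟨h1, h2⟩ := un_high h
    rw [h1, h2, min_eq_left (by nlinarith), max_eq_right (by nlinarith), sub_self]

lemma hn_fam : Fam (fun x : unitInterval × ℝ => x.2) hn where
  cont n := by have := un_cont n; have := pn_cont n; unfold hn; fun_prop
  bound n x := by
    have hb := bb_pos n
    have hs0 := x.1.2.1
    have hs1 := x.1.2.2
    have h1 := un_mem n x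
    have h2 := pn_mem n x.2
    have h3 := tt_le n
    have e1 : 0 ≤ (x.1 : ℝ) * pn n x.2 := mul_nonneg hs0 (by linarith)
    have e2 : (x.1 : ℝ) * pn n x.2 ≤ 1 * tt n :=
      mul_le_mul hs1 h2.2 (by linarith) zero_le_one
    rw [Real.norm_eq_abs, abs_le]
    unfold hn
    have m1 : 0 ≤ min (un n x) (2 * tt n - un n x) := le_min h1.1 (by linarith)
    have m2 : min (un n x) (2 * tt n - un n x) ≤ tt n := by
      rcases le_total (un n x) (tt n) with h | h
      · exact (min_le_left _ _).trans h
      · exact (min_le_right _ _).trans (by linarith)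
    constructor <;> linarith
  supp n x h := hn_zero (lam_out h)

lemma cn_fam : Fam (fun x : unitInterval × ℝ => x.2) cn where
  cont n := by have := un_cont n; have := pn_cont n; unfold cn; fun_prop
  bound n x := by
    have hb := bb_pos n
    have hbt := bb_lt_tt n
    have h2 := pn_mem n x.2
    have h3 := tt_le n
    rw [Real.norm_eq_abs, abs_le]
    unfold cn
    have m1 : bb n ≤ max (bb n) (min (tt n) (un n x)) := le_max_left _ _
    have m2 : max (bb n) (min (tt n) (un n x)) ≤ tt n := max_le hbt.le (min_le_left _ _)
    constructor <;> linarith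
  supp n x h := cn_zero (lam_out h)

def h (x : unitInterval × ℝ) : ℝ := x.1 * x.2 + ∑' n, hn n x
def c (x : unitInterval × ℝ) : ℝ := x.2 + ∑' n, cn n x

lemma h_cont : Continuous h := by
  have := hn_fam.continuous
  unfold h
  fun_prop
lemma c_cont : Continuous c := by
  have := cn_fam.continuous
  unfold c
  fun_prop

lemma h_in {n : ℕ} {x : unitInterval × ℝ} (hx : x.2 ∈ Set.Icc (bb n) (tt n)) :
    h x = min (un n x) (2 * tt n - un n x) := by
  unfold h
  rw [hn_fam.eval hx, hn, pn, lam_mid hx]; ring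
lemma c_in {n : ℕ} {x : unitInterval × ℝ} (hx : x.2 ∈ Set.Icc (bb n) (tt n)) :
    c x = max (bb n) (min (tt n) (un n x)) := by
  unfold c
  rw [cn_fam.eval hx, cn, pn, lam_mid hx]; ring
lemma h_flat {x : unitInterval × ℝ} (hx : w x.2 = 0) : h x = x.1 * x.2 := by
  unfold h
  rcases w_eq_zero hx with hx | ⟨n, hx⟩
  · rw [hn_fam.eval_out hx, add_zero]
  · have hb := bb_lt_tt n
    rw [hn_fam.eval (n := n) (by rcases hx with hx | hx <;> rw [hx] <;> constructor <;> linarith),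
      hn_zero, add_zero]
    exact hx.imp (fun h => lam_low h.le) (fun h => lam_high h.ge)
lemma c_flat {x : unitInterval × ℝ} (hx : w x.2 = 0) : c x = x.2 := by
  unfold c
  rcases w_eq_zero hx with hx | ⟨n, hx⟩
  · rw [cn_fam.eval_out hx, add_zero]
  · have hb := bb_lt_tt n
    rw [cn_fam.eval (n := n) (by rcases hx with hx | hx <;> rw [hx] <;> constructor <;> linarith),
      cn_zero, add_zero]
    exact hx.imp (fun h => lam_low h.le) (fun h => lam_high h.ge)

lemma h_one (y : ℝ) : h (1, y) = y := by
  unfold h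
  have : ∀ n, hn n (1, y) = 0 := by
    intro n
    have h2 := pn_mem n y
    unfold hn un
    simp only [Set.Icc.coe_one]
    rw [min_eq_left (by linarith)]; ring
  simp [this]
lemma c_one (y : ℝ) : c (1, y) = y := by
  unfold c
  have : ∀ n, cn n (1, y) = 0 := by
    intro n
    have h2 := pn_mem n y
    unfold cn un
    simp only [Set.Icc.coe_one]
    rw [show (1 : ℝ) * pn n y + 2 * lam n y * (1 - 1) * tt n = pn n y by ring,
      min_eq_right h2.2, max_eq_right h2.1, sub_self]
  simp [this]

/-- Either `h = c`, or the `c`-point is a gluing point. -/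
lemma hc (x : unitInterval × ℝ) : h x = c x ∨ w (c x) = 0 := by
  by_cases hx : ∃ n, x.2 ∈ Set.Icc (bb n) (tt n)
  · obtain ⟨n, hx⟩ := hx
    rw [h_in hx, c_in hx]
    have hbt := bb_lt_tt n
    rcases le_total (un n x) (bb n) with h1 | h1
    · right
      rw [min_eq_right (by linarith), max_eq_left h1, w_bb]
    · rcases le_total (un n x) (tt n) with h2 | h2
      · left
        rw [min_eq_left (by linarith), min_eq_right h2, max_eq_right h1]
      · right
        rw [min_eq_left h2, max_eq_right hbt.le, w_tt]
  · push Not at hx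
    right
    rw [c_flat (w_out hx), w_out hx]

lemma h_mem {x : unitInterval × ℝ} (hx : x.2 ∈ Set.Icc 0 (tt 0)) : 0 ≤ h x ∧ h x ≤ tt 0 := by
  have hs0 := x.1.2.1
  have hs1 := x.1.2.2
  by_cases hy : ∃ n, x.2 ∈ Set.Icc (bb n) (tt n)
  · obtain ⟨n, hy⟩ := hy
    have h1 := un_mem n x
    rw [h_in hy]
    refine ⟨le_min h1.1 (by linarith), ?_⟩
    have := tt_anti.antitone (Nat.zero_le n)
    rcases le_total (un n x) (tt n) with h | h
    · exact (min_le_left _ _).trans (by linarith)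
    · exact (min_le_right _ _).trans (by linarith)
  · push Not at hy
    rw [h_flat (w_out hy)]
    exact ⟨mul_nonneg hs0 hx.1, by nlinarith [hx.1, hx.2]⟩

/-! ### The maps -/

abbrev M := modifiedHawaiianEarring
abbrev H := hawaiianEarring
abbrev D := Set.Icc (0 : ℝ) (tt 0)

def K (x : unitInterval × D) : M :=
  ⟨(w (h (x.1, x.2)) - 2 * w (c (x.1, x.2)), h (x.1, x.2), 0), mem_M.2 ⟨h_mem x.2.2, rfl, by
    rcases hc (x.1, (x.2 : ℝ)) with e | e
    · right; simp only; rw [e]; ring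
    · left; simp only; rw [e]; ring⟩⟩

lemma K_cont : Continuous K := by
  have := w_cont
  have := h_cont
  have := c_cont
  unfold K
  fun_prop

def R (x : unitInterval × D) : M :=
  ⟨(w (x.1 * x.2), x.1 * x.2, 0), mem_M.2 ⟨⟨mul_nonneg x.1.2.1 x.2.2.1, by
    have h1 := x.1.2.1
    have h2 := x.1.2.2
    have h3 := x.2.2.1
    have h4 := x.2.2.2
    simp only
    nlinarith⟩, rfl, Or.inl rfl⟩⟩

lemma R_cont : Continuous R := by
  have := w_cont
  unfold R
  fun_prop

def Q (y : D) : H := ⟨q y, q_mem y⟩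
lemma Q_cont : Continuous Q := by
  have := q_cont
  unfold Q
  fun_prop
lemma Q_surj : Function.Surjective Q := fun p => by
  obtain ⟨y, hy, e⟩ := q_surj p.2
  exact ⟨⟨y, hy⟩, Subtype.ext e⟩

def O : H := ⟨0, zero_mem_H⟩
lemma Q_flat {y : D} (hy : w y = 0) : Q y = O := Subtype.ext (q_of_w hy)

def sec : H → D := Function.surjInv Q_surj
lemma Q_sec (p : H) : Q (sec p) = p := Function.surjInv_eq Q_surj p
lemma sec_Q (y : D) : sec (Q y) = y ∨ (w (sec (Q y)) = 0 ∧ w y = 0) := by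
  have := Q_sec (Q y)
  rcases q_inj (Subtype.ext_iff.1 this) with h | h
  · exact Or.inl (Subtype.ext h)
  · exact Or.inr h

def ht (p : M) : D := ⟨p.1.2.1, (mem_M.1 p.2).1⟩
lemma ht_cont : Continuous ht := by unfold ht; fun_prop

lemma w_ht {p : M} (hp : p.1.1 = 0) : w (ht p) = 0 := by
  rcases (mem_M.1 p.2).2.2 with h | h
  · exact h.symm.trans hp
  · have : -w (ht p) = 0 := h.symm.trans hp
    linarith

def f : C(M, H) where
  toFun p := if p.1.1 ≤ 0 then Q (ht p) else O
  continuous_toFun := by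
    refine Continuous.if_le (Q_cont.comp ht_cont) continuous_const (by fun_prop)
      continuous_const ?_
    intro p hp
    exact Q_flat (w_ht hp)

lemma K_flat {s : unitInterval} {y : D} (hy : w y = 0) : K (s, y) = R (s, y) := by
  apply Subtype.ext
  simp only [K, R]
  rw [h_flat (x := (s, (y : ℝ))) hy, c_flat (x := (s, (y : ℝ))) hy]
  simp [hy]

lemma R_zero (y : D) : (R (0, y) : ℝ × ℝ × ℝ) = 0 := by
  simp [R, w_zero]

lemma K_sec (y : D) : K (0, sec (Q y)) = K (0, y) := by
  rcases sec_Q y with e | ⟨e1, e2⟩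
  · rw [e]
  · rw [K_flat e1, K_flat e2]
    exact Subtype.ext ((R_zero _).trans (R_zero _).symm)

lemma QQ : IsQuotientMap Q :=
  Q_cont.isClosedMap.isQuotientMap Q_cont Q_surj

def g : C(H, M) where
  toFun p := K (0, sec p)
  continuous_toFun := by
    rw [QQ.continuous_iff]
    have : (fun p => K (0, sec p)) ∘ Q = fun y => K (0, y) := funext K_sec
    rw [this]
    exact K_cont.comp (by fun_prop)

lemma g_O : (g O : ℝ × ℝ × ℝ) = 0 := by
  have hO : Q ⟨0, le_rfl, (tt_pos 0).le⟩ = O := Q_flat w_zero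
  change (K (0, sec O) : ℝ × ℝ × ℝ) = 0
  rw [← hO, K_sec, K_flat w_zero, R_zero]

/-- The homotopy on the modified earring. -/
def homM : ContinuousMap.Homotopy (g.comp f) (ContinuousMap.id M) where
  toFun x := if x.2.1.1 ≤ 0 then K (x.1, ht x.2) else R (x.1, ht x.2)
  continuous_toFun := by
    have := ht_cont
    refine Continuous.if_le (K_cont.comp (by fun_prop)) (R_cont.comp (by fun_prop)) (by fun_prop)
      continuous_const ?_
    intro x hx
    exact K_flat (w_ht hx)
  map_zero_left p := by
    change (if p.1.1 ≤ 0 then K (0, ht p) else R (0, ht p)) =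
      g (if p.1.1 ≤ 0 then Q (ht p) else O)
    split_ifs with hp
    · exact (K_sec _).symm
    · exact Subtype.ext ((R_zero _).trans g_O.symm)
  map_one_left p := by
    change (if p.1.1 ≤ 0 then K (1, ht p) else R (1, ht p)) = p
    have hm := (mem_M.1 p.2).2
    have hw := w_nonneg p.1.2.1
    split_ifs with hp
    · apply Subtype.ext
      simp only [K, h_one, c_one]
      refine Prod.ext ?_ (Prod.ext rfl hm.1.symm)
      simp only [ht]
      rcases hm.2 with e | e <;> linarith
    · apply Subtype.ext
      simp only [R, Set.Icc.coe_one, one_mul]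
      refine Prod.ext ?_ (Prod.ext rfl hm.1.symm)
      simp only [ht]
      rcases hm.2 with e | e <;> linarith

def J (x : unitInterval × D) : H := ⟨q (c (x.1, x.2)), q_mem _⟩
lemma J_cont : Continuous J := by
  have := q_cont
  have := c_cont
  unfold J
  fun_prop

lemma J_flat {s : unitInterval} {y : D} (hy : w y = 0) : J (s, y) = O := by
  apply Subtype.ext
  simp only [J]
  rw [c_flat (x := (s, (y : ℝ))) hy]
  exact q_of_w hy

lemma J_sec (s : unitInterval) (y : D) : J (s, sec (Q y)) = J (s, y) := by
  rcases sec_Q y with e | ⟨e1, e2⟩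
  · rw [e]
  · rw [J_flat e1, J_flat e2]

lemma f_K (y : D) : f (K (0, y)) = J (0, y) := by
  change (if w (h (0, y)) - 2 * w (c (0, y)) ≤ 0 then Q (ht (K (0, y))) else O) = J (0, y)
  apply Subtype.ext
  have hw := w_nonneg (h (0, y))
  have hq : (Q (ht (K (0, y))) : ℝ × ℝ) = q (h (0, y)) := rfl
  have hj : (J (0, y) : ℝ × ℝ) = q (c (0, y)) := rfl
  rcases hc (0, (y : ℝ)) with e | e
  · rw [if_pos (by rw [e] at hw ⊢; linarith), hq, hj, e]
  · rw [hj, q_of_w e]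
    split_ifs with hp
    · rw [hq]
      apply q_of_w
      rw [e] at hp
      linarith
    · rfl

/-- The homotopy on the Hawaiian earring. -/
def homH : ContinuousMap.Homotopy (f.comp g) (ContinuousMap.id H) where
  toFun x := J (x.1, sec x.2)
  continuous_toFun := by
    have hc : Continuous (Prod.map id Q : unitInterval × D → unitInterval × H) :=
      continuous_id.prodMap Q_cont
    have hq : IsQuotientMap (Prod.map id Q : unitInterval × D → unitInterval × H) :=
      hc.isClosedMap.isQuotientMap hc (Function.surjective_id.prodMap Q_surj)
    rw [hq.continuous_iff]
    have : (fun x : unitInterval × H => J (x.1, sec x.2)) ∘ Prod.map id Q = J :=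
      funext fun x => J_sec x.1 x.2
    rw [this]
    exact J_cont
  map_zero_left p := (f_K (sec p)).symm
  map_one_left p := by
    change J (1, sec p) = p
    conv_rhs => rw [← Q_sec p]
    apply Subtype.ext
    simp only [J, Q, c_one]

theorem main : Nonempty (ContinuousMap.HomotopyEquiv modifiedHawaiianEarring hawaiianEarring) :=
  ⟨⟨f, g, ⟨homM⟩, ⟨homH⟩⟩⟩

end MHE

end

/-- The Modified Hawaiian earring is homotopy equivalent to the Hawaiian earring. -/
theorem modifiedHawaiianEarring_homotopyEquiv_hawaiianEarring :
    Nonempty (ContinuousMap.HomotopyEquiv modifiedHawaiianEarring hawaiianEarring) := by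
  exact MHE.main
end

section
/- The subspace U = HA ∩ {(x,y,z) ∈ ℝ³ : 0 ≤ z < 2/3} of the Formal Harmonic archipelago is homotopy equivalent to the Hawaiian earring ℍ. -/
/-- The open subspace `U = HA ∩ {0 ≤ z < 2/3}` of the Formal Harmonic archipelago. -/
def subspaceU : Set (ℝ × ℝ × ℝ) :=
  formalHarmonicArchipelago ∩ {p | 0 ≤ p.2.2 ∧ p.2.2 < 2 / 3}

open Filter Topology

noncomputable section

namespace HAproof

/-! ### Sums of functions with disjoint supports -/

theorem dsum_single {X E : Type*} [NormedAddCommGroup E] (g : ℕ → X → E)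
    (x : X) (n : ℕ) (h : ∀ m, m ≠ n → g m x = 0) : ∑' m, g m x = g n x :=
  tsum_eq_single n h

theorem dsum_exists {X E : Type*} [NormedAddCommGroup E] (g : ℕ → X → E)
    (hd : ∀ x m n, g m x ≠ 0 → g n x ≠ 0 → m = n) (x : X) :
    ∃ n, ∑' m, g m x = g n x ∧ ∀ m, m ≠ n → g m x = 0 := by
  by_cases h : ∃ n, g n x ≠ 0
  · obtain ⟨n, hn⟩ := h
    have h2 : ∀ m, m ≠ n → g m x = 0 := by
      intro m hm
      by_contra h3
      exact hm (hd x m n h3 hn)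
    exact ⟨n, dsum_single g x n h2, h2⟩
  · push Not at h
    exact ⟨0, dsum_single g x 0 (fun m _ => h m), fun m _ => h m⟩

theorem dsum_continuous {X E : Type*} [TopologicalSpace X] [NormedAddCommGroup E]
    (g : ℕ → X → E) (hc : ∀ n, Continuous (g n)) (c : ℕ → ℝ) (hc0 : Tendsto c atTop (𝓝 0))
    (hb : ∀ n x, ‖g n x‖ ≤ c n)
    (hd : ∀ x m n, g m x ≠ 0 → g n x ≠ 0 → m = n) :
    Continuous (fun x => ∑' m, g m x) := by
  have hu : TendstoUniformly (fun N x => ∑ m ∈ Finset.range N, g m x)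
      (fun x => ∑' m, g m x) atTop := by
    rw [Metric.tendstoUniformly_iff]
    intro ε hε
    have h1 := hc0.eventually (gt_mem_nhds hε)
    obtain ⟨N0, hN0⟩ := eventually_atTop.1 h1
    filter_upwards [eventually_ge_atTop N0] with N hN x
    obtain ⟨n, hn, hz⟩ := dsum_exists g hd x
    rw [hn]
    by_cases hnN : n < N
    · rw [Finset.sum_eq_single n (fun m _ hm => hz m hm)
        (fun h => absurd (Finset.mem_range.2 hnN) h)]
      simpa using hε
    · rw [Finset.sum_eq_zero]
      · rw [dist_zero_right]
        exact (hb n x).trans_lt (hN0 n (by omega))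
      · intro m hm
        apply hz
        have := Finset.mem_range.1 hm
        omega
  exact hu.continuous (Frequently.of_forall fun N =>
    continuous_finsetSum _ (fun m _ => hc m))

/-! ### Constants -/

def ct (n : ℕ) : ℝ := 1 / ((n : ℝ) + 1)
def rd (n : ℕ) : ℝ := 1 / (3 * ((n : ℝ) + 1) * ((n : ℝ) + 2))
def be (n : ℕ) : ℝ := ct n - rd n
def ta (n : ℕ) : ℝ := ct n + rd n

theorem ct_pos (n : ℕ) : 0 < ct n := by unfold ct; positivity
theorem rd_pos (n : ℕ) : 0 < rd n := by unfold rd; positivity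

theorem rd_le (n : ℕ) : 6 * rd n ≤ ct n := by
  unfold rd ct
  rw [mul_one_div, div_le_div_iff₀ (by positivity) (by positivity)]
  have : (0 : ℝ) ≤ n := n.cast_nonneg
  nlinarith

theorem ct_le_one (n : ℕ) : ct n ≤ 1 := by
  unfold ct
  rw [div_le_one (by positivity)]
  have : (0 : ℝ) ≤ n := n.cast_nonneg
  linarith

theorem ct_succ (n : ℕ) : ct n - ct (n + 1) = 3 * rd n := by
  unfold rd ct
  push_cast
  field_simp
  ring

theorem ct_anti {m n : ℕ} (h : m ≤ n) : ct n ≤ ct m := by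
  unfold ct
  have : (m : ℝ) ≤ n := by exact_mod_cast h
  gcongr

theorem rd_anti {m n : ℕ} (h : m ≤ n) : rd n ≤ rd m := by
  unfold rd
  have : (m : ℝ) ≤ n := by exact_mod_cast h
  gcongr

theorem wide {m n : ℕ} (h : m < n) : ct n + 3 / 2 * rd n ≤ ct m - 3 / 2 * rd m := by
  have h1 := ct_succ m
  have h2 := ct_anti (Nat.succ_le_of_lt h)
  have h3 := rd_anti h.le
  have h4 : (m.succ) = m + 1 := rfl
  rw [h4] at h2
  linarith

theorem ct_tendsto : Tendsto ct atTop (𝓝 0) := tendsto_one_div_add_atTop_nhds_zero_nat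

theorem ct_mul_tendsto (c : ℝ) : Tendsto (fun n => c * ct n) atTop (𝓝 0) := by
  simpa using ct_tendsto.const_mul c

theorem ta_lt_be {m n : ℕ} (h : m < n) : ta n < be m := by
  have := wide h
  have := rd_pos n
  have := rd_pos m
  unfold ta be
  linarith

theorem be_pos (n : ℕ) : 0 < be n := by
  have := rd_le n; have := rd_pos n; unfold be; linarith

theorem be_lt_ta (n : ℕ) : be n < ta n := by
  have := rd_pos n; unfold be ta; linarith

theorem ta_pos (n : ℕ) : 0 < ta n := (be_pos n).trans (be_lt_ta n)

theorem ta_le (n : ℕ) : ta n ≤ 2 * ct n := by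
  have := rd_le n; have := rd_pos n; unfold ta; linarith

theorem ta_zero : ta 0 = 7 / 6 := by
  unfold ta ct rd; norm_num

theorem ta_le' (n : ℕ) : ta n ≤ 7 / 6 := by
  have h1 := ct_le_one n
  have := rd_le n; unfold ta; linarith

theorem interval_unique {y : ℝ} {m n : ℕ} (hm : y ∈ Set.Ioo (be m) (ta m))
    (hn : y ∈ Set.Ioo (be n) (ta n)) : m = n := by
  rcases lt_trichotomy m n with h | h | h
  · have := ta_lt_be h
    linarith [hm.1, hn.2]
  · exact h
  · have := ta_lt_be h
    linarith [hn.1, hm.2]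

/-! ### The profile function -/

def an (n : ℕ) (y : ℝ) : ℝ := Real.sqrt (rd n ^ 2 - (y - ct n) ^ 2)

theorem an_continuous (n : ℕ) : Continuous (an n) := by
  unfold an; fun_prop

theorem an_nonneg (n : ℕ) (y : ℝ) : 0 ≤ an n y := Real.sqrt_nonneg _

theorem an_le (n : ℕ) (y : ℝ) : an n y ≤ rd n := by
  unfold an
  rw [Real.sqrt_le_left (rd_pos n).le]
  nlinarith [sq_nonneg (y - ct n)]

theorem an_pos_iff (n : ℕ) (y : ℝ) : 0 < an n y ↔ y ∈ Set.Ioo (be n) (ta n) := by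
  unfold an be ta
  rw [Real.sqrt_pos, sub_pos, sq_lt_sq, abs_of_pos (rd_pos n), abs_lt]
  constructor
  · rintro ⟨h1, h2⟩; constructor <;> linarith
  · rintro ⟨h1, h2⟩; constructor <;> linarith

theorem an_ne {n : ℕ} {y : ℝ} (h : an n y ≠ 0) : y ∈ Set.Ioo (be n) (ta n) :=
  (an_pos_iff n y).1 (lt_of_le_of_ne (an_nonneg n y) h.symm)

theorem an_eq_zero {n : ℕ} {y : ℝ} (h : y ∉ Set.Ioo (be n) (ta n)) : an n y = 0 := by
  by_contra h1
  exact h (an_ne h1)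

theorem an_ta (n : ℕ) : an n (ta n) = 0 := an_eq_zero (fun h => lt_irrefl _ h.2)

theorem an_le_be {n : ℕ} {y : ℝ} (h : y ≤ be n) : an n y = 0 :=
  an_eq_zero (fun h' => absurd h'.1 (not_lt.2 h))

theorem an_disj (y : ℝ) (m n : ℕ) (hm : an m y ≠ 0) (hn : an n y ≠ 0) : m = n :=
  interval_unique (an_ne hm) (an_ne hn)

def aa (y : ℝ) : ℝ := ∑' n, an n y

theorem aa_continuous : Continuous aa := by
  apply dsum_continuous an an_continuous ct ct_tendsto _ an_disj
  intro n y
  rw [Real.norm_of_nonneg (an_nonneg n y)]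
  have := an_le n y; have := rd_le n; have := rd_pos n
  linarith

theorem aa_eq {n : ℕ} {y : ℝ} (h : y ∈ Set.Ioo (be n) (ta n)) : aa y = an n y := by
  apply dsum_single an y n
  intro m hm
  by_contra h1
  exact hm (interval_unique (an_ne h1) h)

theorem aa_eq_zero {y : ℝ} (h : ∀ n, y ∉ Set.Ioo (be n) (ta n)) : aa y = 0 := by
  have : aa y = an 0 y := by
    apply dsum_single an y 0
    intro m hm
    exact an_eq_zero (h m)
  rw [this, an_eq_zero (h 0)]

theorem aa_nonneg (y : ℝ) : 0 ≤ aa y := tsum_nonneg fun n => an_nonneg n y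

theorem aa_ne {y : ℝ} (h : aa y ≠ 0) : ∃ n, y ∈ Set.Ioo (be n) (ta n) := by
  by_contra h1
  push Not at h1
  exact h (aa_eq_zero h1)

theorem aa_pos {n : ℕ} {y : ℝ} (h : y ∈ Set.Ioo (be n) (ta n)) : 0 < aa y := by
  rw [aa_eq h]; exact (an_pos_iff n y).2 h

theorem aa_zero : aa 0 = 0 :=
  aa_eq_zero fun n h => absurd h.1 (not_lt.2 (be_pos n).le)

theorem aa_le {y : ℝ} (hy : 0 ≤ y) : aa y ≤ y := by
  by_cases h : aa y = 0
  · rw [h]; exact hy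
  · obtain ⟨n, hn⟩ := aa_ne h
    rw [aa_eq hn]
    have := an_le n y; have := rd_le n; have h3 := hn.1; have := rd_pos n
    unfold be at h3
    linarith

/-- The planar chain of circles. -/
def XX : Set (ℝ × ℝ) := {q | 0 ≤ q.2 ∧ q.2 ≤ 7 / 6 ∧ |q.1| = aa q.2}

def al (y : ℝ) : ℝ × ℝ := (aa y, y)

theorem al_continuous : Continuous al := aa_continuous.prodMk continuous_id

theorem al_mem {y : ℝ} (h0 : 0 ≤ y) (h1 : y ≤ 7 / 6) : al y ∈ XX :=
  ⟨h0, h1, abs_of_nonneg (aa_nonneg y)⟩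

theorem al_zero : al 0 = 0 := by
  unfold al; rw [aa_zero]; rfl

theorem norm_XX {q : ℝ × ℝ} (h : q ∈ XX) : ‖q‖ ≤ q.2 := by
  rw [Prod.norm_def]
  apply max_le
  · rw [Real.norm_eq_abs, h.2.2]
    exact aa_le h.1
  · rw [Real.norm_of_nonneg h.1]

/-! ### Loops in the Hawaiian earring and in the chain -/

/-- Parametrisation of the `n`-th circle of the earring. -/
def EE (n : ℕ) (t : ℝ) : ℝ × ℝ :=
  (2 * ct n * (t * Real.sqrt (1 - t ^ 2)), 2 * ct n * Real.sqrt (1 - t ^ 2) ^ 2)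

theorem EE_continuous (n : ℕ) : Continuous (EE n) := by
  unfold EE; fun_prop

theorem EE_zero {n : ℕ} {t : ℝ} (h : 1 ≤ |t|) : EE n t = 0 := by
  have : Real.sqrt (1 - t ^ 2) = 0 := by
    apply Real.sqrt_eq_zero_of_nonpos
    nlinarith [sq_abs t]
  unfold EE
  rw [this]
  simp

theorem mem_earring {p : ℝ × ℝ} : p ∈ hawaiianEarring ↔
    ∃ n : ℕ, p.1 ^ 2 + p.2 ^ 2 = 2 * ct n * p.2 := by
  unfold hawaiianEarring ct
  simp only [Set.mem_iUnion, Set.mem_ofPred_eq, exists_prop]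
  constructor
  · rintro ⟨n, hn, h⟩
    obtain ⟨k, rfl⟩ := Nat.exists_eq_add_of_le' hn
    refine ⟨k, ?_⟩
    push_cast at h
    linear_combination h
  · rintro ⟨n, h⟩
    refine ⟨n + 1, by omega, ?_⟩
    push_cast
    linear_combination h

theorem sqrt_sq_one_sub {t : ℝ} (h : |t| ≤ 1) : Real.sqrt (1 - t ^ 2) ^ 2 = 1 - t ^ 2 := by
  apply Real.sq_sqrt
  nlinarith [sq_abs t, abs_nonneg t]

theorem EE_circle (n : ℕ) (t : ℝ) :
    (EE n t).1 ^ 2 + (EE n t).2 ^ 2 = 2 * ct n * (EE n t).2 := by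
  by_cases h : |t| ≤ 1
  · have h1 := sqrt_sq_one_sub h
    simp only [EE]
    linear_combination (2 * ct n) ^ 2 * (Real.sqrt (1 - t ^ 2) ^ 2) * h1
  · rw [EE_zero (not_le.1 h).le]
    simp

theorem EE_mem (n : ℕ) (t : ℝ) : EE n t ∈ hawaiianEarring := mem_earring.2 ⟨n, EE_circle n t⟩

theorem zero_mem_earring : (0 : ℝ × ℝ) ∈ hawaiianEarring := mem_earring.2 ⟨0, by simp⟩

theorem norm_circle {p : ℝ × ℝ} {n : ℕ} (h : p.1 ^ 2 + p.2 ^ 2 = 2 * ct n * p.2) :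
    ‖p‖ ≤ 2 * ct n := by
  have hc := ct_pos n
  have h1 : |p.2| ≤ 2 * ct n := by
    have : p.2 ^ 2 ≤ 2 * ct n * p.2 := by nlinarith [sq_nonneg p.1]
    rw [abs_le]
    constructor <;> nlinarith
  rw [Prod.norm_def]
  apply max_le
  · rw [Real.norm_eq_abs]
    apply abs_le_of_sq_le_sq _ (by positivity)
    nlinarith [abs_le.1 h1, sq_nonneg p.2]
  · exact h1

theorem norm_EE (n : ℕ) (t : ℝ) : ‖EE n t‖ ≤ 2 * ct n := norm_circle (EE_circle n t)

def eta (n : ℕ) (t : ℝ) : ℝ := ta n * max 0 (1 - |t|)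

theorem eta_continuous (n : ℕ) : Continuous (eta n) := by
  unfold eta; fun_prop

theorem eta_nonneg (n : ℕ) (t : ℝ) : 0 ≤ eta n t :=
  mul_nonneg (ta_pos n).le (le_max_left _ _)

theorem eta_le (n : ℕ) (t : ℝ) : eta n t ≤ ta n := by
  unfold eta
  have : max 0 (1 - |t|) ≤ 1 := max_le zero_le_one (by linarith [abs_nonneg t])
  nlinarith [ta_pos n]

theorem eta_eq {n : ℕ} {t : ℝ} (h : |t| ≤ 1) : eta n t = ta n * (1 - |t|) := by
  unfold eta; rw [max_eq_right (by linarith)]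

theorem eta_zero (n : ℕ) : eta n 0 = ta n := by
  unfold eta; simp

theorem eta_far {n : ℕ} {t : ℝ} (h : 1 ≤ |t|) : eta n t = 0 := by
  unfold eta; rw [max_eq_left (by linarith)]; simp

/-- The loop in the chain that runs through the `n`-th circle. -/
def ga (n : ℕ) (t : ℝ) : ℝ × ℝ :=
  (aa (eta n t) - 2 * an n (eta n (min t 0)), eta n t)

theorem ga_continuous (n : ℕ) : Continuous (ga n) := by
  have h1 := aa_continuous
  have h2 := eta_continuous n
  have h3 := an_continuous n
  unfold ga
  fun_prop

theorem ga_of_nonneg {n : ℕ} {t : ℝ} (h : 0 ≤ t) : ga n t = al (eta n t) := by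
  unfold ga al
  rw [min_eq_right h, eta_zero, an_ta]
  simp

theorem ga_of_nonpos_out {n : ℕ} {t : ℝ} (h : t ≤ 0)
    (h2 : eta n t ∉ Set.Ioo (be n) (ta n)) : ga n t = al (eta n t) := by
  unfold ga al
  rw [min_eq_left h, an_eq_zero h2]
  simp

theorem ga_of_nonpos_in {n : ℕ} {t : ℝ} (h : t ≤ 0)
    (h2 : eta n t ∈ Set.Ioo (be n) (ta n)) : ga n t = (- aa (eta n t), eta n t) := by
  unfold ga
  rw [min_eq_left h, ← aa_eq h2]
  ext
  · simp; ring
  · rfl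

theorem ga_mem (n : ℕ) (t : ℝ) : ga n t ∈ XX := by
  have h0 := eta_nonneg n t
  have h1 := (eta_le n t).trans (ta_le' n)
  rcases le_total 0 t with h | h
  · rw [ga_of_nonneg h]; exact al_mem h0 h1
  · by_cases h2 : eta n t ∈ Set.Ioo (be n) (ta n)
    · rw [ga_of_nonpos_in h h2]
      exact ⟨h0, h1, by simp [abs_of_nonneg (aa_nonneg _)]⟩
    · rw [ga_of_nonpos_out h h2]; exact al_mem h0 h1

theorem ga_far {n : ℕ} {t : ℝ} (h : 1 ≤ |t|) : ga n t = 0 := by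
  have h1 := norm_XX (ga_mem n t)
  have h2 : (ga n t).2 = 0 := eta_far h
  rw [h2] at h1
  exact norm_le_zero_iff.1 h1

theorem norm_ga (n : ℕ) (t : ℝ) : ‖ga n t‖ ≤ 2 * ct n :=
  (norm_XX (ga_mem n t)).trans ((eta_le n t).trans (ta_le n))

/-! ### Maps out of the Hawaiian earring -/

def ZZ (n : ℕ) (p : ℝ × ℝ) : ℝ :=
  p.2 * (max 0 (1 - |((n : ℝ) + 1) - 2 * p.2 / (p.1 ^ 2 + p.2 ^ 2)|) * (((n : ℝ) + 1) / 2))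

theorem sq_add_ne {p : ℝ × ℝ} (h : p ≠ 0) : p.1 ^ 2 + p.2 ^ 2 ≠ 0 := by
  intro h1
  apply h
  ext
  · simp; nlinarith [sq_nonneg p.1, sq_nonneg p.2]
  · simp; nlinarith [sq_nonneg p.1, sq_nonneg p.2]

theorem ZZ_zero (n : ℕ) : ZZ n 0 = 0 := by simp [ZZ]

theorem ZZ_continuous (n : ℕ) : Continuous (ZZ n) := by
  rw [continuous_iff_continuousAt]
  intro p
  by_cases hp : p = 0
  · subst hp
    unfold ContinuousAt
    rw [ZZ_zero]
    apply squeeze_zero_norm (a := fun p : ℝ × ℝ => |p.2| * (((n : ℝ) + 1) / 2))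
    · intro p
      unfold ZZ
      rw [norm_mul, Real.norm_eq_abs]
      apply mul_le_mul_of_nonneg_left _ (abs_nonneg _)
      rw [Real.norm_of_nonneg (by positivity)]
      have : max 0 (1 - |((n : ℝ) + 1) - 2 * p.2 / (p.1 ^ 2 + p.2 ^ 2)|) ≤ 1 :=
        max_le zero_le_one (by linarith [abs_nonneg (((n : ℝ) + 1) - 2 * p.2 / (p.1 ^ 2 + p.2 ^ 2))])
      have h2 : (0 : ℝ) ≤ ((n : ℝ) + 1) / 2 := by positivity
      nlinarith
    · have : Continuous (fun p : ℝ × ℝ => |p.2| * (((n : ℝ) + 1) / 2)) := by fun_prop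
      simpa using this.tendsto 0
  · have h1 : ContinuousAt (fun p : ℝ × ℝ => 2 * p.2 / (p.1 ^ 2 + p.2 ^ 2)) p := by
      apply ContinuousAt.div
      · fun_prop
      · fun_prop
      · exact sq_add_ne hp
    unfold ZZ
    fun_prop

theorem ZZ_circle {p : ℝ × ℝ} {k : ℕ} (h : p.1 ^ 2 + p.2 ^ 2 = 2 * ct k * p.2) (n : ℕ) :
    ZZ n p = if n = k then p.2 * (((k : ℝ) + 1) / 2) else 0 := by
  by_cases hp : p = 0
  · subst hp; simp [ZZ_zero]
  · have h1 := sq_add_ne hp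
    have h2 : 2 * p.2 / (p.1 ^ 2 + p.2 ^ 2) = (k : ℝ) + 1 := by
      have h3 : p.2 ≠ 0 := by
        intro h4; rw [h, h4] at h1; simp at h1
      rw [h]
      unfold ct
      field_simp
    unfold ZZ
    rw [h2]
    split_ifs with h3
    · subst h3; simp
    · have : (1 : ℝ) ≤ |((n : ℝ) + 1) - ((k : ℝ) + 1)| := by
        have : (1 : ℤ) ≤ |(n : ℤ) - k| := Int.one_le_abs (by omega)
        have h5 : (1 : ℝ) ≤ |(n : ℝ) - k| := by exact_mod_cast this
        convert h5 using 2
        ring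
      rw [max_eq_left (by linarith)]
      simp

def SS (n : ℕ) (p : ℝ × ℝ) : ℝ := Real.sqrt (1 - ZZ n p)

theorem SS_continuous (n : ℕ) : Continuous (SS n) := by
  have := ZZ_continuous n
  unfold SS; fun_prop

def TT (n : ℕ) (p : ℝ × ℝ) : ℝ := if 0 ≤ p.1 then SS n p else - SS n p

theorem abs_TT (n : ℕ) (p : ℝ × ℝ) : |TT n p| = SS n p := by
  unfold TT
  have : 0 ≤ SS n p := Real.sqrt_nonneg _
  split_ifs
  · exact abs_of_nonneg this
  · rw [abs_neg]; exact abs_of_nonneg this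

theorem SS_other {p : ℝ × ℝ} {k : ℕ} (h : p.1 ^ 2 + p.2 ^ 2 = 2 * ct k * p.2) {n : ℕ}
    (hn : n ≠ k) : SS n p = 1 := by
  unfold SS
  rw [ZZ_circle h, if_neg hn]
  simp

theorem SS_EE {n : ℕ} {t : ℝ} (ht : |t| ≤ 1) : SS n (EE n t) = |t| := by
  unfold SS
  rw [ZZ_circle (EE_circle n t), if_pos rfl]
  have : 1 - (EE n t).2 * (((n : ℝ) + 1) / 2) = t ^ 2 := by
    simp only [EE]
    rw [sqrt_sq_one_sub ht]
    unfold ct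
    field_simp
    ring
  rw [this, Real.sqrt_sq_eq_abs]

theorem TT_EE {n : ℕ} {t : ℝ} (ht : |t| < 1) : TT n (EE n t) = t := by
  unfold TT
  rw [SS_EE ht.le]
  have hs : 0 < Real.sqrt (1 - t ^ 2) := by
    apply Real.sqrt_pos.2
    nlinarith [sq_abs t, abs_nonneg t]
  have hc := ct_pos n
  rcases le_or_gt 0 t with h | h
  · rw [if_pos, abs_of_nonneg h]
    simp only [EE]
    positivity
  · rw [if_neg, abs_of_neg h, neg_neg]
    simp only [EE]
    rw [not_le]
    have : t * Real.sqrt (1 - t ^ 2) < 0 := mul_neg_of_neg_of_pos h hs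
    nlinarith

theorem EE_TT {p : ℝ × ℝ} {n : ℕ} (h : p.1 ^ 2 + p.2 ^ 2 = 2 * ct n * p.2) :
    EE n (TT n p) = p := by
  have hc := ct_pos n
  have hS : 0 ≤ SS n p := Real.sqrt_nonneg _
  have hct : ct n * ((n : ℝ) + 1) = 1 := by unfold ct; field_simp
  have hp2 : 0 ≤ p.2 := by nlinarith [sq_nonneg p.1, sq_nonneg p.2]
  have hp3 : p.2 ≤ 2 * ct n := by
    have := norm_circle h
    exact (le_abs_self _).trans ((norm_snd_le p).trans this)
  have hz : p.2 * (((n : ℝ) + 1) / 2) ≤ 1 := by nlinarith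
  have hz0 : 0 ≤ p.2 * (((n : ℝ) + 1) / 2) := by positivity
  have hS2 : SS n p ^ 2 = 1 - p.2 * (((n : ℝ) + 1) / 2) := by
    unfold SS
    rw [ZZ_circle h, if_pos rfl, Real.sq_sqrt (by linarith)]
  have hT2 : TT n p ^ 2 = 1 - p.2 * (((n : ℝ) + 1) / 2) := by
    rw [← sq_abs, abs_TT, hS2]
  have hR : Real.sqrt (1 - TT n p ^ 2) ^ 2 = p.2 * (((n : ℝ) + 1) / 2) := by
    rw [Real.sq_sqrt] <;> rw [hT2]
    · ring
    · linarith
  set R := Real.sqrt (1 - TT n p ^ 2) with hRdef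
  have hR0 : 0 ≤ R := Real.sqrt_nonneg _
  have e2 : (EE n (TT n p)).2 = p.2 := by
    simp only [EE]
    rw [← hRdef, hR]
    linear_combination p.2 * hct
  have e1 : (EE n (TT n p)).1 ^ 2 = p.1 ^ 2 := by
    have := EE_circle n (TT n p)
    rw [e2] at this
    linarith
  ext
  · rcases le_or_gt 0 p.1 with h0 | h0
    · have hT : 0 ≤ TT n p := by unfold TT; rw [if_pos h0]; exact hS
      have : 0 ≤ (EE n (TT n p)).1 := by simp only [EE]; rw [← hRdef]; positivity
      exact (sq_eq_sq₀ this h0).1 e1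
    · have hT : TT n p ≤ 0 := by unfold TT; rw [if_neg (not_le.2 h0)]; linarith
      have : (EE n (TT n p)).1 ≤ 0 := by
        simp only [EE]; rw [← hRdef]
        have := mul_nonpos_of_nonpos_of_nonneg hT hR0
        nlinarith
      have := (sq_eq_sq₀ (neg_nonneg.2 this) (neg_nonneg.2 h0.le)).1 (by linarith)
      linarith
  · exact e2

/-- Families vanishing outside `(-1, 1)` glue on the earring. -/
theorem HM_EE {E : Type*} [NormedAddCommGroup E] (Ψ : ℕ → ℝ → E)
    (h0 : ∀ n t, 1 ≤ |t| → Ψ n t = 0) (n : ℕ) (t : ℝ) :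
    ∑' m, Ψ m (TT m (EE n t)) = Ψ n t := by
  by_cases ht : |t| < 1
  · rw [dsum_single (fun m t' => Ψ m (TT m (EE n t'))) t n]
    · simp only [TT_EE ht]
    · intro m hm
      apply h0
      rw [abs_TT, SS_other (EE_circle n t) hm]
  · push Not at ht
    rw [h0 n t ht, EE_zero ht]
    convert tsum_zero with m
    apply h0
    rw [abs_TT]
    unfold SS
    simp [ZZ_zero]

theorem HM_continuous {S E : Type*} [TopologicalSpace S] [NormedAddCommGroup E]
    (Ψ : ℕ → S → ℝ → E) (hc : ∀ n, Continuous (fun q : S × ℝ => Ψ n q.1 q.2))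
    (h0 : ∀ n s t, 1 ≤ |t| → Ψ n s t = 0)
    (c : ℝ) (hb : ∀ n s t, ‖Ψ n s t‖ ≤ c * ct n) :
    Continuous (fun q : S × hawaiianEarring => ∑' m, Ψ m q.1 (TT m q.2.1)) := by
  apply dsum_continuous (fun m (q : S × hawaiianEarring) => Ψ m q.1 (TT m q.2.1)) _ _
    (ct_mul_tendsto c)
  · intro n q; exact hb n _ _
  · rintro ⟨s, p, hp⟩ m n hm hn
    obtain ⟨k, hk⟩ := mem_earring.1 hp
    have key : ∀ j, Ψ j s (TT j p) ≠ 0 → j = k := by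
      intro j hj
      by_contra hjk
      apply hj
      apply h0
      rw [abs_TT, SS_other hk hjk]
    rw [key m hm, key n hn]
  · intro n
    have hS := SS_continuous n
    have : (fun q : S × hawaiianEarring => Ψ n q.1 (TT n q.2.1)) =
        fun q => if 0 ≤ q.2.1.1 then (fun q : S × ℝ => Ψ n q.1 q.2) (q.1, SS n q.2.1)
          else (fun q : S × ℝ => Ψ n q.1 q.2) (q.1, - SS n q.2.1) := by
      funext q
      unfold TT
      split_ifs <;> rfl
    rw [this]
    have hcn := hc n
    apply Continuous.if_le
    · exact hcn.comp (by fun_prop)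
    · exact hcn.comp (by fun_prop)
    · fun_prop
    · fun_prop
    · rintro ⟨s, p, hp⟩ hx
      simp only at hx ⊢
      obtain ⟨k, hk⟩ := mem_earring.1 hp
      by_cases hnk : n = k
      · subst hnk
        rw [← hx] at hk
        have : p.2 = 0 ∨ p.2 = 2 * ct n := by
          have : p.2 * (p.2 - 2 * ct n) = 0 := by linear_combination hk
          rcases mul_eq_zero.1 this with h | h
          · exact Or.inl h
          · exact Or.inr (by linarith)
        rcases this with h | h
        · have : SS n p = 1 := by simp [SS, ZZ, h]
          rw [this, h0 n s 1 (by simp), h0 n s (-1) (by simp)]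
        · have : SS n p = 0 := by
            have h2 : p.1 ^ 2 + p.2 ^ 2 = 2 * ct n * p.2 := by rw [← hx]; exact hk
            unfold SS
            rw [ZZ_circle h2, if_pos rfl, h]
            unfold ct
            have : 1 - 2 * (1 / ((n : ℝ) + 1)) * (((n : ℝ) + 1) / 2) = 0 := by field_simp; ring
            rw [this, Real.sqrt_zero]
          rw [this, neg_zero]
      · have := SS_other hk hnk
        rw [this, h0 n s 1 (by simp), h0 n s (-1) (by simp)]

/-! ### The map from the chain to the earring -/

def vv (n : ℕ) (y : ℝ) : ℝ := (y - ct n) / rd n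

theorem vv_continuous (n : ℕ) : Continuous (vv n) := by
  unfold vv; fun_prop

theorem vv_be (n : ℕ) : vv n (be n) = -1 := by
  have := (rd_pos n).ne'
  unfold vv be; field_simp; ring

theorem vv_ta (n : ℕ) : vv n (ta n) = 1 := by
  have := (rd_pos n).ne'
  unfold vv ta; field_simp; ring

theorem vv_zero (n : ℕ) : vv n 0 ≤ -1 := by
  have h1 := rd_pos n
  have h2 := rd_le n
  unfold vv
  rw [div_le_iff₀ h1]
  linarith

theorem vv_out {n : ℕ} {y : ℝ} (h : y ∉ Set.Ioo (be n) (ta n)) : 1 ≤ |vv n y| := by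
  have h1 := rd_pos n
  by_contra h2
  push Not at h2
  unfold vv at h2
  rw [abs_div, abs_of_pos h1, div_lt_one h1, abs_lt] at h2
  apply h
  unfold be ta
  constructor <;> linarith [h2.1, h2.2]

def FF (y : ℝ) : ℝ × ℝ := ∑' n, EE n (vv n y)

theorem EEvv_ne {n : ℕ} {y : ℝ} (h : EE n (vv n y) ≠ 0) : y ∈ Set.Ioo (be n) (ta n) := by
  by_contra h1
  exact h (EE_zero (vv_out h1))

theorem FF_continuous : Continuous FF := by
  apply dsum_continuous (fun n y => EE n (vv n y)) _ _ (ct_mul_tendsto 2)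
  · intro n y; exact norm_EE _ _
  · intro y m n hm hn
    exact interval_unique (EEvv_ne hm) (EEvv_ne hn)
  · intro n
    exact (EE_continuous n).comp (vv_continuous n)

theorem FF_in {n : ℕ} {y : ℝ} (h : y ∈ Set.Ioo (be n) (ta n)) : FF y = EE n (vv n y) := by
  apply dsum_single (fun n y => EE n (vv n y)) y n
  intro m hm
  by_contra h1
  exact hm (interval_unique (EEvv_ne h1) h)

theorem FF_out {y : ℝ} (h : aa y = 0) : FF y = 0 := by
  unfold FF
  convert tsum_zero with n
  apply EE_zero
  apply vv_out
  intro h1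
  exact (aa_pos h1).ne' h

theorem FF_mem (y : ℝ) : FF y ∈ hawaiianEarring := by
  by_cases h : aa y = 0
  · rw [FF_out h]; exact zero_mem_earring
  · obtain ⟨n, hn⟩ := aa_ne h
    rw [FF_in hn]; exact EE_mem _ _

def ff0 (q : ℝ × ℝ) : ℝ × ℝ := if 0 ≤ q.1 then 0 else FF q.2

theorem ff0_mem (q : ℝ × ℝ) : ff0 q ∈ hawaiianEarring := by
  unfold ff0
  split_ifs
  · exact zero_mem_earring
  · exact FF_mem _

theorem ff0_continuous : Continuous (fun q : XX => ff0 q.1) := by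
  have := FF_continuous
  unfold ff0
  apply Continuous.if_le
  · fun_prop
  · fun_prop
  · fun_prop
  · fun_prop
  · rintro ⟨q, h0, h1, h2⟩ hx
    simp only at hx ⊢
    rw [← hx, abs_zero] at h2
    rw [FF_out h2.symm]

def ff : C(XX, hawaiianEarring) :=
  ⟨fun q => ⟨ff0 q.1, ff0_mem q.1⟩, ff0_continuous.subtype_mk _⟩

/-! ### The map from the earring to the chain -/

def gg0 (p : ℝ × ℝ) : ℝ × ℝ := ∑' n, ga n (TT n p)

theorem gg0_EE (n : ℕ) (t : ℝ) : gg0 (EE n t) = ga n t :=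
  HM_EE ga (fun _ _ h => ga_far h) n t

theorem earring_cases {p : ℝ × ℝ} (h : p ∈ hawaiianEarring) : ∃ n t, p = EE n t := by
  obtain ⟨n, hn⟩ := mem_earring.1 h
  exact ⟨n, TT n p, (EE_TT hn).symm⟩

theorem gg0_mem {p : ℝ × ℝ} (h : p ∈ hawaiianEarring) : gg0 p ∈ XX := by
  obtain ⟨n, t, rfl⟩ := earring_cases h
  rw [gg0_EE]; exact ga_mem n t

theorem gg0_continuous : Continuous (fun p : hawaiianEarring => gg0 p.1) := by
  have h := HM_continuous (S := Unit) (fun n _ t => ga n t)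
    (fun n => (ga_continuous n).comp continuous_snd) (fun n _ t h => ga_far h) 2
    (fun n _ t => norm_ga n t)
  have h2 : Continuous (fun p : hawaiianEarring => ((), p)) := by fun_prop
  have h3 := h.comp h2
  simp only [Function.comp_def] at h3
  unfold gg0
  exact h3

def gg : C(hawaiianEarring, XX) :=
  ⟨fun p => ⟨gg0 p.1, gg0_mem p.2⟩, gg0_continuous.subtype_mk _⟩

/-! ### First homotopy -/

def ph (n : ℕ) (t : ℝ) : ℝ := vv n (eta n (min t 0))

theorem ff_ga (n : ℕ) (t : ℝ) : ff0 (ga n t) = EE n (ph n t) := by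
  unfold ph
  rcases le_total 0 t with h | h
  · rw [min_eq_right h, eta_zero, vv_ta, EE_zero (by simp), ga_of_nonneg h]
    unfold ff0 al
    rw [if_pos (aa_nonneg _)]
  · rw [min_eq_left h]
    by_cases h2 : eta n t ∈ Set.Ioo (be n) (ta n)
    · rw [ga_of_nonpos_in h h2]
      unfold ff0
      have := aa_pos h2
      rw [if_neg (by simpa using this), FF_in h2]
    · rw [ga_of_nonpos_out h h2, EE_zero (vv_out h2)]
      unfold ff0 al
      rw [if_pos (aa_nonneg _)]

def H1 (n : ℕ) (s : unitInterval) (t : ℝ) : ℝ × ℝ :=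
  EE n ((1 - (s : ℝ)) * ph n t + s * t)

theorem H1_continuous (n : ℕ) : Continuous (fun q : unitInterval × ℝ => H1 n q.1 q.2) := by
  have h1 := EE_continuous n
  have h2 := vv_continuous n
  have h3 := eta_continuous n
  unfold H1 ph
  fun_prop

theorem H1_far (n : ℕ) (s : unitInterval) (t : ℝ) (h : 1 ≤ |t|) : H1 n s t = 0 := by
  apply EE_zero
  have hs0 := s.2.1
  have hs1 := s.2.2
  rcases le_total 0 t with h0 | h0
  · rw [abs_of_nonneg h0] at h
    have : ph n t = 1 := by unfold ph; rw [min_eq_right h0, eta_zero, vv_ta]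
    rw [this]
    apply le_trans _ (le_abs_self _)
    nlinarith
  · have hp : ph n t ≤ -1 := by
      unfold ph; rw [min_eq_left h0, eta_far h]; exact vv_zero n
    rw [abs_of_nonpos h0] at h
    apply le_trans _ (neg_le_abs _)
    nlinarith

def H1s (s : unitInterval) (p : ℝ × ℝ) : ℝ × ℝ := ∑' n, H1 n s (TT n p)

theorem H1s_EE (s : unitInterval) (n : ℕ) (t : ℝ) : H1s s (EE n t) = H1 n s t :=
  HM_EE (fun n t => H1 n s t) (fun n t h => H1_far n s t h) n t

theorem H1s_mem (s : unitInterval) {p : ℝ × ℝ} (h : p ∈ hawaiianEarring) :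
    H1s s p ∈ hawaiianEarring := by
  obtain ⟨n, t, rfl⟩ := earring_cases h
  rw [H1s_EE]; exact EE_mem _ _

theorem H1s_continuous :
    Continuous (fun q : unitInterval × hawaiianEarring => H1s q.1 q.2.1) :=
  HM_continuous H1 H1_continuous H1_far 2 (fun _ _ _ => norm_EE _ _)

def homotopy1 : (ff.comp gg).Homotopy (ContinuousMap.id hawaiianEarring) where
  toFun q := ⟨H1s q.1 q.2.1, H1s_mem q.1 q.2.2⟩
  continuous_toFun := H1s_continuous.subtype_mk _
  map_zero_left := by
    rintro ⟨p, hp⟩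
    apply Subtype.ext
    obtain ⟨n, t, rfl⟩ := earring_cases hp
    change H1s 0 (EE n t) = ff0 (gg0 (EE n t))
    rw [H1s_EE, gg0_EE, ff_ga]
    simp [H1]
  map_one_left := by
    rintro ⟨p, hp⟩
    apply Subtype.ext
    obtain ⟨n, t, rfl⟩ := earring_cases hp
    change H1s 1 (EE n t) = EE n t
    rw [H1s_EE]
    simp [H1]

/-! ### Second homotopy -/

def cl (n : ℕ) (y : ℝ) : ℝ := max (be n) (min y (ta n))

theorem cl_continuous (n : ℕ) : Continuous (cl n) := by
  unfold cl; fun_prop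

theorem cl_in {n : ℕ} {y : ℝ} (h : y ∈ Set.Ioo (be n) (ta n)) : cl n y = y := by
  unfold cl; rw [min_eq_left h.2.le, max_eq_right h.1.le]

theorem cl_out {n : ℕ} {y : ℝ} (h : y ∉ Set.Ioo (be n) (ta n)) :
    cl n y = be n ∨ cl n y = ta n := by
  have hbt := be_lt_ta n
  unfold cl
  by_cases h1 : y ≤ be n
  · left; rw [min_eq_left (h1.trans hbt.le), max_eq_left h1]
  · right
    have h2 : ta n ≤ y := by
      by_contra h3
      exact h ⟨not_le.1 h1, not_le.1 h3⟩
    rw [min_eq_right h2, max_eq_right hbt.le]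

theorem cl_nonneg (n : ℕ) (y : ℝ) : 0 ≤ cl n y := (be_pos n).le.trans (le_max_left _ _)

theorem cl_le (n : ℕ) (y : ℝ) : cl n y ≤ ta n :=
  max_le (be_lt_ta n).le (min_le_right _ _)

def DD (n : ℕ) (q : unitInterval × ℝ) : ℝ × ℝ :=
  ga n ((1 - (q.1 : ℝ)) * vv n (cl n q.2) + q.1 * (cl n q.2 / ta n - 1)) -
    al (q.1 * cl n q.2)

theorem DD_continuous (n : ℕ) : Continuous (DD n) := by
  have h1 := ga_continuous n
  have h2 := vv_continuous n
  have h3 := cl_continuous n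
  have h4 := al_continuous
  unfold DD
  fun_prop

theorem DD_out {n : ℕ} {y : ℝ} (s : unitInterval) (h : y ∉ Set.Ioo (be n) (ta n)) :
    DD n (s, y) = 0 := by
  have hs0 := s.2.1
  have hs1 := s.2.2
  have ht := ta_pos n
  have hb := be_pos n
  have hbt := be_lt_ta n
  unfold DD
  simp only
  rw [sub_eq_zero]
  rcases cl_out h with h1 | h1
  · rw [h1, vv_be]
    set u := (1 - (s : ℝ)) * -1 + s * (be n / ta n - 1) with hu
    have hu' : u = -1 + s * (be n / ta n) := by rw [hu]; ring
    have hr0 : 0 ≤ be n / ta n := by positivity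
    have hr1 : be n / ta n ≤ 1 := (div_le_one ht).2 hbt.le
    have hu0 : u ≤ 0 := by rw [hu']; nlinarith
    have hu1 : -1 ≤ u := by rw [hu']; nlinarith
    have he : eta n u = s * be n := by
      rw [eta_eq (by rw [abs_of_nonpos hu0]; linarith), abs_of_nonpos hu0, hu']
      field_simp
      ring
    rw [ga_of_nonpos_out hu0, he]
    rw [he]
    intro h2
    nlinarith [h2.1]
  · rw [h1, vv_ta, div_self ht.ne']
    have hu : (1 - (s : ℝ)) * 1 + s * (1 - 1) = 1 - s := by ring
    rw [hu, ga_of_nonneg (by linarith), eta_eq, abs_of_nonneg (by linarith)]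
    · congr 1; ring
    · rw [abs_of_nonneg (by linarith)]; linarith

theorem norm_DD (n : ℕ) (q : unitInterval × ℝ) : ‖DD n q‖ ≤ 4 * ct n := by
  have hs0 := q.1.2.1
  have hs1 := q.1.2.2
  have h1 := cl_nonneg n q.2
  have h2 := cl_le n q.2
  have h4 : (q.1 : ℝ) * cl n q.2 ≤ ta n := by nlinarith
  have h3 : ‖al (q.1 * cl n q.2)‖ ≤ 2 * ct n :=
    (norm_XX (al_mem (mul_nonneg hs0 h1) (h4.trans (ta_le' n)))).trans (h4.trans (ta_le n))
  unfold DD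
  refine (norm_sub_le _ _).trans ?_
  have := norm_ga n ((1 - (q.1 : ℝ)) * vv n (cl n q.2) + q.1 * (cl n q.2 / ta n - 1))
  linarith

theorem DD_ne {n : ℕ} {q : unitInterval × ℝ} (h : DD n q ≠ 0) : q.2 ∈ Set.Ioo (be n) (ta n) := by
  by_contra h1
  exact h (DD_out q.1 h1)

def DS (q : unitInterval × ℝ) : ℝ × ℝ := ∑' n, DD n q

theorem DS_continuous : Continuous DS := by
  apply dsum_continuous DD DD_continuous _ (ct_mul_tendsto 4) norm_DD
  intro q m n hm hn
  exact interval_unique (DD_ne hm) (DD_ne hn)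

theorem DS_in {n : ℕ} {y : ℝ} (s : unitInterval) (h : y ∈ Set.Ioo (be n) (ta n)) :
    DS (s, y) = DD n (s, y) := by
  apply dsum_single DD (s, y) n
  intro m hm
  by_contra h1
  exact hm (interval_unique (DD_ne h1) h)

theorem DS_out {y : ℝ} (s : unitInterval) (h : aa y = 0) : DS (s, y) = 0 := by
  unfold DS
  convert tsum_zero with n
  apply DD_out
  intro h1
  exact (aa_pos h1).ne' h

def K2 (s : unitInterval) (q : ℝ × ℝ) : ℝ × ℝ :=
  if 0 ≤ q.1 then al (s * q.2) else al (s * q.2) + DS (s, q.2)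

theorem K2_continuous : Continuous (fun r : unitInterval × XX => K2 r.1 r.2.1) := by
  have h1 := al_continuous
  have h2 := DS_continuous
  unfold K2
  apply Continuous.if_le
  · fun_prop
  · fun_prop
  · fun_prop
  · fun_prop
  · rintro ⟨s, q, h0, h1, h2⟩ hx
    simp only at hx ⊢
    rw [← hx, abs_zero] at h2
    rw [DS_out s h2.symm, add_zero]

theorem XX_neg {q : ℝ × ℝ} (h : q ∈ XX) (h0 : ¬ 0 ≤ q.1) :
    ∃ n, q.2 ∈ Set.Ioo (be n) (ta n) := by
  apply aa_ne
  rw [← h.2.2]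
  exact (abs_pos.2 (by linarith)).ne'

theorem K2_neg (s : unitInterval) {q : ℝ × ℝ} (h0 : ¬ 0 ≤ q.1) {n : ℕ}
    (hn : q.2 ∈ Set.Ioo (be n) (ta n)) :
    K2 s q = ga n ((1 - (s : ℝ)) * vv n q.2 + s * (q.2 / ta n - 1)) := by
  unfold K2
  rw [if_neg h0, DS_in s hn]
  unfold DD
  simp only
  rw [cl_in hn]
  abel

theorem K2_mem (s : unitInterval) {q : ℝ × ℝ} (h : q ∈ XX) : K2 s q ∈ XX := by
  by_cases h0 : 0 ≤ q.1
  · unfold K2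
    rw [if_pos h0]
    have hs0 := s.2.1
    have hs1 := s.2.2
    have := h.1
    have := h.2.1
    apply al_mem
    · positivity
    · nlinarith
  · obtain ⟨n, hn⟩ := XX_neg h h0
    rw [K2_neg s h0 hn]
    exact ga_mem _ _

def homotopy2 : (gg.comp ff).Homotopy (ContinuousMap.id XX) where
  toFun r := ⟨K2 r.1 r.2.1, K2_mem r.1 r.2.2⟩
  continuous_toFun := K2_continuous.subtype_mk _
  map_zero_left := by
    rintro ⟨q, hq⟩
    apply Subtype.ext
    change K2 0 q = gg0 (ff0 q)
    by_cases h0 : 0 ≤ q.1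
    · unfold K2 ff0
      rw [if_pos h0, if_pos h0]
      have h1 : (0 : ℝ × ℝ) = EE 0 1 := (EE_zero (by simp)).symm
      rw [h1, gg0_EE, ga_far (by simp)]
      simp [al_zero]
    · obtain ⟨n, hn⟩ := XX_neg hq h0
      rw [K2_neg 0 h0 hn]
      unfold ff0
      rw [if_neg h0, FF_in hn, gg0_EE]
      simp
  map_one_left := by
    rintro ⟨q, hq⟩
    apply Subtype.ext
    change K2 1 q = q
    by_cases h0 : 0 ≤ q.1
    · unfold K2
      rw [if_pos h0]
      unfold al
      ext
      · simp [← hq.2.2, abs_of_nonneg h0]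
      · simp
    · obtain ⟨n, hn⟩ := XX_neg hq h0
      rw [K2_neg 1 h0 hn]
      have ht := ta_pos n
      have hb := be_pos n
      have h1 : (1 - ((1 : unitInterval) : ℝ)) * vv n q.2 + (1 : unitInterval) * (q.2 / ta n - 1)
          = q.2 / ta n - 1 := by simp
      rw [h1]
      have h2 : q.2 / ta n - 1 ≤ 0 := by
        have := (div_le_one ht).2 hn.2.le
        linarith
      have h3 : 0 ≤ q.2 / ta n := div_nonneg hq.1 ht.le
      have he : eta n (q.2 / ta n - 1) = q.2 := by
        rw [eta_eq (by rw [abs_of_nonpos h2]; linarith), abs_of_nonpos h2]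
        field_simp
        ring
      rw [ga_of_nonpos_in h2 (by rw [he]; exact hn), he, ← hq.2.2, abs_of_neg (not_le.1 h0)]
      simp

def equivXH : ContinuousMap.HomotopyEquiv XX hawaiianEarring where
  toFun := ff
  invFun := gg
  left_inv := ⟨homotopy2⟩
  right_inv := ⟨homotopy1⟩

/-! ### Retracting the truncated cones -/

def dd (n : ℕ) (y : ℝ) : ℝ := (y - ct n) * max 0 (min 1 (3 - 2 * |vv n y|))

theorem dd_continuous (n : ℕ) : Continuous (dd n) := by
  have := vv_continuous n
  unfold dd; fun_prop

theorem abs_sub_ct (n : ℕ) (y : ℝ) : |y - ct n| = |vv n y| * rd n := by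
  have h := rd_pos n
  unfold vv
  rw [abs_div, abs_of_pos h, div_mul_cancel₀ _ h.ne']

theorem dd_ne {n : ℕ} {y : ℝ} (h : dd n y ≠ 0) : |y - ct n| < 3 / 2 * rd n := by
  by_contra h1
  push Not at h1
  apply h
  rw [abs_sub_ct] at h1
  have h2 : 3 / 2 ≤ |vv n y| := le_of_mul_le_mul_right h1 (rd_pos n)
  unfold dd
  rw [max_eq_left]
  · simp
  · exact (min_le_right _ _).trans (by linarith)

theorem norm_dd (n : ℕ) (y : ℝ) : ‖dd n y‖ ≤ 1 * ct n := by
  by_cases h : dd n y = 0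
  · rw [h]; simp [(ct_pos n).le]
  · have h1 := dd_ne h
    have h2 := rd_le n
    have h3 := rd_pos n
    unfold dd
    rw [norm_mul, Real.norm_eq_abs, Real.norm_of_nonneg (le_max_left _ _)]
    have h4 : max 0 (min 1 (3 - 2 * |vv n y|)) ≤ 1 := max_le zero_le_one (min_le_left _ _)
    have h5 : 0 ≤ max 0 (min 1 (3 - 2 * |vv n y|)) := le_max_left _ _
    nlinarith [abs_nonneg (y - ct n)]

theorem dd_disj (y : ℝ) (m n : ℕ) (hm : dd m y ≠ 0) (hn : dd n y ≠ 0) : m = n := by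
  have h1 := abs_lt.1 (dd_ne hm)
  have h2 := abs_lt.1 (dd_ne hn)
  rcases lt_trichotomy m n with h | h | h
  · have := wide h; linarith [h1.1, h2.2]
  · exact h
  · have := wide h; linarith [h2.1, h1.2]

def dS (y : ℝ) : ℝ := ∑' n, dd n y

theorem dS_continuous : Continuous dS :=
  dsum_continuous dd dd_continuous _ (ct_mul_tendsto 1) norm_dd dd_disj

theorem dS_in {n : ℕ} {y : ℝ} (h : |y - ct n| ≤ rd n) : dS y = y - ct n := by
  have hr := rd_pos n
  have hv : |vv n y| ≤ 1 := by
    rw [abs_sub_ct] at h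
    by_contra h1
    push Not at h1
    nlinarith
  have h1 : dd n y = y - ct n := by
    unfold dd
    rw [min_eq_left (by linarith), max_eq_right zero_le_one, mul_one]
  rw [← h1]
  apply dsum_single dd y n
  intro m hm
  by_contra h2
  have h3 := abs_lt.1 (dd_ne h2)
  have h4 := abs_le.1 h
  rcases lt_or_gt_of_ne hm with h5 | h5
  · have := wide h5; linarith [h3.1, h4.2]
  · have := wide h5; linarith [h4.1, h3.2]

/-! ### Describing `U` -/

def InU (x y z : ℝ) : Prop :=
  (∃ n : ℕ, x ^ 2 + (y - ct n) ^ 2 = (rd n * (1 - z)) ^ 2) ∨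
    (z = 0 ∧ x = 0 ∧ ∃ n : ℕ, ta (n + 1) ≤ y ∧ y ≤ be n) ∨ (x = 0 ∧ y = 0 ∧ z = 0)

theorem seg_lo (n : ℕ) : ((3 * ((n + 1 : ℕ) : ℝ) + 7) / (3 * (((n + 1 : ℕ) : ℝ) + 1) *
    (((n + 1 : ℕ) : ℝ) + 2)) : ℝ) = ta (n + 1) := by
  unfold ta ct rd
  push_cast
  field_simp
  ring

theorem seg_hi (n : ℕ) : ((3 * ((n + 1 : ℕ) : ℝ) + 2) / (3 * ((n + 1 : ℕ) : ℝ) *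
    (((n + 1 : ℕ) : ℝ) + 1)) : ℝ) = be n := by
  unfold be ct rd
  push_cast
  field_simp
  ring

theorem ct_cast (n : ℕ) : (1 / ((n + 1 : ℕ) : ℝ)) = ct n := by
  unfold ct; push_cast; rfl

theorem rd_cast (n : ℕ) : (1 / (3 * ((n + 1 : ℕ) : ℝ) * (((n + 1 : ℕ) : ℝ) + 1))) = rd n := by
  unfold rd; push_cast; ring

theorem mem_cone (n : ℕ) (x y z : ℝ) (h0 : 0 ≤ z) (h1 : z < 2 / 3) :
    (x, y, z) ∈ cone (circleC (n + 1)) (0, 1 / ((n + 1 : ℕ) : ℝ), 1) ↔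
      x ^ 2 + (y - ct n) ^ 2 = (rd n * (1 - z)) ^ 2 := by
  unfold cone circleC
  simp only [Set.mem_ofPred_eq, ct_cast, rd_cast]
  constructor
  · rintro ⟨⟨a, b, c⟩, ⟨ha, hc⟩, t, ht, h⟩
    simp only [Prod.smul_mk, Prod.mk_add_mk, Prod.mk.injEq, smul_eq_mul] at h ha hc
    obtain ⟨rfl, rfl, rfl⟩ := h
    subst hc
    have : (1 - t) * 0 + t * 1 = t := by ring
    rw [this]
    linear_combination (1 - t) ^ 2 * ha
  · intro h
    have hz : 1 - z ≠ 0 := by intro h; linarith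
    refine ⟨(x / (1 - z), ct n + (y - ct n) / (1 - z), 0), ⟨?_, rfl⟩, z, ⟨h0, by linarith⟩, ?_⟩
    · simp only
      field_simp
      linear_combination h
    · simp only [Prod.smul_mk, Prod.mk_add_mk, Prod.mk.injEq, smul_eq_mul]
      refine ⟨?_, ?_, ?_⟩
      · field_simp; ring
      · field_simp; ring
      · ring

theorem mem_U (x y z : ℝ) : (x, y, z) ∈ subspaceU ↔ (0 ≤ z ∧ z < 2 / 3) ∧ InU x y z := by
  unfold subspaceU formalHarmonicArchipelago
  rw [Set.mem_inter_iff, and_comm]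
  apply and_congr_right
  intro hz
  have hz0 : 0 ≤ z := hz.1
  have hz1 : z < 2 / 3 := hz.2
  simp only [Set.mem_union, Set.mem_iUnion, exists_prop, Set.mem_singleton_iff, Prod.mk.injEq,
    Set.mem_ofPred_eq, Set.mem_Icc]
  unfold InU
  rw [or_assoc]
  apply or_congr
  · constructor
    · rintro ⟨n, hn, h⟩
      obtain ⟨k, rfl⟩ := Nat.exists_eq_add_of_le' hn
      exact ⟨k, (mem_cone k x y z hz0 hz1).1 h⟩
    · rintro ⟨n, h⟩
      exact ⟨n + 1, by omega, (mem_cone n x y z hz0 hz1).2 h⟩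
  · apply or_congr
    · constructor
      · rintro ⟨n, hn, hx, hy, hz⟩
        obtain ⟨k, rfl⟩ := Nat.exists_eq_add_of_le' hn
        rw [seg_lo, seg_hi] at hy
        exact ⟨hz, hx, k, hy⟩
      · rintro ⟨hz, hx, k, hy⟩
        refine ⟨k + 1, by omega, hx, ?_, hz⟩
        rw [seg_lo, seg_hi]
        exact hy
    · rfl

theorem InU_zero_iff (x y : ℝ) : InU x y 0 ↔ (x, y) ∈ XX := by
  constructor
  · rintro (⟨n, h⟩ | ⟨-, hx, n, h1, h2⟩ | ⟨hx, hy, -⟩)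
    · rw [sub_zero, mul_one] at h
      have hr := rd_pos n
      have hy : |y - ct n| ≤ rd n := by
        apply abs_le_of_sq_le_sq _ hr.le
        nlinarith [sq_nonneg x]
      have hy' := abs_le.1 hy
      have h1 := be_pos n
      have h2 := ta_le' n
      unfold be at h1
      unfold ta at h2
      refine ⟨by simp only; linarith, by simp only; linarith, ?_⟩
      simp only
      have hx : |x| = an n y := by
        unfold an
        rw [← Real.sqrt_sq_eq_abs]
        congr 1
        linarith
      rw [hx]
      by_cases hi : y ∈ Set.Ioo (be n) (ta n)
      · rw [aa_eq hi]
      · rw [an_eq_zero hi, aa_eq_zero]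
        intro m hm
        have hmn : m ≠ n := by rintro rfl; exact hi hm
        rcases lt_or_gt_of_ne hmn with h5 | h5
        · have h6 := ta_lt_be h5
          have := hm.1
          unfold ta at h6
          linarith
        · have h6 := ta_lt_be h5
          have := hm.2
          unfold be at h6
          linarith
    · subst hx
      refine ⟨(ta_pos _).le.trans h1, ?_, ?_⟩
      · exact h2.trans ((be_lt_ta n).le.trans (ta_le' n))
      · simp only [abs_zero]
        rw [aa_eq_zero]
        intro m hm
        rcases le_or_gt m n with h5 | h5
        · rcases h5.lt_or_eq with h6 | h6
          · have := ta_lt_be h6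
            have := be_lt_ta n
            linarith [hm.1]
          · subst h6; linarith [hm.1]
        · have h7 : ta m ≤ ta (n + 1) := by
            unfold ta
            exact add_le_add (ct_anti h5) (rd_anti h5)
          linarith [hm.2]
    · subst hx hy
      exact ⟨le_refl _, by norm_num, by simp [aa_zero]⟩
  · rintro ⟨h0, h1, h2⟩
    simp only at h0 h1 h2
    rcases h0.eq_or_lt with h3 | h3
    · right; right
      subst h3
      rw [aa_zero, abs_eq_zero] at h2
      exact ⟨h2, rfl, rfl⟩
    · by_cases h4 : aa y = 0
      · rw [h4, abs_eq_zero] at h2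
        subst h2
        have hex : ∃ n, ta (n + 1) ≤ y := by
          have h5 := (ct_mul_tendsto 2).eventually (gt_mem_nhds h3)
          obtain ⟨N, hN⟩ := eventually_atTop.1 h5
          exact ⟨N, (ta_le _).trans (hN (N + 1) (by omega)).le⟩
        classical
        have hs := Nat.find_spec hex
        have hm : ∀ m, m < Nat.find hex → ¬ (ta (m + 1) ≤ y) := fun m hm => Nat.find_min hex hm
        set n := Nat.find hex
        have hle : y ≤ ta n := by
          rcases Nat.eq_zero_or_pos n with h6 | h6
          · rw [h6, ta_zero]; exact h1
          · have := hm (n - 1) (by omega)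
            rw [Nat.sub_add_cancel h6] at this
            exact (not_le.1 this).le
        by_cases h7 : y ≤ be n
        · right; left
          exact ⟨rfl, rfl, n, hs, h7⟩
        · left
          have h8 : y = ta n := by
            rcases hle.eq_or_lt with h9 | h9
            · exact h9
            · exact absurd h4 (aa_pos ⟨not_le.1 h7, h9⟩).ne'
          refine ⟨n, ?_⟩
          rw [h8]
          unfold ta
          ring
      · left
        obtain ⟨n, hn⟩ := aa_ne h4
        refine ⟨n, ?_⟩
        have h5 : x ^ 2 = an n y ^ 2 := by rw [← sq_abs, h2, aa_eq hn]
        have h6 : an n y ^ 2 = rd n ^ 2 - (y - ct n) ^ 2 := by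
          unfold an
          have := (an_pos_iff n y).2 hn
          unfold an at this
          exact Real.sq_sqrt (Real.sqrt_pos.1 this).le
        rw [h5, h6]
        ring

/-! ### The deformation of `U` -/

def RR (s : ℝ) (p : ℝ × ℝ × ℝ) : ℝ × ℝ × ℝ :=
  (p.1 * ((1 - s * p.2.2) / (1 - p.2.2)),
    p.2.1 + p.2.2 * (1 - s) / (1 - p.2.2) * dS p.2.1, s * p.2.2)

theorem RR_mem {s : ℝ} (h0 : 0 ≤ s) (h1 : s ≤ 1) {p : ℝ × ℝ × ℝ} (hp : p ∈ subspaceU) :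
    RR s p ∈ subspaceU := by
  obtain ⟨x, y, z⟩ := p
  rw [mem_U] at hp
  obtain ⟨⟨hz0, hz1⟩, h⟩ := hp
  unfold RR
  rw [mem_U]
  simp only
  refine ⟨⟨by positivity, by nlinarith⟩, ?_⟩
  rcases h with ⟨n, h⟩ | ⟨hz, hx, n, hy⟩ | ⟨hx, hy, hz⟩
  · left
    refine ⟨n, ?_⟩
    have hr := rd_pos n
    have hd : |y - ct n| ≤ rd n := by
      apply abs_le_of_sq_le_sq _ hr.le
      have : (rd n * (1 - z)) ^ 2 ≤ rd n ^ 2 := by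
        apply pow_le_pow_left₀
        · exact mul_nonneg hr.le (by linarith)
        · nlinarith
      nlinarith [sq_nonneg x]
    rw [dS_in hd]
    have hz : 1 - z ≠ 0 := by intro h; linarith
    have e : y + z * (1 - s) / (1 - z) * (y - ct n) - ct n
        = (y - ct n) * ((1 - s * z) / (1 - z)) := by
      field_simp
      ring
    rw [e]
    have e2 : rd n * (1 - s * z) = rd n * (1 - z) * ((1 - s * z) / (1 - z)) := by
      field_simp
    rw [e2]
    linear_combination ((1 - s * z) / (1 - z)) ^ 2 * h
  · right; left
    subst hz hx
    refine ⟨by ring, by ring, n, ?_⟩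
    simpa using hy
  · right; right
    subst hz hx hy
    simp

theorem RR_one {p : ℝ × ℝ × ℝ} (hp : p ∈ subspaceU) : RR 1 p = p := by
  obtain ⟨x, y, z⟩ := p
  rw [mem_U] at hp
  have hz : 1 - z ≠ 0 := by intro h; linarith [hp.1.2]
  unfold RR
  simp [hz]

theorem RR_continuous :
    Continuous (fun q : unitInterval × subspaceU => RR (q.1 : ℝ) q.2.1) := by
  have h := dS_continuous
  have hz : ∀ q : unitInterval × subspaceU, 1 - q.2.1.2.2 ≠ 0 := by
    rintro ⟨s, ⟨⟨x, y, z⟩, hp⟩⟩ h1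
    simp only at h1
    have := ((mem_U x y z).1 hp).1.2
    linarith
  unfold RR
  have c1 : Continuous (fun q : unitInterval × subspaceU =>
      (1 - (q.1 : ℝ) * q.2.1.2.2) / (1 - q.2.1.2.2)) := by
    apply Continuous.div (by fun_prop) (by fun_prop) hz
  have c2 : Continuous (fun q : unitInterval × subspaceU =>
      q.2.1.2.2 * (1 - (q.1 : ℝ)) / (1 - q.2.1.2.2)) := by
    apply Continuous.div (by fun_prop) (by fun_prop) hz
  fun_prop

theorem RR_zero_XX {p : ℝ × ℝ × ℝ} (hp : p ∈ subspaceU) :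
    ((RR 0 p).1, (RR 0 p).2.1) ∈ XX := by
  have h := RR_mem le_rfl zero_le_one hp
  have h2 : RR 0 p = ((RR 0 p).1, (RR 0 p).2.1, 0) := by
    unfold RR; simp
  rw [h2, mem_U] at h
  exact (InU_zero_iff _ _).1 h.2

def rr : C(subspaceU, XX) :=
  ⟨fun p => ⟨((RR 0 p.1).1, (RR 0 p.1).2.1), RR_zero_XX p.2⟩, by
    have h : Continuous (fun p : subspaceU => RR 0 p.1) :=
      RR_continuous.comp (continuous_const.prodMk continuous_id :
        Continuous fun p : subspaceU => ((0 : unitInterval), p))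
    exact (h.fst.prodMk h.snd.fst).subtype_mk _⟩

def jj : C(XX, subspaceU) :=
  ⟨fun q => ⟨(q.1.1, q.1.2, 0), (mem_U _ _ _).2
    ⟨⟨le_rfl, by norm_num⟩, (InU_zero_iff _ _).2 q.2⟩⟩, by
    apply Continuous.subtype_mk
    fun_prop⟩

def homotopy3 : (jj.comp rr).Homotopy (ContinuousMap.id subspaceU) where
  toFun q := ⟨RR q.1 q.2.1, RR_mem q.1.2.1 q.1.2.2 q.2.2⟩
  continuous_toFun := RR_continuous.subtype_mk _
  map_zero_left := by
    rintro ⟨p, hp⟩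
    apply Subtype.ext
    change RR ((0 : unitInterval) : ℝ) p = ((RR 0 p).1, (RR 0 p).2.1, 0)
    unfold RR; simp
  map_one_left := by
    rintro ⟨p, hp⟩
    apply Subtype.ext
    change RR ((1 : unitInterval) : ℝ) p = p
    exact RR_one hp

theorem rr_jj : rr.comp jj = ContinuousMap.id XX := by
  ext q
  · change (RR 0 (q.1.1, q.1.2, 0)).1 = q.1.1
    unfold RR; simp
  · change (RR 0 (q.1.1, q.1.2, 0)).2.1 = q.1.2
    unfold RR; simp

def equivUX : ContinuousMap.HomotopyEquiv subspaceU XX where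
  toFun := rr
  invFun := jj
  left_inv := ⟨homotopy3⟩
  right_inv := by rw [rr_jj]

end HAproof

end

/-- The subspace `U` of the Formal Harmonic archipelago is homotopy equivalent
to the Hawaiian earring. -/
theorem subspaceU_homotopyEquiv_hawaiianEarring :
    Nonempty (ContinuousMap.HomotopyEquiv subspaceU hawaiianEarring) := by
  exact ⟨HAproof.equivUX.trans HAproof.equivXH⟩
end

section
/- The fundamental group of the Griffiths space 𝒢 based at the origin (0,0,0) is nontrivial, even though 𝒢 is the one-point union of two contractible spaces (two cones). -/
lemma origin_mem_griffithsSpace : ((0, 0, 0) : ℝ × ℝ × ℝ) ∈ griffithsSpace := by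
  left
  refine ⟨(0, 0, 0), ?_, 0, by norm_num, ?_⟩
  · refine Set.mem_iUnion₂.2 ⟨1, le_refl 1, ?_⟩
    norm_num
  · simp [Prod.ext_iff]


/-- A Heisenberg type monoid -/
@[ext] structure Heis (n : ℕ) where
  al : Fin n → ℚ
  be : Fin n → ℚ
  Z : Matrix (Fin n) (Fin n) ℚ

namespace Heis
variable {n : ℕ}

instance : Mul (Heis n) := ⟨fun g h => ⟨g.al + h.al, g.be + h.be, g.Z + h.Z + Matrix.vecMulVec g.al h.be⟩⟩
instance : One (Heis n) := ⟨⟨0, 0, 0⟩⟩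

@[simp] lemma mul_al (g h : Heis n) : (g * h).al = g.al + h.al := rfl
@[simp] lemma mul_be (g h : Heis n) : (g * h).be = g.be + h.be := rfl
@[simp] lemma mul_Z (g h : Heis n) : (g * h).Z = g.Z + h.Z + Matrix.vecMulVec g.al h.be := rfl
@[simp] lemma one_al : (1 : Heis n).al = 0 := rfl
@[simp] lemma one_be : (1 : Heis n).be = 0 := rfl
@[simp] lemma one_Z : (1 : Heis n).Z = 0 := rfl

instance : Monoid (Heis n) where
  mul_assoc a b c := by
    ext i <;> simp [Matrix.vecMulVec_apply] <;> ring
  one_mul a := by ext i <;> simp [Matrix.vecMulVec_apply]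
  mul_one a := by ext i <;> simp [Matrix.vecMulVec_apply]

lemma rank_add_le' (A B : Matrix (Fin n) (Fin n) ℚ) : (A + B).rank ≤ A.rank + B.rank := by
  unfold Matrix.rank
  rw [Matrix.mulVecLin_add]
  refine le_trans (Submodule.finrank_mono (LinearMap.range_add_le _ _)) ?_
  exact Submodule.finrank_add_le_finrank_add_finrank _ _

def near (r : ℕ) (g h : Heis n) : Prop :=
  ∀ u w : Heis n, ((u * g * w).Z - (u * h * w).Z).rank ≤ r

lemma near_refl (g : Heis n) : near 0 g g := by
  intro u w; simp

lemma near.trans {r s : ℕ} {g h k : Heis n} (h1 : near r g h) (h2 : near s h k) :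
    near (r + s) g k := by
  intro u w
  have : (u * g * w).Z - (u * k * w).Z =
    ((u * g * w).Z - (u * h * w).Z) + ((u * h * w).Z - (u * k * w).Z) := by abel
  rw [this]
  exact (rank_add_le' _ _).trans (add_le_add (h1 u w) (h2 u w))

lemma near.mul {r : ℕ} {g h : Heis n} (a b : Heis n) (h1 : near r g h) :
    near r (a * g * b) (a * h * b) := by
  intro u w
  have := h1 (u * a) (b * w)
  simpa only [mul_assoc] using this

lemma near_of_be {x y : Heis n} (hx : x.be = 0) (hx' : x.Z = 0) (hy : y.be = 0) (hy' : y.Z = 0) :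
    near 1 x y := by
  intro u w
  have : (u * x * w).Z - (u * y * w).Z = Matrix.vecMulVec (x.al - y.al) w.be := by
    ext i j
    simp [Matrix.vecMulVec_apply, hx, hx', hy, hy']
    ring
  rw [this]
  exact Matrix.rank_vecMulVec_le _ _

lemma near_of_al {x y : Heis n} (hx : x.al = 0) (hx' : x.Z = 0) (hy : y.al = 0) (hy' : y.Z = 0) :
    near 1 x y := by
  intro u w
  have : (u * x * w).Z - (u * y * w).Z = Matrix.vecMulVec u.al (x.be - y.be) := by
    ext i j
    simp [Matrix.vecMulVec_apply, hx, hx', hy, hy']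
    ring
  rw [this]
  exact Matrix.rank_vecMulVec_le _ _

lemma near.mono {r s : ℕ} {g h : Heis n} (h1 : near r g h) (hrs : r ≤ s) : near s g h :=
  fun u w => (h1 u w).trans hrs

/-- ordered product of the first `n` terms -/
def pr {M : Type*} [Monoid M] (f : ℕ → M) : ℕ → M
  | 0 => 1
  | k + 1 => pr f k * f k

lemma pr_add {M : Type*} [Monoid M] (f : ℕ → M) (a b : ℕ) :
    pr f (a + b) = pr f a * pr (fun j => f (a + j)) b := by
  induction b with
  | zero => simp [pr]
  | succ b ih => rw [← add_assoc, pr, ih, pr, mul_assoc]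

lemma pr_mul {M : Type*} [Monoid M] (f : ℕ → M) (a b : ℕ) :
    pr f (a * b) = pr (fun J => pr (fun j => f (J * b + j)) b) a := by
  induction a with
  | zero => simp [pr]
  | succ a ih => rw [add_mul, one_mul, pr_add, ih, pr]

lemma pr_one {M : Type*} [Monoid M] (f : ℕ → M) (a : ℕ) (h : ∀ i < a, f i = 1) :
    pr f a = 1 := by
  induction a with
  | zero => rfl
  | succ a ih => rw [pr, ih (fun i hi => h i (by omega)), h a (by omega), one_mul]

lemma pr_prop {M : Type*} [Monoid M] (P : M → Prop) (h1 : P 1) (hm : ∀ x y, P x → P y → P (x * y))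
    (f : ℕ → M) (a : ℕ) (h : ∀ i < a, P (f i)) : P (pr f a) := by
  induction a with
  | zero => exact h1
  | succ a ih => exact hm _ _ (ih (fun i hi => h i (by omega))) (h a (by omega))

lemma row {C : ℕ} (h h' v : ℕ → Heis n) (m : ℕ)
    (H : ∀ j < m, near C (h j * v (j + 1)) (v j * h' j)) :
    near (C * m) (pr h m * v m) (v 0 * pr h' m) := by
  induction m with
  | zero => simpa [pr] using near_refl _
  | succ m ih =>
    have h1 := (H m (by omega)).mul (pr h m) 1
    have h2 := (ih (fun j hj => H j (by omega))).mul 1 (h' m)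
    have h3 := h1.trans (h := pr h m * (v m * h' m) * 1) (k := 1 * (v 0 * pr h' m) * h' m) (s := C * m) (by
      simpa only [mul_assoc, one_mul, mul_one] using h2)
    simp only [pr]
    have e : C + C * m = C * (m + 1) := by ring
    rw [e] at h3
    simpa only [mul_assoc, one_mul, mul_one] using h3

lemma grid {C : ℕ} (h v : ℕ → ℕ → Heis n) (m k : ℕ)
    (H : ∀ i < k, ∀ j < m, near C (h i j * v i (j + 1)) (v i j * h (i + 1) j)) :
    near (C * m * k) (pr (h 0) m * pr (fun i => v i m) k) (pr (fun i => v i 0) k * pr (h k) m) := by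
  induction k with
  | zero => simpa [pr] using near_refl _
  | succ k ih =>
    have h1 := (row (h k) (h (k + 1)) (v k) m (H k (by omega))).mul (pr (fun i => v i 0) k) 1
    have h2 := (ih (fun i hi => H i (by omega))).mul 1 (v k m)
    have h3 := h2.trans (k := pr (fun i => v i 0) k * (v k 0 * pr (h (k+1)) m) * 1) (s := C * m) (by
      simpa only [mul_assoc, one_mul, mul_one] using h1)
    simp only [pr]
    have e : C * m * k + C * m = C * m * (k + 1) := by ring
    rw [e] at h3
    simpa only [mul_assoc, one_mul, mul_one] using h3

/-- generators -/
noncomputable def X (n : ℕ) (k : ℝ) (e : ℚ) : Heis n :=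
  if 0 < k then ⟨fun a => if (a : ℝ) + 1 = k then e else 0, 0, 0⟩
  else ⟨0, fun a => if (a : ℝ) + 1 = -k then e else 0, 0⟩

lemma X_zero (k : ℝ) : X n k 0 = 1 := by
  unfold X; split_ifs <;> ext <;> simp

lemma X_add (k : ℝ) (e f : ℚ) : X n k e * X n k f = X n k (e + f) := by
  unfold X
  split_ifs
  · ext i
    · simp; split_ifs <;> simp
    · simp
    · simp [Matrix.vecMulVec_apply]
  · ext i
    · simp
    · simp; split_ifs <;> simp
    · simp [Matrix.vecMulVec_apply]

lemma X_big (k : ℝ) (e : ℚ) (h : (n : ℝ) < |k|) : X n k e = 1 := by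
  unfold X
  have : ∀ a : Fin n, (a : ℝ) + 1 ≤ n := fun a => by exact_mod_cast a.2
  split_ifs with h0
  · rw [abs_of_pos h0] at h
    ext i
    · have := this i
      simp; intro h; linarith
    · simp
    · simp
  · rw [abs_of_nonpos (by linarith)] at h
    ext i
    · simp
    · have := this i
      simp; intro h; linarith
    · simp

lemma X_be {k : ℝ} (e : ℚ) (h : 0 ≤ k) : (X n k e).be = 0 := by
  unfold X; split_ifs with h0
  · rfl
  · have : k = 0 := by linarith
    subst this
    ext i
    simp; intro h
    have : (0:ℝ) ≤ (i:ℕ) := by positivity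
    linarith
lemma X_al {k : ℝ} (e : ℚ) (h : k ≤ 0) : (X n k e).al = 0 := by
  unfold X; rw [if_neg (by linarith)]
lemma X_Z (k : ℝ) (e : ℚ) : (X n k e).Z = 0 := by
  unfold X; split_ifs <;> rfl

/-- circle order -/
def kk (c : ℕ) : ℤ := if c % 2 = 0 then (c / 2 : ℕ) + 1 else -((c / 2 : ℕ) + 1)

lemma Q_even (i : ℕ) : pr (fun c => X n (kk c) 1) (2 * i) =
    ⟨fun a => if (a : ℕ) < i then 1 else 0, fun a => if (a : ℕ) < i then 1 else 0,
      Matrix.of fun a b => if (a : ℕ) ≤ b ∧ (b : ℕ) < i then 1 else 0⟩ := by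
  induction i with
  | zero => ext <;> simp [pr]
  | succ i ih =>
    have e1 : kk (2 * i) = i + 1 := by unfold kk; rw [if_pos (by omega)]; congr 1; congr 1; omega
    have e2 : kk (2 * i + 1) = - (i + 1) := by
      unfold kk; rw [if_neg (by omega)]; congr 3; omega
    have x1 : X n ((kk (2*i) : ℤ) : ℝ) 1 = ⟨fun a => if (a : ℕ) = i then 1 else 0, 0, 0⟩ := by
      rw [e1]; unfold X; rw [if_pos (by push_cast; positivity)]
      simp
    have x2 : X n ((kk (2*i+1) : ℤ) : ℝ) 1 = ⟨0, fun a => if (a : ℕ) = i then 1 else 0, 0⟩ := by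
      rw [e2]; unfold X; rw [if_neg (by push_cast; linarith [(Nat.cast_nonneg i : (0:ℝ) ≤ i)])]
      simp
    rw [show 2 * (i + 1) = 2 * i + 1 + 1 by ring, pr, pr, ih]
    beta_reduce
    rw [x1, x2]
    ext a b
    · simp; split_ifs <;> first | omega | simp
    · simp; split_ifs <;> first | omega | simp
    · simp [Matrix.vecMulVec_apply]; split_ifs <;> first | omega | simp

lemma Q_rank : (pr (fun c => X n (kk c) 1) (2 * n)).Z.rank = n := by
  rw [Q_even]
  have : Matrix.det (Matrix.of fun a b : Fin n => if (a : ℕ) ≤ b ∧ (b : ℕ) < n then (1:ℚ) else 0) = 1 := by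
    rw [Matrix.det_of_isUpperTriangular]
    · simp
    · intro a b h
      have : (b:ℕ) < a := h
      simp; omega
  have := Matrix.rank_of_isUnit (Matrix.of fun a b : Fin n => if (a : ℕ) ≤ b ∧ (b : ℕ) < n then (1:ℚ) else 0) ((Matrix.isUnit_iff_isUnit_det _).2 (by rw [this]; exact isUnit_one))
  simpa using this

end Heis

open Heis

noncomputable def kap (p : ℝ × ℝ × ℝ) : ℝ := 2 * p.2.1 * (1 - |p.2.2|) / (p.1 ^ 2 + p.2.1 ^ 2)

noncomputable def ss (p : ℝ × ℝ × ℝ) : ℚ := if 0 ≤ p.1 then 1 else 0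

open Classical in
noncomputable def EE (n : ℕ) (p q : ℝ × ℝ × ℝ) : Heis n :=
  if |p.1| < |p.2.1| ∧ |q.1| < |q.2.1| ∧ kap p = kap q then X n (kap p) (ss q - ss p) else 1

lemma mem_plus {p : ℝ × ℝ × ℝ} (hp : p ∈ cone hawaiianPlus (0, 0, 1)) :
    0 ≤ p.2.2 ∧ 0 ≤ p.2.1 ∧ p.2.2 ≤ 1 ∧
      ∃ k : ℕ, 1 ≤ k ∧ (k : ℝ) * (p.1 ^ 2 + p.2.1 ^ 2) = 2 * p.2.1 * (1 - p.2.2) := by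
  obtain ⟨a, ha, t, ⟨ht0, ht1⟩, rfl⟩ := hp
  simp only [hawaiianPlus, Set.mem_iUnion] at ha
  obtain ⟨k, hk, h1, h2⟩ := ha
  have hk' : (0 : ℝ) < k := by exact_mod_cast hk
  have h3 : (k : ℝ) * (a.1 ^ 2 + a.2.1 ^ 2) = 2 * a.2.1 := by
    field_simp at h1
    have : (k : ℝ) * (k * (a.1 ^ 2 + a.2.1 ^ 2)) = k * (2 * a.2.1) := by nlinarith
    exact mul_left_cancel₀ hk'.ne' this
  have h4 : 0 ≤ a.2.1 := by
    have : 0 ≤ (k : ℝ) * (a.1 ^ 2 + a.2.1 ^ 2) := by positivity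
    linarith
  simp only [Prod.fst_add, Prod.snd_add, Prod.smul_fst, Prod.smul_snd, smul_eq_mul, h2]
  refine ⟨by linarith, by nlinarith, by linarith, k, hk, ?_⟩
  linear_combination (1 - t) ^ 2 * h3

lemma mem_minus {p : ℝ × ℝ × ℝ} (hp : p ∈ cone hawaiianMinus (0, 0, -1)) :
    p.2.2 ≤ 0 ∧ p.2.1 ≤ 0 ∧ -1 ≤ p.2.2 ∧
      ∃ k : ℕ, 1 ≤ k ∧ (k : ℝ) * (p.1 ^ 2 + p.2.1 ^ 2) = -(2 * p.2.1 * (1 + p.2.2)) := by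
  obtain ⟨a, ha, t, ⟨ht0, ht1⟩, rfl⟩ := hp
  simp only [hawaiianMinus, Set.mem_iUnion] at ha
  obtain ⟨k, hk, h1, h2⟩ := ha
  have hk' : (0 : ℝ) < k := by exact_mod_cast hk
  have h3 : (k : ℝ) * (a.1 ^ 2 + a.2.1 ^ 2) = -(2 * a.2.1) := by
    field_simp at h1
    have : (k : ℝ) * (k * (a.1 ^ 2 + a.2.1 ^ 2)) = k * (-(2 * a.2.1)) := by nlinarith
    exact mul_left_cancel₀ hk'.ne' this
  have h4 : a.2.1 ≤ 0 := by
    have : 0 ≤ (k : ℝ) * (a.1 ^ 2 + a.2.1 ^ 2) := by positivity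
    linarith
  simp only [Prod.fst_add, Prod.snd_add, Prod.smul_fst, Prod.smul_snd, smul_eq_mul, h2]
  refine ⟨by linarith, by nlinarith, by linarith, k, hk, ?_⟩
  linear_combination (1 - t) ^ 2 * h3

lemma kap_int {p : ℝ × ℝ × ℝ} (hp : p ∈ griffithsSpace) (hy : p.2.1 ≠ 0) :
    ∃ k : ℤ, kap p = k := by
  have hpos : 0 < p.1 ^ 2 + p.2.1 ^ 2 := by positivity
  rcases hp with hp | hp
  · obtain ⟨hz, _, _, k, hk, h⟩ := mem_plus hp
    refine ⟨k, ?_⟩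
    unfold kap
    rw [abs_of_nonneg hz, div_eq_iff hpos.ne', ← h]; simp
  · obtain ⟨hz, _, _, k, hk, h⟩ := mem_minus hp
    refine ⟨-k, ?_⟩
    unfold kap
    rw [abs_of_nonpos hz, div_eq_iff hpos.ne']; push_cast; linarith

lemma kap_nonneg {p : ℝ × ℝ × ℝ} (hp : p ∈ griffithsSpace) (hz : 0 < p.2.2) : 0 ≤ kap p := by
  rcases hp with hp | hp
  · obtain ⟨h1, h2, h3, -⟩ := mem_plus hp
    unfold kap
    rw [abs_of_nonneg h1]
    have : 0 ≤ 1 - p.2.2 := by linarith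
    positivity
  · have := (mem_minus hp).1
    linarith

lemma kap_nonpos {p : ℝ × ℝ × ℝ} (hp : p ∈ griffithsSpace) (hz : p.2.2 < 0) : kap p ≤ 0 := by
  rcases hp with hp | hp
  · have := (mem_plus hp).1
    linarith
  · obtain ⟨h1, h2, h3, -⟩ := mem_minus hp
    unfold kap
    rw [abs_of_nonpos h1]
    apply div_nonpos_of_nonpos_of_nonneg
    · nlinarith
    · positivity

lemma EE_pos {n : ℕ} {p q : ℝ × ℝ × ℝ} (hp : p ∈ griffithsSpace) (hz : 0 < p.2.2) :
    (EE n p q).be = 0 ∧ (EE n p q).Z = 0 := by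
  unfold EE
  split_ifs
  · exact ⟨X_be _ (kap_nonneg hp hz), X_Z _ _⟩
  · exact ⟨rfl, rfl⟩

lemma EE_neg {n : ℕ} {p q : ℝ × ℝ × ℝ} (hp : p ∈ griffithsSpace) (hz : p.2.2 < 0) :
    (EE n p q).al = 0 ∧ (EE n p q).Z = 0 := by
  unfold EE
  split_ifs
  · exact ⟨X_al _ (kap_nonpos hp hz), X_Z _ _⟩
  · exact ⟨rfl, rfl⟩

lemma EE_of_ss {n : ℕ} {p q : ℝ × ℝ × ℝ} (h : ss p = ss q) : EE n p q = 1 := by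
  unfold EE
  rw [h, sub_self, X_zero, ite_self]

lemma EE_small {n : ℕ} (hn : 1 ≤ n) {p q : ℝ × ℝ × ℝ} (hz : |p.2.2| ≤ 3 / 4)
    (hy : |p.2.1| < 1 / (4 * n)) : EE n p q = 1 := by
  unfold EE
  split_ifs with h
  · apply X_big
    obtain ⟨h1, -, -⟩ := h
    have hn' : (1 : ℝ) ≤ n := by exact_mod_cast hn
    have hy0 : 0 < |p.2.1| := lt_of_le_of_lt (abs_nonneg _) h1
    have hpos : 0 < p.1 ^ 2 + p.2.1 ^ 2 := by
      have : p.2.1 ≠ 0 := abs_pos.1 hy0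
      positivity
    have hx : p.1 ^ 2 < p.2.1 ^ 2 := sq_lt_sq.2 h1
    unfold kap
    rw [abs_div, abs_of_pos hpos, lt_div_iff₀ hpos, abs_mul, abs_mul, abs_two,
      abs_of_nonneg (by linarith : 0 ≤ 1 - |p.2.2|)]
    rw [lt_div_iff₀ (by positivity)] at hy
    have h5 : |p.2.1| ^ 2 = p.2.1 ^ 2 := sq_abs _
    have h6 : (n : ℝ) * (p.1 ^ 2 + p.2.1 ^ 2) < n * (2 * |p.2.1| ^ 2) := by
      apply mul_lt_mul_of_pos_left <;> linarith
    have h7 : n * (2 * |p.2.1| ^ 2) < |p.2.1| / 2 := by nlinarith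
    nlinarith
  · rfl

lemma good (n : ℕ) (hn : 1 ≤ n) (p : griffithsSpace) : ∃ O : Set griffithsSpace, IsOpen O ∧ p ∈ O ∧
    ∀ a ∈ O, ∀ b ∈ O, ∀ c ∈ O, |a.1.2.2| ≤ 3 / 4 → |b.1.2.2| ≤ 3 / 4 →
      EE n a b * EE n b c = EE n a c := by
  have cx : Continuous fun q : griffithsSpace => q.1.1 := by fun_prop
  have cy : Continuous fun q : griffithsSpace => q.1.2.1 := by fun_prop
  rcases lt_trichotomy p.1.1 0 with hx | hx | hx
  · refine ⟨{q | q.1.1 < 0}, isOpen_lt cx continuous_const, hx, ?_⟩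
    intro a ha b hb c hc _ _
    have : ∀ q : griffithsSpace, q.1.1 < 0 → ss q = 0 := fun q hq => by
      unfold ss; rw [if_neg (by linarith)]
    rw [EE_of_ss, EE_of_ss, EE_of_ss, one_mul] <;> rw [this _ ‹_›, this _ ‹_›]
  · by_cases hy : p.1.2.1 = 0
    · refine ⟨{q | |q.1.2.1| < 1 / (4 * n)}, isOpen_lt (by fun_prop) continuous_const, ?_, ?_⟩
      · simp only [Set.mem_setOf_eq, hy, abs_zero]
        positivity
      · intro a ha b hb c hc h1 h2
        rw [EE_small hn h1 ha, EE_small hn h2 hb, EE_small hn h1 ha, one_mul]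
    · set U : Set griffithsSpace := {q | |q.1.1| < |q.1.2.1|} with hU
      have hUo : IsOpen U := isOpen_lt (by fun_prop) (by fun_prop)
      have hyU : ∀ q ∈ U, q.1.2.1 ≠ 0 := fun q hq => by
        have : |q.1.1| < |q.1.2.1| := hq
        exact abs_pos.1 (lt_of_le_of_lt (abs_nonneg _) this)
      have hc : ContinuousOn (fun q : griffithsSpace => kap q.1) U := by
        unfold kap
        apply ContinuousOn.div
        · fun_prop
        · fun_prop
        · intro q hq
          have := hyU q hq
          positivity
      refine ⟨U ∩ (fun q : griffithsSpace => kap q.1) ⁻¹' Metric.ball (kap p) 1,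
        hc.isOpen_inter_preimage hUo Metric.isOpen_ball, ⟨?_, ?_⟩, ?_⟩
      · simp only [hU, Set.mem_setOf_eq, hx, abs_zero]
        exact abs_pos.2 hy
      · simp
      · obtain ⟨k, hk⟩ := kap_int p.2 hy
        have key : ∀ q ∈ U ∩ (fun q : griffithsSpace => kap q.1) ⁻¹' Metric.ball (kap p) 1,
            kap q = kap p := by
          rintro q ⟨h1, h2⟩
          obtain ⟨l, hl⟩ := kap_int q.2 (hyU q h1)
          simp only [Set.mem_preimage, Metric.mem_ball, Real.dist_eq, hk, hl] at h2 ⊢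
          have : |l - k| < 1 := by exact_mod_cast h2
          have := Int.abs_lt_one_iff.1 this
          rw [sub_eq_zero.1 this]
        have key2 : ∀ q ∈ U ∩ (fun q : griffithsSpace => kap q.1) ⁻¹' Metric.ball (kap p) 1,
          ∀ r ∈ U ∩ (fun q : griffithsSpace => kap q.1) ⁻¹' Metric.ball (kap p) 1,
            EE n q r = X n (kap p) (ss r - ss q) := by
          intro q hq r hr
          unfold EE
          rw [if_pos ⟨hq.1, hr.1, (key q hq).trans (key r hr).symm⟩, key q hq]
        intro a ha b hb c hc _ _
        rw [key2 a ha b hb, key2 b hb c hc, key2 a ha c hc, X_add]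
        congr 1; ring
  · refine ⟨{q | 0 < q.1.1}, isOpen_lt continuous_const cx, hx, ?_⟩
    intro a ha b hb c hc _ _
    have : ∀ q : griffithsSpace, 0 < q.1.1 → ss q = 1 := fun q hq => by
      unfold ss; rw [if_pos hq.le]
    rw [EE_of_ss, EE_of_ss, EE_of_ss, one_mul] <;> rw [this _ ‹_›, this _ ‹_›]

open Heis Filter Topology

lemma kk_ne (c : ℕ) : kk c ≠ 0 := by unfold kk; split_ifs <;> omega

lemma kk_inj {c d : ℕ} (h : kk c = kk d) : c = d := by
  unfold kk at h; split_ifs at h <;> omega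

lemma kk_abs (c : ℕ) : ((c : ℝ) + 1) / 2 ≤ |(kk c : ℝ)| := by
  have : (c : ℤ) + 1 ≤ 2 * |kk c| := by
    unfold kk; split_ifs
    · rw [abs_of_nonneg (by omega)]; omega
    · rw [abs_of_nonpos (by omega)]; omega
  have : (c : ℝ) + 1 ≤ 2 * |(kk c : ℝ)| := by exact_mod_cast this
  linarith

lemma cont_floor (ρ : ℤ → ℝ) (g : ℝ → ℝ) (hg : Continuous g) (h0 : ∀ n : ℤ, g n = 0) :
    Continuous fun u : ℝ => ρ ⌊u⌋ * g u := by
  rw [continuous_iff_continuousAt]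
  intro u
  rcases (Int.floor_le u).eq_or_lt with h | h
  · have hgu : g u = 0 := by rw [← h]; exact h0 _
    have : Tendsto (fun x => ρ ⌊x⌋ * g x) (𝓝 u) (𝓝 0) := by
      apply bdd_le_mul_tendsto_zero' (|ρ ⌊u⌋| + |ρ (⌊u⌋ - 1)|)
      · have : Set.Ioo ((⌊u⌋ : ℝ) - 1) (⌊u⌋ + 1) ∈ 𝓝 u := Ioo_mem_nhds (by linarith) (by linarith)
        filter_upwards [this] with x hx
        rcases le_or_gt (⌊u⌋ : ℝ) x with h1 | h1
        · have : ⌊x⌋ = ⌊u⌋ := Int.floor_eq_iff.2 ⟨h1, hx.2⟩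
          rw [this]; linarith [abs_nonneg (ρ (⌊u⌋ - 1))]
        · have : ⌊x⌋ = ⌊u⌋ - 1 := Int.floor_eq_iff.2 ⟨by push_cast; linarith [hx.1], by push_cast; linarith⟩
          rw [this]; linarith [abs_nonneg (ρ (⌊u⌋))]
      · have := hg.tendsto u
        rwa [hgu] at this
    unfold ContinuousAt
    simpa only [hgu, mul_zero] using this
  · have : Set.Ioo (⌊u⌋ : ℝ) (⌊u⌋ + 1) ∈ 𝓝 u := Ioo_mem_nhds h (Int.lt_floor_add_one u)
    have h2 : (fun x => ρ ⌊u⌋ * g x) =ᶠ[𝓝 u] fun x => ρ ⌊x⌋ * g x := by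
      filter_upwards [this] with x hx
      have : ⌊x⌋ = ⌊u⌋ := Int.floor_eq_iff.2 ⟨hx.1.le, hx.2⟩
      rw [this]
    exact ContinuousAt.congr (by fun_prop) h2

noncomputable def uu (t : ℝ) : ℝ := t / (1 - t)
noncomputable def mm (t : ℝ) : ℕ := ⌊uu t⌋.toNat
noncomputable def lx (t : ℝ) : ℝ := -(1 / |(kk (mm t) : ℝ)|) * Real.sin (2 * Real.pi * uu t)
noncomputable def ly (t : ℝ) : ℝ := (1 / (kk (mm t) : ℝ)) * (1 - Real.cos (2 * Real.pi * uu t))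
noncomputable def gl (t : ℝ) : ℝ × ℝ × ℝ := (lx t, ly t, 0)

lemma kbound {t : ℝ} (h0 : 0 ≤ t) (h1 : t < 1) : 1 / |(kk (mm t) : ℝ)| ≤ 4 * (1 - t) := by
  have hu : 0 ≤ uu t := div_nonneg h0 (by linarith)
  have h2 := kk_abs (mm t)
  have h3 : uu t < mm t + 1 := by
    have : ((mm t : ℤ) : ℝ) = ⌊uu t⌋ := by
      unfold mm; rw [Int.toNat_of_nonneg (Int.floor_nonneg.2 hu)]
    have h4 := Int.lt_floor_add_one (uu t)
    rw [← this] at h4; exact_mod_cast h4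
  have h5 : 1 + uu t = 1 / (1 - t) := by unfold uu; field_simp [(by linarith : (1 - t) ≠ 0)]; ring
  have h6 : 1 / (1 - t) ≤ 4 * |(kk (mm t) : ℝ)| := by
    have : (0:ℝ) ≤ mm t := by positivity
    linarith
  have hp : 0 < |(kk (mm t) : ℝ)| := by
    have : (0:ℝ) ≤ mm t := by positivity
    linarith
  rw [div_le_iff₀ (by linarith)] at h6
  rw [div_le_iff₀ hp]
  linarith

lemma uu_one : uu 1 = 0 := by simp [uu]
lemma lx_one : lx 1 = 0 := by simp [lx, uu_one]
lemma ly_one : ly 1 = 0 := by simp [ly, uu_one]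
lemma lx_zero : lx 0 = 0 := by simp [lx, uu]
lemma ly_zero : ly 0 = 0 := by simp [ly, uu]

lemma cont_aux (f : ℝ → ℝ) (ρ : ℤ → ℝ) (g : ℝ → ℝ) (hg : Continuous g) (h0 : ∀ n : ℤ, g n = 0)
    (hf : ∀ t, f t = ρ ⌊uu t⌋ * g (uu t)) (hb : ∀ t, 0 ≤ t → t < 1 → |f t| ≤ 8 * (1 - t))
    (h1 : f 1 = 0) : ContinuousOn f (Set.Icc 0 1) := by
  intro t ht
  rcases ht.2.eq_or_lt with h | h
  · subst h
    unfold ContinuousWithinAt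
    rw [h1]
    apply squeeze_zero_norm' (a := fun t : ℝ => 8 * (1 - t))
    · filter_upwards [self_mem_nhdsWithin] with x hx
      rcases hx.2.eq_or_lt with h | h
      · subst h; simp [h1]
      · exact hb x hx.1 h
    · have : Tendsto (fun t : ℝ => 8 * (1 - t)) (𝓝 1) (𝓝 (8 * (1 - 1))) := by
        apply Continuous.tendsto (by fun_prop)
      simp at this
      exact tendsto_nhdsWithin_of_tendsto_nhds this
  · apply ContinuousAt.continuousWithinAt
    have : f = (fun u : ℝ => ρ ⌊u⌋ * g u) ∘ uu := funext hf
    rw [this]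
    apply ContinuousAt.comp
    · exact (cont_floor ρ g hg h0).continuousAt
    · unfold uu
      apply ContinuousAt.div <;> try fun_prop
      linarith

lemma cont_lx : ContinuousOn lx (Set.Icc 0 1) := by
  apply cont_aux lx (fun m => -(1 / |(kk m.toNat : ℝ)|)) (fun u => Real.sin (2 * Real.pi * u))
    (by fun_prop) _ (fun t => rfl) _ lx_one
  · intro n
    rw [show 2 * Real.pi * (n:ℝ) = 0 + n * (2 * Real.pi) by ring, Real.sin_add_int_mul_two_pi, Real.sin_zero]
  · intro t h0 h1
    have := kbound h0 h1
    have h2 := Real.abs_sin_le_one (2 * Real.pi * uu t)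
    have h3 : 0 ≤ 1 / |(kk (mm t) : ℝ)| := by positivity
    unfold lx
    rw [abs_mul, abs_neg, abs_of_nonneg h3]
    nlinarith [abs_nonneg (Real.sin (2 * Real.pi * uu t))]

lemma cont_ly : ContinuousOn ly (Set.Icc 0 1) := by
  apply cont_aux ly (fun m => (1 / (kk m.toNat : ℝ))) (fun u => 1 - Real.cos (2 * Real.pi * u))
    (by fun_prop) _ (fun t => rfl) _ ly_one
  · intro n
    rw [show 2 * Real.pi * (n:ℝ) = 0 + n * (2 * Real.pi) by ring, Real.cos_add_int_mul_two_pi, Real.cos_zero]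
    simp
  · intro t h0 h1
    have := kbound h0 h1
    have h2 := Real.cos_le_one (2 * Real.pi * uu t)
    have h2' := Real.neg_one_le_cos (2 * Real.pi * uu t)
    have h3 : 0 ≤ 1 / |(kk (mm t) : ℝ)| := by positivity
    unfold ly
    rw [abs_mul, abs_div, abs_one, abs_of_nonneg (by linarith : 0 ≤ 1 - Real.cos (2 * Real.pi * uu t))]
    nlinarith

lemma circ (t : ℝ) : (kk (mm t) : ℝ) * (lx t ^ 2 + ly t ^ 2) = 2 * ly t := by
  have h : (kk (mm t) : ℝ) ≠ 0 := by exact_mod_cast kk_ne _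
  have h2 : lx t ^ 2 = (1 / (kk (mm t) : ℝ)) ^ 2 * Real.sin (2 * Real.pi * uu t) ^ 2 := by
    unfold lx; rw [mul_pow, neg_sq, div_pow, sq_abs, div_pow]
  rw [h2, Real.sin_sq]
  unfold ly
  field_simp
  ring

lemma lp_mem (t : ℝ) : gl t ∈ griffithsSpace := by
  have h := circ t
  have hk := kk_ne (mm t)
  rcases lt_or_gt_of_ne hk with h1 | h1
  · right
    refine ⟨gl t, ?_, 0, by norm_num, by simp⟩
    have e : ((-kk (mm t)).toNat : ℝ) = -(kk (mm t) : ℝ) := by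
      have : ((-kk (mm t)).toNat : ℤ) = -(kk (mm t)) := by omega
      exact_mod_cast this
    refine Set.mem_iUnion₂.2 ⟨(-kk (mm t)).toNat, by omega, ?_, rfl⟩
    rw [e]
    have : (kk (mm t) : ℝ) ≠ 0 := by exact_mod_cast hk
    simp only [gl]
    field_simp
    linear_combination (kk (mm t) : ℝ) * h
  · left
    refine ⟨gl t, ?_, 0, by norm_num, by simp⟩
    have e : ((kk (mm t)).toNat : ℝ) = (kk (mm t) : ℝ) := by
      have : ((kk (mm t)).toNat : ℤ) = (kk (mm t)) := by omega
      exact_mod_cast this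
    refine Set.mem_iUnion₂.2 ⟨(kk (mm t)).toNat, by omega, ?_, rfl⟩
    rw [e]
    have : (kk (mm t) : ℝ) ≠ 0 := by exact_mod_cast hk
    simp only [gl]
    field_simp
    linear_combination (kk (mm t) : ℝ) * h

lemma kap_lp {t : ℝ} (hy : ly t ≠ 0) : kap (gl t) = kk (mm t) := by
  have h := circ t
  unfold kap gl
  simp only [abs_zero, sub_zero, mul_one]
  rw [div_eq_iff (by positivity), h]

lemma mm_floor {t : ℝ} (h0 : 0 ≤ t) (h1 : t < 1) : (mm t : ℝ) ≤ uu t ∧ uu t < mm t + 1 := by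
  have hu : 0 ≤ uu t := div_nonneg h0 (by linarith)
  have : ((mm t : ℤ) : ℝ) = ⌊uu t⌋ := by
    unfold mm; rw [Int.toNat_of_nonneg (Int.floor_nonneg.2 hu)]
  have h4 := Int.lt_floor_add_one (uu t)
  have h5 := Int.floor_le (uu t)
  rw [← this] at h4 h5
  exact ⟨by exact_mod_cast h5, by exact_mod_cast h4⟩

lemma uu_shift (t : ℝ) (m : ℕ) : Real.sin (2 * Real.pi * uu t) = Real.sin (2 * Real.pi * (uu t - m)) ∧
    Real.cos (2 * Real.pi * uu t) = Real.cos (2 * Real.pi * (uu t - m)) := by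
  have : 2 * Real.pi * uu t = 2 * Real.pi * (uu t - m) + m * (2 * Real.pi) := by ring
  rw [this]
  exact ⟨Real.sin_add_nat_mul_two_pi _ _, Real.cos_add_nat_mul_two_pi _ _⟩

lemma ss_lp {t : ℝ} (h0 : 0 ≤ t) (h1 : t ≤ 1) (hy : ly t ≠ 0) :
    0 ≤ lx t ↔ (2 * (mm t : ℝ) + 1) * (1 - t) ≤ 2 * t := by
  have h1' : t < 1 := lt_of_le_of_ne h1 (by rintro rfl; exact hy ly_one)
  obtain ⟨ha, hb⟩ := mm_floor h0 h1'
  have hpi := Real.pi_pos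
  obtain ⟨e1, e2⟩ := uu_shift t (mm t)
  have e3 : (2 * (mm t : ℝ) + 1) * (1 - t) ≤ 2 * t ↔ 1 / 2 ≤ uu t - mm t := by
    have : uu t * (1 - t) = t := by unfold uu; field_simp [(by linarith : (1 - t) ≠ 0)]
    constructor
    · intro h
      by_contra hc
      push Not at hc
      nlinarith
    · intro h; nlinarith
  have hf : 0 < uu t - mm t := by
    rcases ha.eq_or_lt with h | h
    · exfalso; apply hy; unfold ly; rw [e2, ← h]; simp
    · linarith
  have hk : 0 < 1 / |(kk (mm t) : ℝ)| := by
    have : (kk (mm t) : ℝ) ≠ 0 := by exact_mod_cast kk_ne _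
    positivity
  rw [e3]
  unfold lx
  rw [e1]
  constructor
  · intro h
    by_contra hc
    push Not at hc
    have : 0 < Real.sin (2 * Real.pi * (uu t - mm t)) := by
      apply Real.sin_pos_of_pos_of_lt_pi
      · positivity
      · nlinarith
    nlinarith
  · intro h
    have : Real.sin (2 * Real.pi * (uu t - mm t)) ≤ 0 := by
      rw [← Real.sin_sub_two_pi]
      apply Real.sin_nonpos_of_nonpos_of_neg_pi_le
      · nlinarith
      · nlinarith
    nlinarith

lemma T_lp {t : ℝ} {m : ℕ} (h0 : 0 ≤ t) (h1 : t < 1) (ha : m + 1 / 4 < uu t) (hb : uu t < m + 3 / 4) :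
    mm t = m ∧ |lx t| < |ly t| := by
  have hpi := Real.pi_pos
  have hm : mm t = m := by
    unfold mm
    have : ⌊uu t⌋ = (m : ℤ) := Int.floor_eq_iff.2 ⟨by push_cast; linarith, by push_cast; linarith⟩
    rw [this]; simp
  refine ⟨hm, ?_⟩
  obtain ⟨e1, e2⟩ := uu_shift t m
  have hk : 0 < 1 / |(kk (mm t) : ℝ)| := by
    have : (kk (mm t) : ℝ) ≠ 0 := by exact_mod_cast kk_ne _
    positivity
  have hc : Real.cos (2 * Real.pi * (uu t - m)) < 0 := by
    apply Real.cos_neg_of_pi_div_two_lt_of_lt <;> nlinarith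
  have hs := Real.abs_sin_le_one (2 * Real.pi * uu t)
  unfold lx ly
  rw [abs_mul, abs_neg, abs_mul, abs_div, abs_div, abs_one, abs_abs]
  apply mul_lt_mul_of_pos_left _ hk
  rw [e2, abs_of_pos (by linarith : 0 < 1 - Real.cos (2 * Real.pi * (uu t - m)))]
  linarith

lemma abs_ne {a b : ℝ} (h : |a| < |b|) : b ≠ 0 := abs_pos.1 (lt_of_le_of_lt (abs_nonneg _) h)

lemma kk_big {n m : ℕ} (h : 2 * n ≤ m) : (n : ℝ) < |(kk m : ℝ)| := by
  have : (n : ℤ) < |kk m| := by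
    unfold kk; split_ifs
    · rw [abs_of_nonneg (by omega)]; omega
    · rw [abs_of_nonpos (by omega)]; omega
  exact_mod_cast this

lemma step_none {n : ℕ} {t t' : ℝ} (h0 : 0 ≤ t) (htt : t ≤ t') (h1 : t' ≤ 1)
    (H : ∀ m < 2 * n, (2 * (m : ℝ) + 1) * (1 - t') ≤ 2 * t' → (2 * (m : ℝ) + 1) * (1 - t) ≤ 2 * t) :
    EE n (gl t) (gl t') = 1 := by
  unfold EE
  split_ifs with h
  · obtain ⟨ha, hb, hc⟩ := h
    have hya : ly t ≠ 0 := abs_ne ha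
    have hyb : ly t' ≠ 0 := abs_ne hb
    rw [kap_lp hya, kap_lp hyb] at hc
    have hm : mm t = mm t' := kk_inj (by exact_mod_cast hc)
    rw [kap_lp hya]
    by_cases hbig : 2 * n ≤ mm t
    · exact X_big _ _ (kk_big hbig)
    · have hs := ss_lp h0 (by linarith) hya
      have hs' := ss_lp (by linarith) h1 hyb
      have hmono : (2 * (mm t : ℝ) + 1) * (1 - t) ≤ 2 * t → (2 * (mm t : ℝ) + 1) * (1 - t') ≤ 2 * t' := by
        intro h
        have : (0:ℝ) ≤ mm t := by positivity
        nlinarith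
      have : 0 ≤ lx t ↔ 0 ≤ lx t' := by
        rw [hs, hs', ← hm]
        exact ⟨hmono, H _ (by omega)⟩
      have e : ss (gl t') = ss (gl t) := by
        unfold ss gl
        simp only [this]
      rw [e, sub_self, X_zero]
  · rfl

lemma step_one {n m : ℕ} {t t' : ℝ} (h0 : 0 ≤ t) (h1 : t' ≤ 1) (hm : m < 2 * n)
    (hd : t' - t < 1 / (4 * (2 * (n : ℝ) + 1) ^ 2))
    (ht : 2 * t < (2 * (m : ℝ) + 1) * (1 - t)) (ht' : (2 * (m : ℝ) + 1) * (1 - t') ≤ 2 * t') :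
    EE n (gl t) (gl t') = X n (kk m) 1 ∧ 2 * t' < (2 * ((m : ℝ) + 1) + 1) * (1 - t') := by
  have hm0 : (0 : ℝ) ≤ m := by positivity
  have hmn : (m : ℝ) + 1 ≤ 2 * n := by exact_mod_cast hm
  have hdd : (t' - t) * (4 * ((m : ℝ) + 2) ^ 2) < 1 := by
    rw [lt_div_iff₀ (by positivity)] at hd
    rcases le_or_gt (t' - t) 0 with h | h
    · have : 0 ≤ 4 * ((m : ℝ) + 2) ^ 2 := by positivity
      nlinarith
    · refine lt_of_le_of_lt (mul_le_mul_of_nonneg_left ?_ h.le) hd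
      nlinarith
  have htt : t < t' := by nlinarith
  -- bounds on the two parameters
  have q1 : (m + 1 / 4) * (1 - t) < t := by nlinarith
  have q2 : t' < (m + 3 / 4) * (1 - t') := by nlinarith
  have ht'1 : t' < 1 := by nlinarith
  have b1 : m + 1 / 4 < uu t ∧ uu t < m + 1 / 2 := by
    unfold uu
    rw [lt_div_iff₀ (by linarith), div_lt_iff₀ (by linarith)]
    exact ⟨q1, by linarith⟩
  have b2 : m + 1 / 2 ≤ uu t' ∧ uu t' < m + 3 / 4 := by
    unfold uu
    rw [le_div_iff₀ (by linarith), div_lt_iff₀ (by linarith)]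
    exact ⟨by linarith, q2⟩
  obtain ⟨m1, T1⟩ := T_lp h0 (by linarith) b1.1 (by linarith)
  obtain ⟨m2, T2⟩ := T_lp (by linarith) ht'1 (by linarith) b2.2
  have s1 := ss_lp h0 (by linarith) (abs_ne T1)
  have s2 := ss_lp (by linarith) h1 (abs_ne T2)
  rw [m1] at s1
  rw [m2] at s2
  refine ⟨?_, by nlinarith⟩
  have k1 := kap_lp (abs_ne T1)
  have k2 := kap_lp (abs_ne T2)
  unfold EE
  rw [if_pos ⟨T1, T2, by rw [k1, k2, m1, m2]⟩, k1, m1]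
  have e1 : ss (gl t) = 0 := by
    unfold ss; rw [if_neg]; intro h; exact absurd (s1.1 h) (by linarith)
  have e2 : ss (gl t') = 1 := by
    unfold ss; rw [if_pos]; exact s2.2 ht'
  rw [e1, e2, sub_zero]

lemma loop_word (n K : ℕ) (hK : 0 < K) (hd : 1 / (K : ℝ) < 1 / (4 * (2 * (n : ℝ) + 1) ^ 2)) :
    pr (fun j => EE n (gl (j / K)) (gl ((j + 1 : ℕ) / K))) K = pr (fun c => X n (kk c) 1) (2 * n) := by
  have hK' : (0 : ℝ) < K := by exact_mod_cast hK
  have key : ∀ j ≤ K, ∃ c ≤ 2 * n,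
      pr (fun j => EE n (gl (j / K)) (gl ((j + 1 : ℕ) / K))) j = pr (fun c => X n (kk c) 1) c ∧
      ∀ m < 2 * n, ((2 * (m : ℝ) + 1) * (1 - (j / K : ℝ)) ≤ 2 * (j / K : ℝ) ↔ m < c) := by
    intro j
    induction j with
    | zero =>
      intro _
      refine ⟨0, by omega, rfl, ?_⟩
      intro m _
      have : (0 : ℝ) ≤ m := by positivity
      simp; linarith
    | succ j ih =>
      intro hj
      obtain ⟨c, hc, hpr, hm⟩ := ih (by omega)
      set t : ℝ := j / K with ht
      set t' : ℝ := (j + 1 : ℕ) / K with ht'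
      have htt : t' - t = 1 / K := by rw [ht, ht']; push_cast; ring
      have hpos : 0 < 1 / (K : ℝ) := by positivity
      have h0 : 0 ≤ t := by positivity
      have h1 : t' ≤ 1 := by rw [ht', div_le_one hK']; exact_mod_cast hj
      by_cases hcase : c < 2 * n ∧ (2 * (c : ℝ) + 1) * (1 - t') ≤ 2 * t'
      · have hct : 2 * t < (2 * (c : ℝ) + 1) * (1 - t) := by
          by_contra h
          push Not at h
          exact absurd ((hm c hcase.1).1 h) (lt_irrefl _)
        obtain ⟨hE, hnext⟩ := step_one h0 h1 hcase.1 (by rw [htt]; exact hd) hct hcase.2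
        refine ⟨c + 1, by omega, ?_, ?_⟩
        · simp only [pr]
          rw [hpr, ← ht, ← ht', hE]
        · intro m hm2
          constructor
          · intro h
            by_contra hcm
            have : (c : ℝ) + 1 ≤ m := by exact_mod_cast (by omega : c + 1 ≤ m)
            nlinarith
          · intro h
            have : (m : ℝ) ≤ c := by exact_mod_cast (by omega : m ≤ c)
            have := hcase.2
            nlinarith
      · have hno : ∀ m < 2 * n, (2 * (m : ℝ) + 1) * (1 - t') ≤ 2 * t' → m < c := by
          intro m hm2 h
          by_contra hcm
          apply hcase
          have : (c : ℝ) ≤ m := by exact_mod_cast (by omega : c ≤ m)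
          exact ⟨by omega, by nlinarith⟩
        refine ⟨c, hc, ?_, ?_⟩
        · simp only [pr]
          rw [hpr, ← ht, ← ht', step_none h0 (by linarith) h1, mul_one]
          intro m hm2 h
          exact (hm m hm2).2 (hno m hm2 h)
        · intro m hm2
          refine ⟨hno m hm2, fun h => ?_⟩
          have h5 := (hm m hm2).2 h
          have : (0 : ℝ) ≤ m := by positivity
          nlinarith
  obtain ⟨c, hc, h1, h2⟩ := key K le_rfl
  rw [h1]
  congr 1
  by_contra hne
  have := (h2 c (by omega)).1 (by rw [div_self hK'.ne']; norm_num)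
  omega

open Heis Filter Topology

lemma leb (P : Set (ℝ × ℝ) → Prop) (hp : ∀ x, ∃ O, IsOpen O ∧ x ∈ O ∧ P O) :
    ∃ δ > 0, ∀ x ∈ Set.Icc (0:ℝ) 1 ×ˢ Set.Icc (0:ℝ) 1, ∃ O, P O ∧ Metric.ball x δ ⊆ O := by
  obtain ⟨δ, hδ, h⟩ := lebesgue_number_lemma_of_metric_sUnion
    (s := Set.Icc (0:ℝ) 1 ×ˢ Set.Icc (0:ℝ) 1) (c := {O | IsOpen O ∧ P O})
    (isCompact_Icc.prod isCompact_Icc) (fun t ht => ht.1) (by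
      intro x _
      obtain ⟨O, h1, h2, h3⟩ := hp x
      exact ⟨O, ⟨h1, h3⟩, h2⟩)
  refine ⟨δ, hδ, fun x hx => ?_⟩
  obtain ⟨O, h1, h2⟩ := h x hx
  exact ⟨O, h1.2, h2⟩

lemma near_of_eq {n : ℕ} {g h : Heis n} (e : g = h) : near 0 g h := e ▸ near_refl _

lemma no_homotopy (F : ℝ × ℝ → griffithsSpace) (hF : Continuous F)
    (h0 : ∀ t ∈ Set.Icc (0:ℝ) 1, (F (0, t)).1 = gl t)
    (h1 : ∀ t ∈ Set.Icc (0:ℝ) 1, (F (1, t)).1 = (0, 0, 0))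
    (h2 : ∀ s ∈ Set.Icc (0:ℝ) 1, (F (s, 0)).1 = (0, 0, 0))
    (h3 : ∀ s ∈ Set.Icc (0:ℝ) 1, (F (s, 1)).1 = (0, 0, 0)) : False := by
  have hz : Continuous fun x => (F x).1.2.2 := by fun_prop
  obtain ⟨δ₁, hδ₁, L1⟩ := leb (fun O => (∀ x ∈ O, |(F x).1.2.2| ≤ 3 / 4) ∨
      (∀ x ∈ O, 0 < (F x).1.2.2) ∨ (∀ x ∈ O, (F x).1.2.2 < 0)) (by
    intro x
    rcases lt_trichotomy (F x).1.2.2 0 with h | h | h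
    · exact ⟨{y | (F y).1.2.2 < 0}, isOpen_lt hz continuous_const, h, Or.inr (Or.inr fun y hy => hy)⟩
    · refine ⟨{y | |(F y).1.2.2| < 3 / 4}, isOpen_lt hz.abs continuous_const, ?_,
        Or.inl fun y hy => le_of_lt hy⟩
      show |(F x).1.2.2| < 3 / 4
      rw [h]; norm_num
    · exact ⟨{y | 0 < (F y).1.2.2}, isOpen_lt continuous_const hz, h, Or.inr (Or.inl fun y hy => hy)⟩)
  obtain ⟨N', hN'⟩ := exists_nat_one_div_lt hδ₁
  set N := N' + 1 with hN
  have hNδ : 1 / (N : ℝ) < δ₁ := by rw [hN]; push_cast; exact hN'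
  have hNpos : (0 : ℝ) < N := by rw [hN]; positivity
  set n := N * N + 1 with hn
  obtain ⟨δ₂, hδ₂, L2⟩ := leb (fun O => ∀ a ∈ O, ∀ b ∈ O, ∀ c ∈ O, |(F a).1.2.2| ≤ 3 / 4 →
      |(F b).1.2.2| ≤ 3 / 4 → EE n (F a) (F b) * EE n (F b) (F c) = EE n (F a) (F c)) (by
    intro x
    obtain ⟨O, ho, hx, hg⟩ := good n (by omega) (F x)
    exact ⟨F ⁻¹' O, ho.preimage hF, hx, fun a ha b hb c hc => hg _ ha _ hb _ hc⟩)
  obtain ⟨M', hM'⟩ := exists_nat_one_div_lt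
    (lt_min hδ₂ (by positivity : 0 < 1 / (4 * (2 * (n : ℝ) + 1) ^ 2)))
  set M := M' + 1 with hM
  have hMpos : (0 : ℝ) < M := by rw [hM]; positivity
  set K := N * M with hK
  have hKpos : (0 : ℝ) < K := by rw [hK]; push_cast; positivity
  have hKn : 0 < K := by exact_mod_cast hKpos
  have hKM : 1 / (K : ℝ) < min δ₂ (1 / (4 * (2 * (n : ℝ) + 1) ^ 2)) := by
    refine lt_of_le_of_lt ?_ hM'
    rw [show (M' : ℝ) + 1 = M by rw [hM]; push_cast; rfl]
    apply one_div_le_one_div_of_le hMpos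
    rw [hK]
    exact_mod_cast Nat.le_mul_of_pos_left M (by omega)
  set g : ℕ → ℕ → ℝ × ℝ := fun i j => ((i : ℝ) / K, (j : ℝ) / K) with hg
  set h : ℕ → ℕ → Heis n := fun i j => EE n (F (g i j)) (F (g i (j + 1))) with hh
  set v : ℕ → ℕ → Heis n := fun i j => EE n (F (g i j)) (F (g (i + 1) j)) with hv
  have unit_mem : ∀ i ≤ K, (i : ℝ) / K ∈ Set.Icc (0:ℝ) 1 := fun i hi =>
    ⟨by positivity, (div_le_one hKpos).2 (by exact_mod_cast hi)⟩
  -- coarse blocks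
  have block : ∀ I < N, ∀ J < N, near 1
      (pr (fun j => h (I * M) (J * M + j)) M * pr (fun i => v (I * M + i) ((J + 1) * M)) M)
      (pr (fun i => v (I * M + i) (J * M)) M * pr (fun j => h ((I + 1) * M) (J * M + j)) M) := by
    intro I hI J hJ
    have cmem : ∀ I < N, I * M ≤ K := fun I hI => Nat.mul_le_mul_right M hI.le
    obtain ⟨O, hO, hb⟩ := L1 (g (I * M) (J * M)) ⟨unit_mem _ (cmem I hI), unit_mem _ (cmem J hJ)⟩
    have hgO : ∀ i ≤ M, ∀ j ≤ M, g (I * M + i) (J * M + j) ∈ O := by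
      intro i hi j hj
      apply hb
      have aux : ∀ (I i : ℕ), i ≤ M → dist (((I * M + i : ℕ) : ℝ) / K) (((I * M : ℕ) : ℝ) / K) < δ₁ := by
        intro I i hi
        rw [Real.dist_eq, ← sub_div]
        push_cast
        rw [add_sub_cancel_left, abs_of_nonneg (by positivity)]
        refine lt_of_le_of_lt ?_ hNδ
        rw [hK]; push_cast
        rw [div_le_div_iff₀ (by positivity) hNpos]
        have : (i : ℝ) ≤ M := by exact_mod_cast hi
        nlinarith
      rw [Metric.mem_ball, Prod.dist_eq]
      exact max_lt (aux I i hi) (aux J j hj)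
    rcases hO with hO | hO | hO
    · have key := grid (C := 0) (fun i j => h (I * M + i) (J * M + j))
        (fun i j => v (I * M + i) (J * M + j)) M M (by
          intro i hi j hj
          apply near_of_eq
          have iK : I * M + i ≤ K := by
            have : (I + 1) * M ≤ K := Nat.mul_le_mul_right M hI
            rw [add_mul] at this; omega
          have jK : J * M + j ≤ K := by
            have : (J + 1) * M ≤ K := Nat.mul_le_mul_right M hJ
            rw [add_mul] at this; omega
          obtain ⟨O', hO', hb'⟩ := L2 (g (I * M + i) (J * M + j)) ⟨unit_mem _ iK, unit_mem _ jK⟩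
          have d0 : ∀ i : ℕ, dist ((i : ℝ) / K) ((i : ℝ) / K) < δ₂ := fun i => by simpa using hδ₂
          have d1 : ∀ i : ℕ, dist (((i + 1 : ℕ) : ℝ) / K) ((i : ℝ) / K) < δ₂ := fun i => by
            rw [Real.dist_eq, ← sub_div]
            push_cast
            rw [add_sub_cancel_left, abs_of_nonneg (by positivity)]
            exact lt_of_lt_of_le hKM (min_le_left _ _)
          have m00 : g (I * M + i) (J * M + j) ∈ O' := hb' (by
            rw [Metric.mem_ball, Prod.dist_eq]; exact max_lt (d0 _) (d0 _))
          have m01 : g (I * M + i) (J * M + j + 1) ∈ O' := hb' (by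
            rw [Metric.mem_ball, Prod.dist_eq]; exact max_lt (d0 _) (d1 _))
          have m10 : g (I * M + i + 1) (J * M + j) ∈ O' := hb' (by
            rw [Metric.mem_ball, Prod.dist_eq]; exact max_lt (d1 _) (d0 _))
          have m11 : g (I * M + i + 1) (J * M + j + 1) ∈ O' := hb' (by
            rw [Metric.mem_ball, Prod.dist_eq]; exact max_lt (d1 _) (d1 _))
          have z00 := hO _ (hgO i (by omega) j (by omega))
          have z01 := hO _ (hgO i (by omega) (j + 1) (by omega))
          have z10 := hO _ (hgO (i + 1) (by omega) j (by omega))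
          have e1 := hO' _ m00 _ m01 _ m11 z00 z01
          have e2 := hO' _ m00 _ m10 _ m11 z00 z10
          exact e1.trans e2.symm)
      simp only [add_zero, zero_mul] at key
      rw [add_mul, add_mul, one_mul]
      exact key.mono (by omega)
    · have hp : ∀ i ≤ M, ∀ j ≤ M, ∀ q, (EE n (F (g (I * M + i) (J * M + j))) q).be = 0 ∧
          (EE n (F (g (I * M + i) (J * M + j))) q).Z = 0 := fun i hi j hj q =>
        EE_pos (F _).2 (hO _ (hgO i hi j hj))
      have hmul : ∀ x y : Heis n, x.be = 0 ∧ x.Z = 0 → y.be = 0 ∧ y.Z = 0 →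
          (x * y).be = 0 ∧ (x * y).Z = 0 := by
        rintro x y ⟨a, b⟩ ⟨c, d⟩
        simp [a, b, c, d]
      have hpr := pr_prop (fun x : Heis n => x.be = 0 ∧ x.Z = 0) ⟨rfl, rfl⟩ hmul
      have a1 := hmul _ _ (hpr (fun j => h (I * M) (J * M + j)) M
          (fun j hj => hp 0 (by omega) j hj.le _))
        (hpr (fun i => v (I * M + i) ((J + 1) * M)) M
          (fun i hi => by rw [add_mul, one_mul]; exact hp i hi.le M le_rfl _))
      have a2 := hmul _ _ (hpr (fun i => v (I * M + i) (J * M)) M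
          (fun i hi => hp i hi.le 0 (by omega) _))
        (hpr (fun j => h ((I + 1) * M) (J * M + j)) M
          (fun j hj => by rw [add_mul, one_mul]; exact hp M le_rfl j hj.le _))
      exact near_of_be a1.1 a1.2 a2.1 a2.2
    · have hp : ∀ i ≤ M, ∀ j ≤ M, ∀ q, (EE n (F (g (I * M + i) (J * M + j))) q).al = 0 ∧
          (EE n (F (g (I * M + i) (J * M + j))) q).Z = 0 := fun i hi j hj q =>
        EE_neg (F _).2 (hO _ (hgO i hi j hj))
      have hmul : ∀ x y : Heis n, x.al = 0 ∧ x.Z = 0 → y.al = 0 ∧ y.Z = 0 →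
          (x * y).al = 0 ∧ (x * y).Z = 0 := by
        rintro x y ⟨a, b⟩ ⟨c, d⟩
        simp [a, b, c, d]
      have hpr := pr_prop (fun x : Heis n => x.al = 0 ∧ x.Z = 0) ⟨rfl, rfl⟩ hmul
      have a1 := hmul _ _ (hpr (fun j => h (I * M) (J * M + j)) M
          (fun j hj => hp 0 (by omega) j hj.le _))
        (hpr (fun i => v (I * M + i) ((J + 1) * M)) M
          (fun i hi => by rw [add_mul, one_mul]; exact hp i hi.le M le_rfl _))
      have a2 := hmul _ _ (hpr (fun i => v (I * M + i) (J * M)) M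
          (fun i hi => hp i hi.le 0 (by omega) _))
        (hpr (fun j => h ((I + 1) * M) (J * M + j)) M
          (fun j hj => by rw [add_mul, one_mul]; exact hp M le_rfl j hj.le _))
      exact near_of_al a1.1 a1.2 a2.1 a2.2
  have big := grid (C := 1) (fun I J => pr (fun j => h (I * M) (J * M + j)) M)
    (fun I J => pr (fun i => v (I * M + i) (J * M)) M) N N block
  rw [← pr_mul (h (0 * M)) N M, ← pr_mul (h (N * M)) N M,
    ← pr_mul (fun i => v i (N * M)) N M, ← pr_mul (fun i => v i (0 * M)) N M, zero_mul, ← hK] at big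
  have w1 : pr (h 0) K = pr (fun c => X n (kk c) 1) (2 * n) := by
    rw [← loop_word n K hKn (lt_of_lt_of_le hKM (min_le_right _ _))]
    have : ∀ L ≤ K, pr (h 0) L = pr (fun j => EE n (gl (j / K)) (gl ((j + 1 : ℕ) / K))) L := by
      intro L
      induction L with
      | zero => intro _; rfl
      | succ L ih =>
        intro hL
        simp only [pr]
        rw [ih (by omega)]
        congr 1
        simp only [hh, hg]
        rw [Nat.cast_zero, zero_div, h0 _ (unit_mem L (by omega)), h0 _ (unit_mem (L + 1) hL)]
    exact this K le_rfl
  have w2 : pr (h K) K = 1 := by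
    apply pr_one
    intro j hj
    simp only [hh, hg]
    rw [div_self hKpos.ne', h1 _ (unit_mem j (by omega)), h1 _ (unit_mem (j + 1) hj)]
    exact EE_of_ss rfl
  have w3 : pr (fun i => v i K) K = 1 := by
    apply pr_one
    intro j hj
    simp only [hv, hg]
    rw [div_self hKpos.ne', h3 _ (unit_mem j (by omega)), h3 _ (unit_mem (j + 1) hj)]
    exact EE_of_ss rfl
  have w4 : pr (fun i => v i 0) K = 1 := by
    apply pr_one
    intro j hj
    simp only [hv, hg]
    rw [Nat.cast_zero, zero_div, h2 _ (unit_mem j (by omega)), h2 _ (unit_mem (j + 1) hj)]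
    exact EE_of_ss rfl
  rw [w1, w2, w3, w4] at big
  have fin := big 1 1
  simp only [one_mul, mul_one, one_Z, sub_zero] at fin
  rw [Q_rank] at fin
  omega

lemma starPlus : StarConvex ℝ ((0, 0, 1) : ℝ × ℝ × ℝ) (cone hawaiianPlus (0, 0, 1)) := by
  rintro y ⟨a, ha, t, ⟨ht0, ht1⟩, rfl⟩ c d hc hd hcd
  refine ⟨a, ha, c + d * t, ⟨by positivity, by nlinarith⟩, ?_⟩
  obtain rfl : c = 1 - d := by linarith
  module

lemma starMinus : StarConvex ℝ ((0, 0, -1) : ℝ × ℝ × ℝ) (cone hawaiianMinus (0, 0, -1)) := by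
  rintro y ⟨a, ha, t, ⟨ht0, ht1⟩, rfl⟩ c d hc hd hcd
  refine ⟨a, ha, c + d * t, ⟨by positivity, by nlinarith⟩, ?_⟩
  obtain rfl : c = 1 - d := by linarith
  module

lemma zero_memPlus : ((0, 0, 0) : ℝ × ℝ × ℝ) ∈ cone hawaiianPlus (0, 0, 1) := by
  refine ⟨(0, 0, 0), ?_, 0, by norm_num, ?_⟩
  · refine Set.mem_iUnion₂.2 ⟨1, le_refl 1, ?_⟩
    norm_num
  · simp [Prod.ext_iff]

lemma zero_memMinus : ((0, 0, 0) : ℝ × ℝ × ℝ) ∈ cone hawaiianMinus (0, 0, -1) := by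
  refine ⟨(0, 0, 0), ?_, 0, by norm_num, ?_⟩
  · refine Set.mem_iUnion₂.2 ⟨1, le_refl 1, ?_⟩
    norm_num
  · simp [Prod.ext_iff]

lemma inter_eq : cone hawaiianPlus (0, 0, 1) ∩ cone hawaiianMinus (0, 0, -1) = {(0, 0, 0)} := by
  ext p
  constructor
  · rintro ⟨hp, hm⟩
    obtain ⟨a1, a2, a3, k, hk, e⟩ := mem_plus hp
    obtain ⟨b1, b2, b3, -⟩ := mem_minus hm
    have hz : p.2.2 = 0 := le_antisymm b1 a1
    have hy : p.2.1 = 0 := le_antisymm b2 a2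
    rw [hy] at e
    have hk' : (k : ℝ) ≠ 0 := by exact_mod_cast (by omega : k ≠ 0)
    have hx : p.1 = 0 := by simpa [hk'] using e
    exact Prod.ext hx (Prod.ext hy hz)
  · rintro rfl
    exact ⟨zero_memPlus, zero_memMinus⟩

noncomputable def griffithsLoop : Path (⟨(0, 0, 0), origin_mem_griffithsSpace⟩ : griffithsSpace)
    ⟨(0, 0, 0), origin_mem_griffithsSpace⟩ where
  toFun t := ⟨gl t, lp_mem t⟩
  continuous_toFun := by
    apply Continuous.subtype_mk
    have c1 : Continuous fun t : unitInterval => lx t := continuousOn_iff_continuous_restrict.1 cont_lx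
    have c2 : Continuous fun t : unitInterval => ly t := continuousOn_iff_continuous_restrict.1 cont_ly
    exact c1.prodMk (c2.prodMk continuous_const)
  source' := by
    apply Subtype.ext
    simp [gl, lx_zero, ly_zero]
  target' := by
    apply Subtype.ext
    simp [gl, lx_one, ly_one]

lemma griffithsLoop_not_null : ¬ griffithsLoop.Homotopic (Path.refl _) := by
  rintro ⟨H⟩
  have pI : ∀ t (ht : t ∈ Set.Icc (0:ℝ) 1), Set.projIcc (0:ℝ) 1 zero_le_one t = ⟨t, ht⟩ :=
    fun t ht => Set.projIcc_of_mem zero_le_one ht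
  have p0 : Set.projIcc (0:ℝ) 1 zero_le_one 0 = (0 : unitInterval) := Set.projIcc_left _
  have p1 : Set.projIcc (0:ℝ) 1 zero_le_one 1 = (1 : unitInterval) := Set.projIcc_right _
  have pc : Continuous (Set.projIcc (0:ℝ) 1 zero_le_one) := continuous_projIcc
  refine no_homotopy (fun x => H (Set.projIcc 0 1 zero_le_one x.1, Set.projIcc 0 1 zero_le_one x.2))
    (H.continuous.comp ((pc.comp continuous_fst).prodMk (pc.comp continuous_snd))) ?_ ?_ ?_ ?_
  · intro t ht
    simp only [p0, pI t ht]
    rw [H.apply_zero]; rfl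
  · intro t ht
    simp only [p1, pI t ht]
    rw [H.apply_one]; rfl
  · intro s hs
    simp only [p0]
    rw [H.source]
  · intro s hs
    simp only [p1]
    rw [H.target]

/-- The fundamental group of the Griffiths space based at the origin is nontrivial, even
though the Griffiths space is the union of the two contractible cones over `ℍ₊` and `ℍ₋`,
which meet exactly in the single point `(0,0,0)`. -/
theorem fundamentalGroup_griffithsSpace_nontrivial :
    ContractibleSpace (cone hawaiianPlus (0, 0, 1)) ∧
    ContractibleSpace (cone hawaiianMinus (0, 0, -1)) ∧
    cone hawaiianPlus (0, 0, 1) ∩ cone hawaiianMinus (0, 0, -1) = {(0, 0, 0)} ∧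
    Nontrivial (FundamentalGroup griffithsSpace
      ⟨(0, 0, 0), origin_mem_griffithsSpace⟩) := by
  refine ⟨starPlus.contractibleSpace ⟨_, zero_memPlus⟩,
    starMinus.contractibleSpace ⟨_, zero_memMinus⟩, inter_eq, ?_⟩
  by_contra hcon
  rw [not_nontrivial_iff_subsingleton] at hcon
  have e : (Path.Homotopic.Quotient.mk griffithsLoop : FundamentalGroup griffithsSpace
      ⟨(0, 0, 0), origin_mem_griffithsSpace⟩) = Path.Homotopic.Quotient.mk (Path.refl _) :=
    hcon.elim _ _
  exact griffithsLoop_not_null (Path.Homotopic.Quotient.exact e)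
end
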